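/- For every fixed ε > 0 there is a constant C = C(ε) such that for all x ≥ 2 one has |N(x) − c₀·x| ≤ C·x^{ϖ+ε}, where ϖ = (26 + √433)/81 = 0.57788…, N(x) is the number of positive integers n ≤ x for which n²+1 is squarefree, and c₀ = ∏_{p prime, p ≡ 1 (mod 4)} (1 − 2p^{-2}). -/

import Mathlib

/-- `c₀ = ∏_{p prime, p ≡ 1 (mod 4)} (1 − 2 p⁻²)`. -/
noncomputable def squarefreeConstant : ℝ :=
  ∏' p : {p : ℕ // p.Prime ∧ p % 4 = 1}, (1 - 2 / (p : ℝ) ^ 2)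

/-- `N(x)`: the number of positive integers `n ≤ x` with `n² + 1` squarefree. -/
noncomputable def countSquarefreeVals (x : ℝ) : ℕ :=
  ((Finset.Icc 1 ⌊x⌋₊).filter (fun n => Squarefree (n ^ 2 + 1))).card

/-- `ϖ = (26 + √433)/81 = 0.57788…`. -/
noncomputable def varpi : ℝ := (26 + Real.sqrt 433) / 81


namespace SFV
open Finset

lemma prod_bound (ε : ℝ) (hε : 0 < ε) : ∃ Y : ℕ, ∃ c : ℝ, 1 ≤ c ∧
    ∀ (ι : Type) (T : Finset ι) (N e : ι → ℕ) (k : ℕ), (∀ t ∈ T, 2 ≤ N t) →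
      (T.filter (fun t => N t < Y)).card ≤ k →
      (∏ t ∈ T, ((e t : ℝ) + 1)) ≤ c ^ k * ∏ t ∈ T, ((N t : ℝ) ^ (e t)) ^ ε := by
  refine ⟨⌈(2:ℝ) ^ (1/ε)⌉₊, max 1 (1 / (ε * Real.log 2)), le_max_left _ _, ?_⟩
  intro ι T N e k hN hk
  set c : ℝ := max 1 (1 / (ε * Real.log 2)) with hc
  set Y := ⌈(2:ℝ) ^ (1/ε)⌉₊ with hY
  have hc1 : 1 ≤ c := le_max_left _ _
  have hl2 : 0 < Real.log 2 := Real.log_pos (by norm_num)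
  have key : ∀ t ∈ T, ((e t : ℝ) + 1) ≤ (if N t < Y then c else 1) * ((N t : ℝ) ^ (e t)) ^ ε := by
    intro t ht
    have h2 : (2:ℝ) ≤ N t := by exact_mod_cast hN t ht
    split_ifs with h
    · have h1 : (2:ℝ) ^ (ε * e t) ≤ ((N t : ℝ) ^ (e t)) ^ ε := by
        rw [mul_comm, Real.rpow_mul (by norm_num), Real.rpow_natCast]
        gcongr
      have h3 : 1 + ε * Real.log 2 * e t ≤ (2:ℝ) ^ (ε * e t) := by
        rw [Real.rpow_def_of_pos (by norm_num)]
        have := Real.add_one_le_exp (Real.log 2 * (ε * e t))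
        linarith
      have h4 : 1 ≤ c * (ε * Real.log 2) := by
        have : 1 / (ε * Real.log 2) ≤ c := le_max_right _ _
        rwa [div_le_iff₀ (by positivity)] at this
      have he : (0:ℝ) ≤ e t := by positivity
      calc (e t : ℝ) + 1 ≤ c * (1 + ε * Real.log 2 * e t) := by nlinarith
        _ ≤ _ := by gcongr; exact h3.trans h1
    · have h1 : (2:ℝ) ^ (1/ε) ≤ N t := by
        push Not at h
        exact (Nat.le_ceil _).trans (by exact_mod_cast h)
      have h3 : (2:ℝ) ^ (e t) ≤ ((N t : ℝ) ^ (e t)) ^ ε := by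
        calc (2:ℝ) ^ (e t) = (((2:ℝ) ^ (1/ε)) ^ (e t)) ^ ε := by
              rw [← Real.rpow_natCast, ← Real.rpow_natCast, ← Real.rpow_mul (by positivity),
                ← Real.rpow_mul (by positivity)]
              congr 1
              field_simp
          _ ≤ _ := by gcongr
      have h4 : ((e t : ℝ) + 1) ≤ (2:ℝ) ^ (e t) := by
        exact_mod_cast Nat.lt_two_pow_self
      linarith
  calc (∏ t ∈ T, ((e t : ℝ) + 1)) ≤ ∏ t ∈ T, ((if N t < Y then c else 1) * ((N t : ℝ) ^ (e t)) ^ ε) :=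
        Finset.prod_le_prod (fun t _ => by positivity) key
    _ = (∏ t ∈ T, (if N t < Y then c else 1)) * ∏ t ∈ T, ((N t : ℝ) ^ (e t)) ^ ε := by
        rw [Finset.prod_mul_distrib]
    _ ≤ _ := by
        gcongr
        rw [← Finset.prod_filter, Finset.prod_const]
        exact pow_le_pow_right₀ hc1 hk

lemma divisors_bound (ε : ℝ) (hε : 0 < ε) : ∃ C : ℝ, 1 ≤ C ∧ ∀ n : ℕ, n ≠ 0 →
    (n.divisors.card : ℝ) ≤ C * (n:ℝ) ^ ε := by
  obtain ⟨Y, c, hc, h⟩ := prod_bound ε hε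
  refine ⟨c ^ Y, one_le_pow₀ hc, fun n hn => ?_⟩
  rw [Nat.card_divisors hn]
  have := h ℕ n.primeFactors id n.factorization Y (fun t ht => (Nat.prime_of_mem_primeFactors ht).two_le)
    (by
      calc _ ≤ (Finset.range Y).card := Finset.card_le_card (fun t ht => by
            simp at ht ⊢; exact ht.2)
        _ = Y := by simp)
  push_cast
  refine this.trans (le_of_eq ?_)
  rw [Real.finsetProd_rpow _ _ (fun i _ => by positivity)]
  congr 2
  conv_rhs => rw [← Nat.prod_factorization_pow_eq_self hn]
  rw [Finsupp.prod]
  push_cast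
  simp

/-- divisors in a Dedekind domain with finite quotients -/
lemma ideal_divisors_bound (ε : ℝ) (hε : 0 < ε) (d : ℕ) : ∃ C : ℝ, 1 ≤ C ∧
    ∀ (K : Type) [Field K] [NumberField K], Module.finrank ℚ K ≤ d →
    ∀ m : ℕ, m ≠ 0 → ∃ S : Finset (Ideal (NumberField.RingOfIntegers K)),
      (∀ I : Ideal (NumberField.RingOfIntegers K), I ∣ Ideal.span {(m : NumberField.RingOfIntegers K)} → I ∈ S) ∧
      (S.card : ℝ) ≤ C * ((m:ℝ) ^ d) ^ ε := by
  classical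
  obtain ⟨Y, c, hc, h⟩ := prod_bound ε hε
  refine ⟨c ^ (Nat.log 2 (Y.factorial ^ d)), one_le_pow₀ hc, ?_⟩
  intro K _ _ hd m hm
  set R := NumberField.RingOfIntegers K with hR
  have hnorm : ∀ k : ℕ, k ≠ 0 → Ideal.absNorm (Ideal.span {(k : R)}) ≤ k ^ d := by
    intro k hk
    rw [Ideal.absNorm_span_singleton]
    have : (Algebra.norm ℤ (k : R)) = (k:ℤ) ^ Module.finrank ℚ K := by
      have := Algebra.norm_algebraMap (S := R) (k : ℤ)
      rw [NumberField.RingOfIntegers.rank] at this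
      simpa using this
    rw [this, Int.natAbs_pow]
    simpa using Nat.pow_le_pow_right (Nat.pos_of_ne_zero hk) hd
  set J : Ideal R := Ideal.span {(m : R)} with hJ
  have hJ0 : J ≠ 0 := by
    simp [hJ, hm]
  set s := UniqueFactorizationMonoid.normalizedFactors J with hs
  refine ⟨(Finset.Iic s).image Multiset.prod, ?_, ?_⟩
  · intro I hI
    have hI0 : I ≠ 0 := ne_zero_of_dvd_ne_zero hJ0 hI
    rw [Finset.mem_image]
    refine ⟨UniqueFactorizationMonoid.normalizedFactors I, ?_, ?_⟩
    · rw [Finset.mem_Iic]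
      exact (UniqueFactorizationMonoid.dvd_iff_normalizedFactors_le_normalizedFactors hI0 hJ0).1 hI
    · exact associated_iff_eq.1 (UniqueFactorizationMonoid.prod_normalizedFactors hI0)
  · have hprime : ∀ P ∈ s.toFinset, Prime P := fun P hP =>
      UniqueFactorizationMonoid.prime_of_normalized_factor P (Multiset.mem_toFinset.1 hP)
    have h2 : ∀ P ∈ s.toFinset, 2 ≤ Ideal.absNorm P := by
      intro P hP
      have hp := hprime P hP
      have h0 : Ideal.absNorm P ≠ 0 := by
        rw [Ne, Ideal.absNorm_eq_zero_iff]
        exact hp.ne_zero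
      have h1 : Ideal.absNorm P ≠ 1 := by
        rw [Ne, Ideal.absNorm_eq_one_iff]
        intro h; apply hp.not_isUnit; rw [h, ← Ideal.one_eq_top]; exact isUnit_one
      omega
    have hsmall : (s.toFinset.filter (fun P => Ideal.absNorm P < Y)).card ≤ Nat.log 2 (Y.factorial ^ d) := by
      apply Nat.le_log_of_pow_le (by norm_num)
      set T := s.toFinset.filter (fun P => Ideal.absNorm P < Y)
      have hdiv : ∏ P ∈ T, P ∣ Ideal.span {((Y.factorial : ℕ) : R)} := by
        apply Finset.prod_primes_dvd
        · intro P hP; exact hprime P (Finset.mem_filter.1 hP).1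
        · intro P hP
          have hP' := Finset.mem_filter.1 hP
          rw [Ideal.dvd_span_singleton]
          have h1 : (Ideal.absNorm P : R) ∈ P := Ideal.absNorm_mem P
          have h3 : Ideal.absNorm P ∣ Y.factorial :=
            Nat.dvd_factorial (by have := h2 P hP'.1; omega) hP'.2.le
          obtain ⟨k, hk⟩ := h3
          rw [hk, Nat.cast_mul]
          exact Ideal.mul_mem_right _ _ h1
      have h3 : Ideal.absNorm (∏ P ∈ T, P) ≤ Y.factorial ^ d := by
        refine le_trans ?_ (hnorm Y.factorial (Nat.factorial_ne_zero _))
        apply Nat.le_of_dvd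
        · apply Nat.pos_of_ne_zero
          rw [Ne, Ideal.absNorm_eq_zero_iff]
          simp [Nat.factorial_ne_zero]
        · exact map_dvd Ideal.absNorm hdiv
      refine le_trans ?_ h3
      rw [map_prod]
      exact Finset.pow_card_le_prod _ _ _ (fun P hP => h2 P (Finset.mem_filter.1 hP).1)
    have hmain := h (Ideal R) s.toFinset (fun P => Ideal.absNorm P) (fun P => s.count P) _ h2 hsmall
    calc (((Finset.Iic s).image Multiset.prod).card : ℝ) ≤ ((Finset.Iic s).card : ℝ) := by
          exact_mod_cast Finset.card_image_le
      _ = ∏ P ∈ s.toFinset, ((s.count P : ℝ) + 1) := by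
          rw [Multiset.card_Iic]; push_cast; rfl
      _ ≤ _ := hmain
      _ ≤ _ := by
          gcongr
          rw [Real.finsetProd_rpow _ _ (fun i _ => by positivity)]
          gcongr
          have : Ideal.absNorm J = ∏ P ∈ s.toFinset, Ideal.absNorm P ^ s.count P := by
            conv_lhs => rw [← associated_iff_eq.1 (UniqueFactorizationMonoid.prod_normalizedFactors hJ0)]
            rw [← hs, Finset.prod_multiset_count, map_prod]
            simp
          have h4 := hnorm m hm
          rw [← hJ, this] at h4
          exact_mod_cast h4

end SFV


namespace SFV
open Finset NumberField

lemma small_integers_bound (d : ℕ) : ∃ C : ℕ, ∀ (K : Type) [Field K] [NumberField K],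
    Module.finrank ℚ K ≤ d → ∀ V : Finset (𝓞 K),
    (∀ η ∈ V, ∀ φ : K →+* ℂ, ‖φ (η : K)‖ ≤ 3) → V.card ≤ C := by
  classical
  set H : ℤ := 6 ^ d with hH
  set Ps : Finset (Polynomial ℤ) := (Fintype.piFinset (fun _ : Fin (d+1) => Finset.Icc (-H) H)).image
    (fun f => ∑ i : Fin (d+1), Polynomial.C (f i) * Polynomial.X ^ (i:ℕ)) with hPs
  refine ⟨Ps.card * d, ?_⟩
  intro K _ _ hd V hV
  have hsub : V ⊆ Ps.biUnion (fun p => (p.map (algebraMap ℤ (𝓞 K))).roots.toFinset) := by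
    intro η hη
    have hint : IsIntegral ℤ (η : K) := η.isIntegral_coe
    have hmp := minpoly.isIntegrallyClosed_eq_field_fractions' ℚ hint
    set p := minpoly ℤ (η:K) with hp
    have hmon : p.Monic := minpoly.monic hint
    have hdeg : p.natDegree ≤ d := by
      have h1 : (minpoly ℚ (η:K)).natDegree = p.natDegree := by
        rw [hmp]; exact hmon.natDegree_map _
      rw [← h1]
      exact (minpoly.natDegree_le _).trans hd
    have hcoef : ∀ i, p.coeff i ∈ Finset.Icc (-H) H := by
      intro i
      have h1 := Embeddings.coeff_bdd_of_norm_le (hV η hη) i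
      rw [hmp, Polynomial.coeff_map] at h1
      have h2 : ‖(algebraMap ℤ ℚ) (p.coeff i)‖ = ((|p.coeff i| : ℤ) : ℝ) := by
        simp [Int.norm_eq_abs]
      rw [h2] at h1
      have h3 : max (3:ℝ) 1 ^ Module.finrank ℚ K * ((Module.finrank ℚ K).choose (Module.finrank ℚ K / 2) : ℝ)
          ≤ ((H : ℤ) : ℝ) := by
        have : ((Module.finrank ℚ K).choose (Module.finrank ℚ K / 2) : ℝ) ≤ 2 ^ d := by
          have h5 := Nat.choose_le_two_pow (Module.finrank ℚ K) (Module.finrank ℚ K / 2)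
          have h6 : 2 ^ (Module.finrank ℚ K) ≤ 2 ^ d := Nat.pow_le_pow_right (by norm_num) hd
          exact_mod_cast h5.trans h6
        have h7 : max (3:ℝ) 1 ^ Module.finrank ℚ K ≤ 3 ^ d := by
          rw [max_eq_left (by norm_num)]
          exact pow_le_pow_right₀ (by norm_num) hd
        calc _ ≤ (3:ℝ) ^ d * 2 ^ d := by gcongr
          _ = _ := by rw [← mul_pow, hH]; norm_num
      have h4 : |p.coeff i| ≤ H := by exact_mod_cast h1.trans h3
      rw [Finset.mem_Icc]
      exact abs_le.1 h4
    rw [Finset.mem_biUnion]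
    refine ⟨p, ?_, ?_⟩
    · rw [hPs, Finset.mem_image]
      refine ⟨fun i => p.coeff i, ?_, ?_⟩
      · rw [Fintype.mem_piFinset]; intro i; exact hcoef i
      · rw [Finset.sum_fin_eq_sum_range]
        conv_rhs => rw [Polynomial.as_sum_range_C_mul_X_pow' (p := p) (n := d+1) (by omega)]
        apply Finset.sum_congr rfl
        intro i hi
        rw [dif_pos (Finset.mem_range.1 hi)]
    · rw [Multiset.mem_toFinset, Polynomial.mem_roots']
      refine ⟨(hmon.map _).ne_zero, ?_⟩
      rw [Polynomial.IsRoot, Polynomial.eval_map, ← Polynomial.aeval_def]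
      apply RingOfIntegers.coe_injective
      have : (algebraMap (𝓞 K) K) ((Polynomial.aeval η) p) = (Polynomial.aeval (η:K)) p := by
        rw [Polynomial.aeval_algebraMap_apply]
      rw [this, map_zero]
      exact minpoly.aeval _ _
  refine (Finset.card_le_card hsub).trans ?_
  refine Finset.card_biUnion_le_card_mul _ _ _ ?_
  intro p hp
  rw [hPs, Finset.mem_image] at hp
  obtain ⟨f, _, rfl⟩ := hp
  refine (Multiset.toFinset_card_le _).trans ((Polynomial.card_roots' _).trans ?_)
  refine (Polynomial.natDegree_map_le).trans ?_
  apply Polynomial.natDegree_sum_le_of_forall_le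
  intro i _
  refine (Polynomial.natDegree_C_mul_X_pow_le _ _).trans ?_
  omega

lemma values_bound (ε : ℝ) (hε : 0 < ε) (d : ℕ) (hd1 : 1 ≤ d) : ∃ C : ℝ, 1 ≤ C ∧
    ∀ (K : Type) [Field K] [NumberField K],
    Module.finrank ℚ K ≤ d → ∀ (m : ℕ) (B : ℝ), m ≠ 0 → 1 ≤ B → ∀ V : Finset (𝓞 K),
    (∀ α ∈ V, α ∣ (m : 𝓞 K) ∧ ∀ φ : K →+* ℂ, ‖φ (α : K)‖ ≤ B) →
    (V.card : ℝ) ≤ C * (m * B) ^ ε := by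
  classical
  obtain ⟨C1, hC1⟩ := small_integers_bound d
  obtain ⟨C2, hC2, hI⟩ := ideal_divisors_bound (ε / d) (by positivity) d
  set δ : ℝ := ε / d with hδ
  have hd0 : (0:ℝ) < d := by positivity
  have hδ0 : 0 < δ := by positivity
  set C3 : ℝ := (2 * d / δ + 5) ^ d with hC3
  have hC31 : 1 ≤ C3 := one_le_pow₀ (by have : 0 ≤ 2 * d / δ := by positivity
                                        linarith)
  refine ⟨(C1 + 1) * (C2 * C3), ?_, ?_⟩
  · have : (1:ℝ) ≤ C1 + 1 := by linarith [show (0:ℝ) ≤ C1 by positivity]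
    exact one_le_mul_of_one_le_of_one_le this (one_le_mul_of_one_le_of_one_le hC2 hC31)
  intro K _ _ hd m B hm hB V hV
  obtain ⟨S, hS, hScard⟩ := hI K hd m hm
  set L : ℤ := ⌈d * Real.log B⌉ with hL
  have hlogB : 0 ≤ Real.log B := Real.log_nonneg hB
  have hL0 : 0 ≤ L := Int.ceil_nonneg (by positivity)
  set T : Finset (Ideal (𝓞 K) × ((K →+* ℂ) → ℤ)) :=
    S ×ˢ Fintype.piFinset (fun _ : K →+* ℂ => Finset.Icc (-L) L) with hT
  set f : 𝓞 K → Ideal (𝓞 K) × ((K →+* ℂ) → ℤ) :=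
    fun α => (Ideal.span {α}, fun φ => ⌊Real.log ‖φ (α:K)‖⌋) with hf
  have hmne : (m : 𝓞 K) ≠ 0 := by exact_mod_cast hm
  have hne : ∀ α ∈ V, α ≠ 0 := fun α hα => ne_zero_of_dvd_ne_zero hmne (hV α hα).1
  have hφne : ∀ α ∈ V, ∀ φ : K →+* ℂ, 0 < ‖φ (α:K)‖ := by
    intro α hα φ
    rw [norm_pos_iff, Ne, map_eq_zero]
    exact RingOfIntegers.coe_ne_zero_iff.2 (hne α hα)
  have hfib : ∀ b ∈ T, (V.filter (fun a => f a = b)).card ≤ C1 := by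
    intro b _
    set W := V.filter (fun a => f a = b) with hW
    rcases W.eq_empty_or_nonempty with h0 | ⟨α0, hα0⟩
    · simp [h0]
    · have hα0' := Finset.mem_filter.1 hα0
      have hex : ∀ α ∈ W, ∃ η : 𝓞 K, α = α0 * η := by
        intro α hα
        have hα' := Finset.mem_filter.1 hα
        have h1 : Ideal.span {α} = Ideal.span {α0} := by
          have h2 := congrArg Prod.fst (hα'.2.trans hα0'.2.symm)
          exact h2
        rw [Ideal.span_singleton_eq_span_singleton] at h1
        obtain ⟨η, hη⟩ := h1.symm
        exact ⟨η, hη.symm⟩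
      choose! g hg using hex
      have hinj : Set.InjOn g W := by
        intro α hα β hβ hab
        rw [hg α hα, hg β hβ, hab]
      rw [← Finset.card_image_of_injOn hinj]
      apply hC1 K hd
      intro η hη φ
      rw [Finset.mem_image] at hη
      obtain ⟨α, hα, rfl⟩ := hη
      have hα' := Finset.mem_filter.1 hα
      have h1 : ⌊Real.log ‖φ (α:K)‖⌋ = ⌊Real.log ‖φ (α0:K)‖⌋ := by
        have h2 := congrArg Prod.snd (hα'.2.trans hα0'.2.symm)
        exact congrFun h2 φ
      have h3 : ‖φ (α:K)‖ = ‖φ (α0:K)‖ * ‖φ (g α : K)‖ := by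
        conv_lhs => rw [hg α hα]
        simp
      have p1 := hφne α hα'.1 φ
      have p0 := hφne α0 hα0'.1 φ
      have pg : 0 < ‖φ (g α : K)‖ := by
        rw [h3] at p1
        exact (pos_iff_pos_of_mul_pos p1).1 p0
      have h4 : Real.log ‖φ (g α : K)‖ ≤ 1 := by
        have h5 : Real.log ‖φ (α:K)‖ = Real.log ‖φ (α0:K)‖ + Real.log ‖φ (g α : K)‖ := by
          rw [h3, Real.log_mul p0.ne' pg.ne']
        have h6 := Int.lt_floor_add_one (Real.log ‖φ (α:K)‖)
        have h7 := Int.floor_le (Real.log ‖φ (α0:K)‖)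
        rw [h1] at h6
        linarith
      have h8 : ‖φ (g α : K)‖ ≤ Real.exp 1 := by
        rwa [← Real.log_le_iff_le_exp pg]
      have := Real.exp_one_lt_d9
      linarith
  have hmaps : ∀ α ∈ V, f α ∈ T := by
    intro α hα
    rw [hT, Finset.mem_product]
    refine ⟨hS _ ?_, ?_⟩
    · obtain ⟨k, hk⟩ := (hV α hα).1
      simp only [hf, hk]
      exact ⟨Ideal.span {k}, by rw [Ideal.span_singleton_mul_span_singleton]⟩
    · rw [Fintype.mem_piFinset]
      intro φ
      have p := hφne α hα φ
      have hup : Real.log ‖φ (α:K)‖ ≤ Real.log B := Real.log_le_log p ((hV α hα).2 φ)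
      have hprod : (1:ℝ) ≤ ∏ ψ : K →+* ℂ, ‖ψ (α:K)‖ := by
        have h1 : (algebraMap ℚ ℂ) (Algebra.norm ℚ (α:K)) = ∏ ψ : K →ₐ[ℚ] ℂ, ψ (α:K) :=
          Algebra.norm_eq_prod_embeddings ℚ ℂ (α:K)
        have h2 : ∏ ψ : K →+* ℂ, ‖ψ (α:K)‖ = ∏ ψ : K →ₐ[ℚ] ℂ, ‖ψ (α:K)‖ := by
          apply Fintype.prod_equiv (RingHom.equivRatAlgHom K ℂ)
          intro ψ; rfl
        rw [h2, ← norm_prod, ← h1]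
        have h3 : Algebra.norm ℚ (α:K) = ((Algebra.norm ℤ α : ℤ) : ℚ) := by
          have := Algebra.coe_norm_int α
          exact this.symm
        rw [h3]
        have h4 : Algebra.norm ℤ α ≠ 0 := by
          rw [Algebra.norm_ne_zero_iff]; exact hne α hα
        have h5 : (1:ℤ) ≤ |Algebra.norm ℤ α| := Int.one_le_abs h4
        simp
        exact_mod_cast h5
      have hlow : -(d * Real.log B) ≤ Real.log ‖φ (α:K)‖ := by
        have h1 : (1:ℝ) ≤ ‖φ (α:K)‖ * B ^ d := by
          calc (1:ℝ) ≤ ∏ ψ : K →+* ℂ, ‖ψ (α:K)‖ := hprod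
            _ = ‖φ (α:K)‖ * ∏ ψ ∈ Finset.univ.erase φ, ‖ψ (α:K)‖ := by
                exact (Finset.mul_prod_erase _ (fun ψ : K →+* ℂ => ‖ψ (α:K)‖) (Finset.mem_univ φ)).symm
            _ ≤ ‖φ (α:K)‖ * B ^ d := by
                gcongr
                calc ∏ ψ ∈ Finset.univ.erase φ, ‖ψ (α:K)‖ ≤ ∏ ψ ∈ Finset.univ.erase φ, B := by
                      apply Finset.prod_le_prod
                      · intro i _; positivity
                      · intro i _; exact (hV α hα).2 i
                  _ = B ^ (Finset.univ.erase φ).card := by rw [Finset.prod_const]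
                  _ ≤ B ^ d := by
                      apply pow_le_pow_right₀ hB
                      refine (Finset.card_le_univ _).trans ?_
                      rw [Embeddings.card]; exact hd
        have h2 := Real.log_le_log (by norm_num) h1
        rw [Real.log_one, Real.log_mul p.ne' (by positivity), Real.log_pow] at h2
        linarith
      rw [Finset.mem_Icc]
      have hLge : d * Real.log B ≤ (L:ℝ) := Int.le_ceil _
      constructor
      · apply Int.le_floor.2
        push_cast
        linarith
      · have h1 : ⌊Real.log ‖φ (α:K)‖⌋ ≤ ⌈d * Real.log B⌉ := by
          refine (Int.floor_le_ceil _).trans (Int.ceil_le_ceil ?_)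
          have : (1:ℝ) ≤ d := by exact_mod_cast hd1
          nlinarith
        exact h1
  have hcard := Finset.card_le_mul_card_image_of_maps_to hmaps C1 hfib
  have hTc : (T.card : ℝ) ≤ (C2 * ((m:ℝ) ^ d) ^ δ) * (C3 * B ^ ε) := by
    rw [hT, Finset.card_product]
    push_cast
    gcongr
    · rw [Fintype.card_piFinset, Finset.prod_const, Finset.card_univ, Embeddings.card]
      have h1 : ((Finset.Icc (-L) L).card : ℝ) ≤ (2 * d / δ + 5) * B ^ δ := by
        rw [Int.card_Icc]
        have h2 : (((L + 1 - -L).toNat : ℕ) : ℝ) = 2 * L + 1 := by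
          have : (((L + 1 - -L).toNat : ℕ) : ℤ) = 2 * L + 1 := by
            rw [Int.toNat_of_nonneg (by omega)]; ring
          exact_mod_cast this
        rw [h2]
        have h3 : (L:ℝ) < d * Real.log B + 1 := Int.ceil_lt_add_one _
        have h4 : Real.log B ≤ B ^ δ / δ := Real.log_le_rpow_div (by linarith) hδ0
        have h5 : 1 ≤ B ^ δ := Real.one_le_rpow hB hδ0.le
        have h6 : d * Real.log B ≤ d * (B ^ δ / δ) := by gcongr
        have h7 : d * (B ^ δ / δ) = (d / δ) * B ^ δ := by ring
        have h8 : 2 * d / δ = 2 * (d/δ) := by ring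
        rw [h8]
        nlinarith
      have h1' : (1:ℝ) ≤ ((Finset.Icc (-L) L).card : ℝ) := by
        have : (Finset.Icc (-L) L).Nonempty := ⟨0, by simp [hL0]⟩
        exact_mod_cast Finset.card_pos.2 this
      push_cast
      calc ((Finset.Icc (-L) L).card : ℝ) ^ Module.finrank ℚ K ≤ ((Finset.Icc (-L) L).card : ℝ) ^ d :=
            pow_le_pow_right₀ h1' hd
        _ ≤ ((2 * d / δ + 5) * B ^ δ) ^ d := by gcongr
        _ = C3 * B ^ ε := by
            rw [mul_pow, hC3]
            congr 1
            rw [← Real.rpow_natCast, ← Real.rpow_mul (by linarith)]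
            congr 1
            rw [hδ]; field_simp
  have hmpow : ((m:ℝ) ^ d) ^ δ = (m:ℝ) ^ ε := by
    rw [← Real.rpow_natCast, ← Real.rpow_mul (by positivity)]
    congr 1
    rw [hδ]; field_simp
  rw [hmpow] at hTc
  have hcard' : (V.card : ℝ) ≤ C1 * T.card := by exact_mod_cast hcard
  calc (V.card : ℝ) ≤ C1 * T.card := hcard'
    _ ≤ (C1 + 1) * ((C2 * (m:ℝ) ^ ε) * (C3 * B ^ ε)) := by
        gcongr
        linarith
    _ = _ := by
        rw [Real.mul_rpow (by positivity) (by linarith)]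
        ring

end SFV


namespace SFV
open Finset NumberField

noncomputable def bform (n : ℕ) (f : ℕ → ℤ) (a b : ℤ) : ℤ :=
  ∑ i ∈ range (n+1), f i * a ^ i * b ^ (n - i)

noncomputable def fpoly (n : ℕ) (f : ℕ → ℤ) : Polynomial ℤ :=
  ∑ i ∈ range (n+1), Polynomial.C (f i) * Polynomial.X ^ i

lemma fpoly_coeff (n : ℕ) (f : ℕ → ℤ) (i : ℕ) : (fpoly n f).coeff i = if i ≤ n then f i else 0 := by
  simp only [fpoly, Polynomial.finsetSum_coeff, Polynomial.coeff_C_mul_X_pow]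
  simp [Finset.sum_ite_eq, Nat.lt_succ_iff]

lemma fpoly_natDegree (n : ℕ) (f : ℕ → ℤ) : (fpoly n f).natDegree ≤ n := by
  apply Polynomial.natDegree_le_iff_coeff_eq_zero.2
  intro i hi
  rw [fpoly_coeff, if_neg (by omega)]

lemma fpoly_aeval (n : ℕ) (f : ℕ → ℤ) {S : Type*} [CommRing S] (θ : S) :
    Polynomial.aeval θ (fpoly n f) = ∑ i ∈ range (n+1), (f i : S) * θ ^ i := by
  simp [fpoly]

/-- size of (lead * root) -/
lemma root_size (p : Polynomial ℤ) (B : ℝ) (n : ℕ) (hn : p.natDegree ≤ n)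
    (hB : ∀ i, |(p.coeff i : ℝ)| ≤ B) (z : ℂ) (hz : Polynomial.aeval z p = 0) :
    ‖(p.leadingCoeff : ℂ) * z‖ ≤ (n + 1) * B := by
  have hB0 : 0 ≤ B := (abs_nonneg _).trans (hB 0)
  have hn0 : (0:ℝ) ≤ n := by positivity
  rw [norm_mul]
  have hc : ‖(p.leadingCoeff : ℂ)‖ ≤ B := by
    rw [Complex.norm_intCast]
    exact hB p.natDegree
  by_cases h1 : ‖z‖ ≤ 1
  · calc _ ≤ B * 1 := by gcongr
      _ ≤ _ := by nlinarith
  · push Not at h1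
    rw [Polynomial.aeval_eq_sum_range, Finset.sum_range_succ] at hz
    rcases Nat.eq_zero_or_pos p.natDegree with h0 | hpos
    · rw [h0] at hz
      simp at hz
      have : p.leadingCoeff = 0 := by rw [Polynomial.leadingCoeff, h0]; exact_mod_cast hz
      rw [this]; simp; positivity
    · obtain ⟨k, hk⟩ : ∃ k, p.natDegree = k + 1 := ⟨p.natDegree - 1, by omega⟩
      have hlc : (p.leadingCoeff : ℂ) = ((p.coeff (k+1) : ℤ) : ℂ) := by
        rw [Polynomial.leadingCoeff, hk]
      rw [hk] at hz
      have h2 : ((p.coeff (k+1) : ℤ) : ℂ) * z ^ (k+1) = - ∑ x ∈ range (k+1), p.coeff x • z ^ x := by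
        have h3 : p.coeff (k+1) • z ^ (k+1) = ((p.coeff (k+1) : ℤ) : ℂ) * z ^ (k+1) := by simp
        rw [h3] at hz
        linear_combination hz
      have h4 : ‖(p.leadingCoeff : ℂ)‖ * ‖z‖ ^ (k+1) ≤ (k+1) * B * ‖z‖ ^ k := by
        rw [hlc, ← norm_pow, ← norm_mul, h2, norm_neg]
        calc _ ≤ ∑ x ∈ range (k+1), ‖p.coeff x • z ^ x‖ := norm_sum_le _ _
          _ ≤ ∑ x ∈ range (k+1), B * ‖z‖ ^ k := by
              apply Finset.sum_le_sum
              intro i hi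
              have hik : i ≤ k := by have := Finset.mem_range.1 hi; omega
              have : ‖p.coeff i • z ^ i‖ = |(p.coeff i : ℝ)| * ‖z‖ ^ i := by simp
              rw [this]
              have h5 : ‖z‖ ^ i ≤ ‖z‖ ^ k := pow_le_pow_right₀ h1.le hik
              exact mul_le_mul (hB i) h5 (by positivity) hB0
          _ = _ := by rw [Finset.sum_const, Finset.card_range]; simp; ring
      have hzk : 0 < ‖z‖ ^ k := by positivity
      have h6 : (‖(p.leadingCoeff : ℂ)‖ * ‖z‖) * ‖z‖ ^ k ≤ ((k+1) * B) * ‖z‖ ^ k := by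
        rw [pow_succ] at h4; linarith
      have h7 := le_of_mul_le_mul_right h6 hzk
      refine h7.trans ?_
      have : ((k:ℝ)+1) ≤ n + 1 := by
        have : k ≤ n := by omega
        have : (k:ℝ) ≤ n := by exact_mod_cast this
        linarith
      gcongr

lemma root_values (ε : ℝ) (hε : 0 < ε) (n : ℕ) (hn1 : 1 ≤ n) : ∃ C : ℝ, 1 ≤ C ∧
    ∀ (f : ℕ → ℤ) (R : ℤ) (B : ℝ) (θ : ℂ), fpoly n f ≠ 0 → R ≠ 0 → 1 ≤ B →
    (∀ i, |(f i : ℝ)| ≤ B) → |(R : ℝ)| ≤ B → Polynomial.aeval θ (fpoly n f) = 0 →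
    ∀ V : Finset (ℤ × ℤ), (∀ z ∈ V, |(z.1 : ℝ)| ≤ B ∧ |(z.2:ℝ)| ≤ B ∧ bform n f z.1 z.2 ∣ R) →
    ((V.image (fun z => (z.1 : ℂ) - θ * z.2)).card : ℝ) ≤ C * B ^ ε := by
  classical
  set ε' := ε / (n+3) with hε'
  obtain ⟨C, hC, hval⟩ := values_bound ε' (by positivity) n hn1
  refine ⟨C * (n+2:ℝ) ^ ε', ?_, ?_⟩
  · apply one_le_mul_of_one_le_of_one_le hC
    apply Real.one_le_rpow _ (by positivity)
    have : (0:ℝ) ≤ n := by positivity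
    linarith
  intro f R B θ hf0 hR hB hfB hRB hθ V hV
  set p := fpoly n f with hp
  have hpB : ∀ i, |(p.coeff i : ℝ)| ≤ B := by
    intro i
    rw [hp, fpoly_coeff]
    split_ifs
    · exact hfB i
    · simp; linarith
  set c : ℤ := p.leadingCoeff with hc
  have hc0 : c ≠ 0 := Polynomial.leadingCoeff_ne_zero.2 hf0
  have halg : IsAlgebraic ℤ θ := ⟨p, hf0, hθ⟩
  have hint : IsIntegral ℚ θ := by
    have : IsAlgebraic ℚ θ := halg.extendScalars (FaithfulSMul.algebraMap_injective ℤ ℚ)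
    exact this.isIntegral
  let K := IntermediateField.adjoin ℚ {θ}
  have : FiniteDimensional ℚ K := IntermediateField.adjoin.finiteDimensional hint
  have : NumberField K := ⟨⟩
  have hdeg : Module.finrank ℚ K ≤ n := by
    rw [IntermediateField.adjoin.finrank hint]
    have hpq : p.map (algebraMap ℤ ℚ) ≠ 0 := by
      rw [Ne, Polynomial.map_eq_zero_iff (FaithfulSMul.algebraMap_injective ℤ ℚ)]; exact hf0
    have h1 : (minpoly ℚ θ) ∣ p.map (algebraMap ℤ ℚ) := by
      apply minpoly.dvd
      rw [Polynomial.aeval_map_algebraMap]; exact hθ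
    refine (Polynomial.natDegree_le_of_dvd h1 hpq).trans ?_
    exact (Polynomial.natDegree_map_le).trans (fpoly_natDegree n f)
  let θK : K := ⟨θ, IntermediateField.mem_adjoin_simple_self ℚ θ⟩
  have hθK : Polynomial.aeval θK p = 0 := by
    apply (algebraMap K ℂ).injective
    rw [← Polynomial.aeval_algebraMap_apply, map_zero]
    exact hθ
  have hyint : IsIntegral ℤ ((c:K) * θK) := by
    have := isIntegral_leadingCoeff_smul p θK hθK
    rwa [zsmul_eq_mul] at this
  let y : 𝓞 K := ⟨(c:K) * θK, hyint⟩
  have hy : algebraMap (𝓞 K) K y = (c:K) * θK := rfl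
  set W : Finset (𝓞 K) := V.image (fun z => ((c * z.1 : ℤ) : 𝓞 K) - y * (z.2 : 𝓞 K)) with hW
  have hcard : (V.image (fun z => (z.1 : ℂ) - θ * z.2)).card ≤ W.card := by
    have : V.image (fun z => (z.1 : ℂ) - θ * z.2) = W.image (fun α : 𝓞 K => ((c:ℂ))⁻¹ * (algebraMap K ℂ (algebraMap (𝓞 K) K α))) := by
      rw [hW, Finset.image_image]
      apply Finset.image_congr
      intro z _
      have hcc : (c:ℂ) ≠ 0 := by exact_mod_cast hc0
      have h1 : algebraMap K ℂ θK = θ := rfl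
      simp only [Function.comp]
      rw [map_sub, map_mul, map_sub, map_mul, hy, map_mul, h1]
      simp only [map_intCast]
      push_cast
      field_simp
    rw [this]
    exact Finset.card_image_le
  set m : ℕ := (c ^ n * R).natAbs with hm
  have hm0 : m ≠ 0 := by
    rw [hm, Ne, Int.natAbs_eq_zero]; exact mul_ne_zero (pow_ne_zero _ hc0) hR
  have hmB : (m:ℝ) ≤ B ^ (n+1) := by
    rw [hm, Nat.cast_natAbs]
    push_cast
    rw [abs_mul, abs_pow, pow_succ]
    have := hpB p.natDegree
    have h2 : |(c:ℝ)| ≤ B := this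
    gcongr
  have hn0 : (0:ℝ) ≤ n := by positivity
  have hWb := hval K hdeg m ((n+2) * B ^ 2) hm0 (by nlinarith [one_le_pow₀ hB (n := 2)]) W (by
    intro α hα
    rw [hW, Finset.mem_image] at hα
    obtain ⟨z, hz, rfl⟩ := hα
    obtain ⟨h1, h2, h3⟩ := hV z hz
    constructor
    · have key : (((c * z.1 : ℤ) : 𝓞 K) - y * (z.2 : 𝓞 K)) ∣ ((c ^ n * bform n f z.1 z.2 : ℤ) : 𝓞 K) := by
        have e1 : ((c ^ n * bform n f z.1 z.2 : ℤ) : 𝓞 K) =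
          ∑ i ∈ range (n+1), ((f i * (c * z.2) ^ (n-i) : ℤ) : 𝓞 K) *
            (((c * z.1 : ℤ) : 𝓞 K) ^ i - (y * (z.2 : 𝓞 K)) ^ i) := by
          have e2 : ∑ i ∈ range (n+1), ((f i * (c * z.2) ^ (n-i) : ℤ) : 𝓞 K) * (y * (z.2 : 𝓞 K)) ^ i = 0 := by
            apply RingOfIntegers.coe_injective
            rw [map_zero, map_sum]
            have e3 : ((c:K) * z.2) ^ n * Polynomial.aeval θK p = 0 := by rw [hθK, mul_zero]
            rw [hp, fpoly_aeval, Finset.mul_sum] at e3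
            rw [← e3]
            apply Finset.sum_congr rfl
            intro i hi
            have hi' : i ≤ n := by have := Finset.mem_range.1 hi; omega
            rw [map_mul, map_pow, map_mul, hy]
            simp only [map_intCast]
            push_cast
            have : ((c:K) * z.2) ^ n = ((c:K) * z.2) ^ (n-i) * ((c:K) * z.2) ^ i := by
              rw [← pow_add]; congr 1; omega
            rw [this]; ring
          simp only [mul_sub, Finset.sum_sub_distrib]
          rw [e2, sub_zero, bform, Finset.mul_sum]
          push_cast
          apply Finset.sum_congr rfl
          intro i hi
          have hi' : i ≤ n := by have := Finset.mem_range.1 hi; omega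
          have : (c:𝓞 K) ^ n = (c:𝓞 K) ^ (n-i) * (c:𝓞 K) ^ i := by
              rw [← pow_add]; congr 1; omega
          rw [this]; ring
        rw [e1]
        apply Finset.dvd_sum
        intro i _
        exact Dvd.dvd.mul_left (sub_dvd_pow_sub_pow _ _ _) _
      refine key.trans ?_
      have e4 : (c ^ n * bform n f z.1 z.2 : ℤ) ∣ (m : ℤ) := by
        rw [hm, Int.dvd_natAbs]
        exact mul_dvd_mul_left _ h3
      have := map_dvd (Int.castRingHom (𝓞 K)) e4
      simpa using this
    · intro φ
      have hφ : Polynomial.aeval (φ θK) p = 0 := by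
        have := congrArg φ hθK
        rw [map_zero] at this
        rw [← this, hp, fpoly_aeval, fpoly_aeval, map_sum]
        simp
      have hs := root_size p B n (fpoly_natDegree n f) hpB _ hφ
      have e1 : φ (algebraMap (𝓞 K) K (((c * z.1 : ℤ) : 𝓞 K) - y * (z.2 : 𝓞 K))) =
          (c:ℂ) * z.1 - ((c:ℂ) * φ θK) * z.2 := by
        rw [map_sub, map_mul, hy]
        simp
      change ‖φ (algebraMap (𝓞 K) K _)‖ ≤ _
      rw [e1]
      have hcB : ‖(c:ℂ)‖ ≤ B := by
        rw [Complex.norm_intCast]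
        exact hpB p.natDegree
      have hz1 : ‖(z.1:ℂ)‖ ≤ B := by simpa using h1
      have hz2 : ‖(z.2:ℂ)‖ ≤ B := by simpa using h2
      calc _ ≤ ‖(c:ℂ) * z.1‖ + ‖((c:ℂ) * φ θK) * z.2‖ := norm_sub_le _ _
        _ ≤ B * B + ((n+1) * B) * B := by
          rw [norm_mul, norm_mul (_ * _)]
          gcongr
        _ = _ := by ring)
  calc ((V.image (fun z => (z.1 : ℂ) - θ * z.2)).card : ℝ) ≤ W.card := by exact_mod_cast hcard
    _ ≤ C * (m * ((n+2) * B ^ 2)) ^ ε' := hWb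
    _ ≤ C * ((n+2) * B ^ (n+3)) ^ ε' := by
        refine mul_le_mul_of_nonneg_left (Real.rpow_le_rpow (by positivity) ?_ (by positivity)) (by linarith)
        calc (m:ℝ) * ((n+2) * B ^ 2) ≤ B ^ (n+1) * ((n+2) * B ^ 2) := by gcongr
          _ = (n+2) * B ^ (n+3) := by ring
    _ = _ := by
        rw [Real.mul_rpow (by positivity) (by positivity), ← Real.rpow_natCast B, ← Real.rpow_mul (by linarith)]
        have : (((n+3 : ℕ) : ℝ)) * ε' = ε := by rw [hε']; push_cast; field_simp
        rw [this]; ring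

end SFV


namespace SFV
open Finset

lemma image_dvd_card (R : ℤ) (hR : R ≠ 0) (T : Finset ℤ) (h : ∀ t ∈ T, t ∣ R) :
    T.card ≤ 2 * R.natAbs.divisors.card := by
  classical
  have : T ⊆ (R.natAbs.divisors.image (fun k : ℕ => (k:ℤ))) ∪ (R.natAbs.divisors.image (fun k : ℕ => -(k:ℤ))) := by
    intro t ht
    have h1 : t.natAbs ∈ R.natAbs.divisors := by
      rw [Nat.mem_divisors]
      exact ⟨Int.natAbs_dvd_natAbs.2 (h t ht), by simpa using hR⟩
    rw [Finset.mem_union, Finset.mem_image, Finset.mem_image]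
    rcases Int.natAbs_eq t with h2 | h2
    · left; exact ⟨_, h1, h2.symm⟩
    · right; exact ⟨_, h1, h2.symm⟩
  refine (Finset.card_le_card this).trans ((Finset.card_union_le _ _).trans ?_)
  have a1 := Finset.card_image_le (s := R.natAbs.divisors) (f := fun k : ℕ => (k:ℤ))
  have a2 := Finset.card_image_le (s := R.natAbs.divisors) (f := fun k : ℕ => -(k:ℤ))
  omega

lemma card_le_pair {α β γ : Type*} [DecidableEq β] [DecidableEq γ] (V : Finset α) (g : α → β) (k : α → γ)
    (hinj : ∀ x ∈ V, ∀ y ∈ V, g x = g y → k x = k y → x = y) :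
    V.card ≤ (V.image g).card * (V.image k).card := by
  rw [← Finset.card_product]
  apply Finset.card_le_card_of_injOn (fun x => (g x, k x))
  · intro x hx
    simp only [Finset.coe_product, Set.mem_prod, Finset.mem_coe]
    exact ⟨Finset.mem_image_of_mem _ hx, Finset.mem_image_of_mem _ hx⟩
  · intro x hx y hy h
    simp only [Prod.mk.injEq] at h
    exact hinj x hx y hy h.1 h.2

lemma single_root (n : ℕ) (hn : 1 ≤ n) (f : ℕ → ℤ) (p : Polynomial ℤ) (hp : p = fpoly n f) (hp0 : p ≠ 0)
    (hdeg : p.natDegree = n) (θ : ℂ) (hall : ∀ z : ℂ, Polynomial.aeval z p = 0 → z = θ) :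
    ∃ c r q : ℤ, c ≠ 0 ∧ IsCoprime r q ∧ ∀ i ≤ n, f i = c * n.choose i * (-q) ^ i * r ^ (n - i) := by
  have hcast : Function.Injective (algebraMap ℤ ℂ) := FaithfulSMul.algebraMap_injective ℤ ℂ
  set P := p.map (algebraMap ℤ ℂ) with hP
  have hP0 : P ≠ 0 := by rw [hP, Ne, Polynomial.map_eq_zero_iff hcast]; exact hp0
  have hPdeg : P.natDegree = n := by rw [hP, Polynomial.natDegree_map_eq_of_injective hcast, hdeg]
  have hroots : P.roots = Multiset.replicate n θ := by
    rw [Multiset.eq_replicate]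
    constructor
    · rw [← hPdeg]
      exact (Polynomial.splits_iff_card_roots.1 (IsAlgClosed.splits P))
    · intro z hz
      apply hall
      rw [Polynomial.mem_roots hP0, Polynomial.IsRoot, hP, Polynomial.eval_map, ← Polynomial.aeval_def] at hz
      exact hz
  have hfac : P = Polynomial.C P.leadingCoeff * (Polynomial.X - Polynomial.C θ) ^ n := by
    have := (IsAlgClosed.splits P).eq_prod_roots
    rw [hroots] at this
    simpa using this
  set c := p.leadingCoeff with hc
  have hc0 : c ≠ 0 := Polynomial.leadingCoeff_ne_zero.2 hp0
  have hcf : c = f n := by rw [hc, Polynomial.leadingCoeff, hdeg, hp, fpoly_coeff, if_pos le_rfl]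
  have hlc : P.leadingCoeff = (c:ℂ) := by
    rw [hP, Polynomial.leadingCoeff_map_of_injective hcast]; simp [hc]
  have hco : ∀ i ≤ n, (f i : ℂ) = c * ((-θ) ^ (n-i) * n.choose i) := by
    intro i hi
    have h1 : P.coeff i = (f i : ℂ) := by
      rw [hP, Polynomial.coeff_map, hp, fpoly_coeff, if_pos hi]; simp
    rw [← h1, hfac, Polynomial.coeff_C_mul, hlc, sub_eq_add_neg, ← Polynomial.C_neg, Polynomial.coeff_X_add_C_pow]
  have hn0 : (n:ℂ) ≠ 0 := by exact_mod_cast (by omega : n ≠ 0)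
  have hcc : (c:ℂ) ≠ 0 := by exact_mod_cast hc0
  obtain ⟨r, hr⟩ : ∃ r : ℚ, (r:ℂ) = θ := by
    have h1 := hco (n-1) (by omega)
    have h2 : n.choose (n-1) = n := by
      rw [Nat.choose_symm_of_eq_add (by omega : n = (n-1)+1), Nat.choose_one_right]
    rw [h2, show n - (n-1) = 1 by omega] at h1
    refine ⟨-(f (n-1) : ℚ) / (c * n), ?_⟩
    push_cast
    rw [h1]; field_simp
  have hq0 : (r.den : ℤ) ≠ 0 := by exact_mod_cast r.den_nz
  have hcop : IsCoprime r.num (r.den : ℤ) := Rat.isCoprime_num_den r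
  have hθ : θ * (r.den:ℂ) = (r.num : ℂ) := by
    rw [← hr]
    have := Rat.mul_den_eq_num r
    exact_mod_cast this
  have hint : ∀ i ≤ n, f i * (r.den : ℤ) ^ (n-i) = c * ((-r.num) ^ (n-i) * n.choose i) := by
    intro i hi
    have h1 := hco i hi
    have h2 : (f i : ℂ) * (r.den:ℂ) ^ (n-i) = c * ((-(r.num:ℂ)) ^ (n-i) * n.choose i) := by
      rw [h1, ← hθ, ← neg_mul, mul_pow]; ring
    exact_mod_cast h2
  have hdvd : (r.den : ℤ) ^ n ∣ c := by
    have h1 := hint 0 (by omega)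
    simp only [Nat.sub_zero, Nat.choose_zero_right, Nat.cast_one, mul_one] at h1
    have h2 : IsCoprime ((r.den:ℤ) ^ n) ((-r.num) ^ n) := (hcop.symm.neg_right).pow
    exact h2.dvd_of_dvd_mul_right ⟨f 0, by rw [← h1]; ring⟩
  obtain ⟨e, he⟩ := hdvd
  refine ⟨e * (-1) ^ n, r.num, r.den, ?_, hcop, ?_⟩
  · apply mul_ne_zero
    · rintro rfl; simp at he; exact hc0 he
    · simp
  · intro i hi
    have h1 := hint i hi
    have h3 : (r.den : ℤ) ^ n = (r.den : ℤ) ^ i * (r.den : ℤ) ^ (n-i) := by rw [← pow_add]; congr 1; omega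
    have h4 : ((-1:ℤ)) ^ n = (-1) ^ i * (-1) ^ (n-i) := by rw [← pow_add]; congr 1; omega
    have h5 : ((-1:ℤ)) ^ i * (-1) ^ i = 1 := by rw [← mul_pow]; simp
    apply mul_right_cancel₀ (pow_ne_zero (n-i) hq0)
    rw [h1, he, h3, h4, neg_pow (r.num), neg_pow (r.den : ℤ)]
    linear_combination (-(e * (r.den:ℤ) ^ i * (r.den:ℤ) ^ (n-i) * ((-1) ^ (n-i) * r.num ^ (n-i)) * (n.choose i : ℤ))) * h5

lemma form_eval_power (n : ℕ) (f : ℕ → ℤ) (c r q : ℤ)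
    (h : ∀ i ≤ n, f i = c * n.choose i * (-q) ^ i * r ^ (n - i)) (a b : ℤ) :
    bform n f a b = c * (r * b - q * a) ^ n := by
  have : r * b - q * a = (-q * a) + (r * b) := by ring
  rw [this, add_pow, bform, Finset.mul_sum]
  apply Finset.sum_congr rfl
  intro i hi
  rw [h i (by have := Finset.mem_range.1 hi; omega), mul_pow, mul_pow]
  ring

lemma form_count (ε : ℝ) (hε : 0 < ε) (n : ℕ) (hn1 : 1 ≤ n) : ∃ C : ℝ, 1 ≤ C ∧
    ∀ (f : ℕ → ℤ) (R : ℤ) (B : ℝ), (∃ i ≤ n, f i ≠ 0) → R ≠ 0 → 1 ≤ B →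
    (∀ i, |(f i : ℝ)| ≤ B) → |(R : ℝ)| ≤ B →
    ∀ V : Finset (ℤ × ℤ), (∀ z ∈ V, |(z.1 : ℝ)| ≤ B ∧ |(z.2:ℝ)| ≤ B ∧ bform n f z.1 z.2 ∣ R) →
    (V.card : ℝ) ≤ C * B ^ ε ∨
    ∃ c r q : ℤ, c ≠ 0 ∧ IsCoprime r q ∧ (∀ i ≤ n, f i = c * n.choose i * (-q) ^ i * r ^ (n - i)) ∧
      ((V.image (fun z => r * z.2 - q * z.1)).card : ℝ) ≤ C * B ^ ε := by
  classical
  obtain ⟨C1, hC1, hroot⟩ := root_values (ε/2) (by positivity) n hn1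
  obtain ⟨C2, hC2, hdiv⟩ := divisors_bound (ε/2) (by positivity)
  refine ⟨(C1 + 2 * C2) ^ 2, by nlinarith, ?_⟩
  intro f R B hf hR hB hfB hRB V hV
  have hBe : 1 ≤ B ^ (ε/2) := Real.one_le_rpow hB (by positivity)
  have hBB : B ^ ε = B ^ (ε/2) * B ^ (ε/2) := by
    rw [← Real.rpow_add (by linarith)]; congr 1; ring
  have hdvd : ∀ g : ℤ × ℤ → ℤ, (∀ z ∈ V, g z ∣ R) → ((V.image g).card : ℝ) ≤ 2 * C2 * B ^ (ε/2) := by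
    intro g hg
    have h1 := image_dvd_card R hR (V.image g) (by
      intro t ht
      obtain ⟨z, hz, rfl⟩ := Finset.mem_image.1 ht
      exact hg z hz)
    have h2 := hdiv R.natAbs (by simpa using hR)
    have h3 : ((R.natAbs : ℕ) : ℝ) ≤ B := by rw [Nat.cast_natAbs]; push_cast; exact hRB
    calc ((V.image g).card : ℝ) ≤ 2 * (R.natAbs.divisors.card : ℝ) := by exact_mod_cast h1
      _ ≤ 2 * (C2 * (R.natAbs : ℝ) ^ (ε/2)) := by gcongr
      _ ≤ 2 * (C2 * B ^ (ε/2)) := by gcongr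
      _ = _ := by ring
  have hprod : ∀ s t : ℝ, 0 ≤ s → 0 ≤ t → s ≤ (C1 + 2*C2) * B ^ (ε/2) → t ≤ (C1 + 2*C2) * B ^ (ε/2) →
      s * t ≤ (C1 + 2 * C2) ^ 2 * B ^ ε := by
    intro s t hs ht h1 h2
    rw [hBB]
    calc s * t ≤ ((C1 + 2*C2) * B ^ (ε/2)) * ((C1 + 2*C2) * B ^ (ε/2)) := by gcongr
      _ = _ := by ring
  have hw1 : ∀ s : ℝ, s ≤ C1 * B ^ (ε/2) → s ≤ (C1 + 2*C2) * B ^ (ε/2) := by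
    intro s hs; nlinarith
  have hw2 : ∀ s : ℝ, s ≤ 2 * C2 * B ^ (ε/2) → s ≤ (C1 + 2*C2) * B ^ (ε/2) := by
    intro s hs; nlinarith
  have hw3 : ∀ s : ℝ, s ≤ 2 * C2 * B ^ (ε/2) → s ≤ (C1 + 2*C2) ^ 2 * B ^ ε := by
    intro s hs
    rcases le_or_gt 0 s with h0 | h0
    · have := hprod s 1 h0 (by norm_num) (hw2 s hs) (by nlinarith)
      linarith
    · have : 0 ≤ (C1 + 2*C2) ^ 2 * B ^ ε := by positivity
      linarith
  set p := fpoly n f with hp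
  have hp0 : p ≠ 0 := by
    obtain ⟨i, hi, hfi⟩ := hf
    intro h
    have := fpoly_coeff n f i
    rw [← hp, h, if_pos hi] at this
    exact hfi (by simpa using this.symm)
  rcases (fpoly_natDegree n f).lt_or_eq with hlt | heq
  · -- b divides
    have hfn : f n = 0 := by
      have := fpoly_coeff n f n
      rw [if_pos le_rfl] at this
      rw [← this]
      exact Polynomial.coeff_eq_zero_of_natDegree_lt hlt
    rcases Nat.eq_zero_or_pos p.natDegree with h0 | hpos
    · right
      have hcoef : ∀ i ≤ n, 1 ≤ i → f i = 0 := by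
        intro i hi h1
        have := fpoly_coeff n f i
        rw [if_pos hi] at this
        rw [← this]
        exact Polynomial.coeff_eq_zero_of_natDegree_lt (by rw [← hp]; omega)
      have hf0 : f 0 ≠ 0 := by
        obtain ⟨i, hi, hfi⟩ := hf
        rcases Nat.eq_zero_or_pos i with h | h
        · rwa [h] at hfi
        · exact absurd (hcoef i hi h) hfi
      have hform : ∀ i ≤ n, f i = f 0 * n.choose i * (-0) ^ i * 1 ^ (n - i) := by
        intro i hi
        rcases Nat.eq_zero_or_pos i with h | h
        · subst h; simp
        · rw [hcoef i hi h]; simp; right; omega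
      refine ⟨f 0, 1, 0, hf0, isCoprime_one_left, hform, ?_⟩
      apply hw3
      apply hdvd
      intro z hz
      obtain ⟨-, -, h3⟩ := hV z hz
      rw [form_eval_power n f _ _ _ hform] at h3
      exact (Dvd.intro_left _ rfl : _ ∣ f 0 * _).trans
        ((mul_dvd_mul_left _ (dvd_pow_self _ (by omega))).trans h3)
    · left
      obtain ⟨θ, hθ⟩ := IsAlgClosed.exists_aeval_eq_zero ℂ p (by
        intro h; have := Polynomial.natDegree_eq_zero_iff_degree_le_zero.2 h.le; omega)
      have h1 := hroot f R B θ hp0 hR hB hfB hRB hθ V hV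
      have h2 := hdvd (fun z => z.2) (by
        intro z hz
        obtain ⟨-, -, h3⟩ := hV z hz
        refine Dvd.dvd.trans ?_ h3
        rw [bform]
        apply Finset.dvd_sum
        intro i hi
        by_cases hin : i = n
        · rw [hin, hfn]; simp
        · exact Dvd.dvd.mul_left (dvd_pow_self _ (by have := Finset.mem_range.1 hi; omega)) _)
      have h3 := card_le_pair V (fun z => (z.1 : ℂ) - θ * z.2) (fun z => z.2) (by
        intro z _ w _ e1 e2
        rw [e2] at e1
        have : (z.1:ℂ) = w.1 := by linear_combination e1
        exact Prod.ext (by exact_mod_cast this) e2)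
      calc (V.card : ℝ) ≤ _ := by exact_mod_cast h3
        _ ≤ _ := hprod _ _ (by positivity) (by positivity) (hw1 _ h1) (hw2 _ h2)
  · change p.natDegree = n at heq
    obtain ⟨θ, hθ⟩ := IsAlgClosed.exists_aeval_eq_zero ℂ p (by
        intro h; have := Polynomial.natDegree_eq_zero_iff_degree_le_zero.2 h.le; omega)
    by_cases hall : ∀ z : ℂ, Polynomial.aeval z p = 0 → z = θ
    · right
      obtain ⟨c, r, q, hc, hrq, hform⟩ := single_root n hn1 f p hp hp0 heq θ hall
      refine ⟨c, r, q, hc, hrq, hform, ?_⟩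
      apply hw3
      apply hdvd
      intro z hz
      obtain ⟨-, -, h3⟩ := hV z hz
      rw [form_eval_power n f _ _ _ hform] at h3
      exact (Dvd.intro_left _ rfl : _ ∣ c * _).trans
        ((mul_dvd_mul_left _ (dvd_pow_self _ (by omega))).trans h3)
    · left
      push Not at hall
      obtain ⟨θ', hθ', hne⟩ := hall
      have h1 := hroot f R B θ hp0 hR hB hfB hRB hθ V hV
      have h2 := hroot f R B θ' hp0 hR hB hfB hRB hθ' V hV
      have h3 := card_le_pair V (fun z => (z.1 : ℂ) - θ * z.2) (fun z => (z.1 : ℂ) - θ' * z.2) (by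
        intro z _ w _ e1 e2
        have e3 : (θ' - θ) * ((z.2:ℂ) - w.2) = 0 := by linear_combination e1 - e2
        have e4 : (z.2:ℂ) = w.2 := by
          rcases mul_eq_zero.1 e3 with h | h
          · exact absurd (sub_eq_zero.1 h) hne
          · exact sub_eq_zero.1 h
        have : (z.1:ℂ) = w.1 := by rw [e4] at e1; linear_combination e1
        exact Prod.ext (by exact_mod_cast this) (by exact_mod_cast e4))
      calc (V.card : ℝ) ≤ _ := by exact_mod_cast h3
        _ ≤ _ := hprod _ _ (by positivity) (by positivity) (hw1 _ h1) (hw1 _ h2)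

end SFV


namespace SFV
open Finset

@[ext] structure Pt where
  a : ℤ
  b : ℤ
  u : ℤ
  v : ℤ

def qf (A B C : ℤ) (P : Pt) : ℤ := A * P.a ^ 2 + B * P.a * P.b + C * P.b ^ 2

def IsPt (P : Pt) : Prop := 0 < P.b ∧ (P.a ^ 2 - P.b ^ 2) * P.v + 2 * P.a * P.b * P.u = 1

def InjAB (V : Finset Pt) : Prop := ∀ P ∈ V, ∀ Q ∈ V, P.a = Q.a → P.b = Q.b → P = Q

def LineHyp (V : Finset Pt) : Prop := ∀ A B C D E F c r q h : ℤ, c ≠ 0 → IsCoprime r q → h ≠ 0 →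
  D = c * q ^ 4 → E - 2 * A = -4 * c * r * q ^ 3 → F - D - 2 * B = 6 * c * r ^ 2 * q ^ 2 →
  -E - 2 * C = -4 * c * r ^ 3 * q → -F = c * r ^ 4 →
  ∀ W ⊆ V, (∀ P ∈ W, r * P.b - q * P.a = h ∧ P.v * qf A B C P + P.u * qf D E F P = 0) → W.card ≤ 2

def c4 (x0 x1 x2 x3 x4 : ℤ) : ℕ → ℤ
  | 0 => x0
  | 1 => x1
  | 2 => x2
  | 3 => x3
  | 4 => x4
  | _ => 0

lemma c4_bound (x0 x1 x2 x3 x4 : ℤ) (B : ℝ) (h0 : |(x0:ℝ)| ≤ B) (h1 : |(x1:ℝ)| ≤ B) (h2 : |(x2:ℝ)| ≤ B)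
    (h3 : |(x3:ℝ)| ≤ B) (h4 : |(x4:ℝ)| ≤ B) : ∀ i, |(c4 x0 x1 x2 x3 x4 i:ℝ)| ≤ B := by
  intro i
  match i with
  | 0 => exact h0
  | 1 => exact h1
  | 2 => exact h2
  | 3 => exact h3
  | 4 => exact h4
  | (n+5) => simp only [c4]; simp; exact (abs_nonneg _).trans h0

lemma IsPt.coprime {P : Pt} (h : IsPt P) : IsCoprime P.a P.b :=
  ⟨P.a * P.v + 2 * P.b * P.u, -P.b * P.v, by linear_combination h.2⟩

lemma InjAB.subset {V W : Finset Pt} (h : InjAB V) (hW : W ⊆ V) : InjAB W :=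
  fun P hP Q hQ => h P (hW hP) Q (hW hQ)

lemma LineHyp.subset {V W : Finset Pt} (h : LineHyp V) (hW : W ⊆ V) : LineHyp W := by
  intro A B C D E F c r q hh h1 h2 h3 h4 h5 h6 h7 h8 X hX
  exact h A B C D E F c r q hh h1 h2 h3 h4 h5 h6 h7 h8 X (hX.trans hW)

lemma slope_inj {P Q : Pt} (hP : IsPt P) (hQ : IsPt Q) (h : P.a * Q.b = Q.a * P.b) :
    P.a = Q.a ∧ P.b = Q.b := by
  have h1 : P.b ∣ Q.b := by
    apply hP.coprime.symm.dvd_of_dvd_mul_left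
    exact ⟨Q.a, by rw [h]; ring⟩
  have h2 : Q.b ∣ P.b := by
    apply hQ.coprime.symm.dvd_of_dvd_mul_left
    exact ⟨P.a, by rw [← h]; ring⟩
  have hb : P.b = Q.b := Int.dvd_antisymm hP.1.le hQ.1.le h1 h2
  refine ⟨?_, hb⟩
  rw [hb] at h
  exact mul_right_cancel₀ hQ.1.ne' h

lemma zero_count (V : Finset Pt) (hV : ∀ P ∈ V, IsPt P) (hinj : InjAB V) (A B C : ℤ)
    (h0 : ¬ (A = 0 ∧ B = 0 ∧ C = 0)) (hz : ∀ P ∈ V, qf A B C P = 0) : V.card ≤ 2 := by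
  classical
  set p : Polynomial ℚ := Polynomial.C (A:ℚ) * Polynomial.X ^ 2 + Polynomial.C (B:ℚ) * Polynomial.X + Polynomial.C (C:ℚ) with hp
  have hp0 : p ≠ 0 := by
    intro h
    apply h0
    have e2 := congrArg (fun r => Polynomial.eval 1 r) h
    have e1 := congrArg (fun r => Polynomial.eval (-1) r) h
    have e0 := congrArg (fun r => Polynomial.eval 0 r) h
    simp [hp] at e2 e1 e0
    have e2' : A + B + C = 0 := by exact_mod_cast e2
    have e1' : A + -B + C = 0 := by exact_mod_cast e1
    omega
  have hdeg : p.natDegree ≤ 2 := by rw [hp]; exact Polynomial.natDegree_quadratic_le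
  calc V.card ≤ p.roots.toFinset.card := by
        apply Finset.card_le_card_of_injOn (fun P => (P.a : ℚ) / P.b)
        · intro P hP
          have hb : (P.b : ℚ) ≠ 0 := by exact_mod_cast (hV P hP).1.ne'
          rw [Finset.mem_coe, Multiset.mem_toFinset, Polynomial.mem_roots hp0, Polynomial.IsRoot]
          have := hz P hP
          rw [qf] at this
          have h2 : (A:ℚ) * P.a ^ 2 + B * P.a * P.b + C * P.b ^ 2 = 0 := by exact_mod_cast this
          simp [hp]
          field_simp
          linear_combination h2
        · intro P hP Q hQ h
          have hb : (P.b : ℚ) ≠ 0 := by exact_mod_cast (hV P hP).1.ne'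
          have hb' : (Q.b : ℚ) ≠ 0 := by exact_mod_cast (hV Q hQ).1.ne'
          simp only at h
          rw [div_eq_div_iff hb hb'] at h
          have h' : P.a * Q.b = Q.a * P.b := by exact_mod_cast h
          have := slope_inj (hV P hP) (hV Q hQ) h'
          exact hinj P hP Q hQ this.1 this.2
    _ ≤ _ := (Multiset.toFinset_card_le _).trans ((Polynomial.card_roots' _).trans hdeg)

/-- from form_count to points -/
lemma pts_form_count (ε : ℝ) (hε : 0 < ε) (n : ℕ) (hn : 1 ≤ n) : ∃ C : ℝ, 1 ≤ C ∧
    ∀ (f : ℕ → ℤ) (R : ℤ) (B : ℝ), R ≠ 0 → 1 ≤ B →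
    (∀ i, |(f i : ℝ)| ≤ B) → |(R : ℝ)| ≤ B →
    ∀ V : Finset Pt, InjAB V → (∀ P ∈ V, |(P.a : ℝ)| ≤ B ∧ |(P.b:ℝ)| ≤ B ∧ bform n f P.a P.b ∣ R) →
    (∀ c r q h : ℤ, c ≠ 0 → IsCoprime r q → h ≠ 0 →
      (∀ i ≤ n, f i = c * n.choose i * (-q) ^ i * r ^ (n - i)) →
      ∀ W ⊆ V, (∀ P ∈ W, r * P.b - q * P.a = h) → W.card ≤ 2) →
    (V.card : ℝ) ≤ C * B ^ ε := by
  classical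
  obtain ⟨C, hC, hmain⟩ := form_count ε hε n hn
  refine ⟨2 * C, by linarith, ?_⟩
  intro f R B hR hB hfB hRB V hinj hV hpow
  have hB0 : 0 ≤ B ^ ε := by positivity
  rcases V.eq_empty_or_nonempty with hVe | ⟨P0, hP0⟩
  · rw [hVe]; simp; positivity
  have hf : ∃ i ≤ n, f i ≠ 0 := by
    by_contra hcon
    push Not at hcon
    have h1 := (hV P0 hP0).2.2
    have h2 : bform n f P0.a P0.b = 0 := by
      rw [bform]
      apply Finset.sum_eq_zero
      intro i hi
      rw [hcon i (by have := Finset.mem_range.1 hi; omega)]; ring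
    rw [h2] at h1
    exact hR (zero_dvd_iff.1 h1)
  have hmain' := hmain f R B hf hR hB hfB hRB (V.image (fun P => (P.a, P.b))) (by
    intro z hz
    obtain ⟨P, hP, rfl⟩ := Finset.mem_image.1 hz
    exact hV P hP)
  have hinjo : Set.InjOn (fun P : Pt => (P.a, P.b)) (V : Set Pt) := by
    intro P hP Q hQ h
    simp only [Prod.mk.injEq] at h
    exact hinj P hP Q hQ h.1 h.2
  rcases hmain' with h | ⟨c, r, q, hc, hrq, hform, hcard⟩
  · rw [Finset.card_image_of_injOn hinjo] at h
    nlinarith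
  · rw [Finset.image_image] at hcard
    have h1 : V.card ≤ 2 * (V.image ((fun z : ℤ × ℤ => r * z.2 - q * z.1) ∘ (fun P : Pt => (P.a, P.b)))).card := by
      apply Finset.card_le_mul_card_image
      intro h hh
      apply hpow c r q h hc hrq _ hform _ (Finset.filter_subset _ _)
      · intro P hP
        exact (Finset.mem_filter.1 hP).2
      · rintro rfl
        obtain ⟨P, hP, hP2⟩ := Finset.mem_image.1 hh
        simp only [Function.comp] at hP2
        have := (hV P hP).2.2
        rw [form_eval_power n f c r q hform, hP2, zero_pow (by omega), mul_zero] at this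
        exact hR (zero_dvd_iff.1 this)
    calc (V.card : ℝ) ≤ 2 * (V.image ((fun z : ℤ × ℤ => r * z.2 - q * z.1) ∘ (fun P : Pt => (P.a, P.b)))).card := by exact_mod_cast h1
      _ ≤ 2 * (C * B ^ ε) := by gcongr
      _ = _ := by ring

lemma cop_dvd {a b g R : ℤ} (n : ℕ) (hab : IsCoprime a b) (h1 : g ∣ R * a ^ n) (h2 : g ∣ R * b ^ n) : g ∣ R := by
  obtain ⟨s, t, hst⟩ := (hab.pow : IsCoprime (a ^ n) (b ^ n))
  have : R = s * (R * a ^ n) + t * (R * b ^ n) := by linear_combination -R * hst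
  rw [this]
  exact dvd_add (Dvd.dvd.mul_left h1 _) (Dvd.dvd.mul_left h2 _)

lemma cnt2 (ε : ℝ) (hε : 0 < ε) : ∃ K : ℝ, 1 ≤ K ∧ ∀ (A B C D E F : ℤ) (H : ℝ), 1 ≤ H →
    |(A:ℝ)| ≤ H → |(B:ℝ)| ≤ H → |(C:ℝ)| ≤ H → |(D:ℝ)| ≤ H → |(E:ℝ)| ≤ H → |(F:ℝ)| ≤ H →
    (A * F - C * D) ^ 2 - (A * E - B * D) * (B * F - C * E) ≠ 0 →
    ∀ V : Finset Pt, (∀ P ∈ V, IsPt P ∧ |(P.a : ℝ)| ≤ H ∧ |(P.b:ℝ)| ≤ H) → InjAB V → LineHyp V →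
    (∀ P ∈ V, P.v * qf A B C P + P.u * qf D E F P = 0) → (V.card : ℝ) ≤ K * (8 * H ^ 4) ^ ε := by
  obtain ⟨K, hK, hm⟩ := pts_form_count ε hε 4 (by norm_num)
  refine ⟨K, hK, ?_⟩
  intro A B C D E F H hH hA hB hC hD hE hF hR V hV hinj hline hcurve
  have hH4 : H ≤ H ^ 4 := le_self_pow₀ hH (by norm_num)
  have key : ∀ P ∈ V, bform 4 (c4 (-F) (-E-2*C) (F-D-2*B) (E-2*A) D) P.a P.b =
      qf D E F P * (P.a^2-P.b^2) - 2 * qf A B C P * P.a * P.b := by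
    intro P _
    simp only [bform, Finset.sum_range_succ, Finset.sum_range_zero, c4, qf]
    norm_num
    ring
  have hdv : ∀ P ∈ V, bform 4 (c4 (-F) (-E-2*C) (F-D-2*B) (E-2*A) D) P.a P.b ∣ qf A B C P ∧
      bform 4 (c4 (-F) (-E-2*C) (F-D-2*B) (E-2*A) D) P.a P.b ∣ qf D E F P := by
    intro P hP
    rw [key P hP]
    have e1 := (hV P hP).1.2
    have e2 := hcurve P hP
    constructor
    · refine ⟨-P.u, ?_⟩
      linear_combination (-qf A B C P) * e1 + (P.a^2-P.b^2) * e2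
    · refine ⟨P.v, ?_⟩
      linear_combination (-qf D E F P) * e1 + (2*P.a*P.b) * e2
  apply hm (c4 (-F) (-E-2*C) (F-D-2*B) (E-2*A) D) _ (8*H^4) hR (by linarith)
  · apply c4_bound
    all_goals
      push_cast
      rw [abs_le] at *
      constructor <;> linarith [hA.1, hA.2, hB.1, hB.2, hC.1, hC.2]
  · push_cast
    have f1 : |(A:ℝ) * F - C * D| ≤ 2 * H^2 := by
      calc _ ≤ |(A:ℝ) * F| + |(C:ℝ) * D| := abs_sub _ _
        _ ≤ H * H + H * H := by rw [abs_mul, abs_mul]; gcongr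
        _ = _ := by ring
    have f2 : |(A:ℝ) * E - B * D| ≤ 2 * H^2 := by
      calc _ ≤ |(A:ℝ) * E| + |(B:ℝ) * D| := abs_sub _ _
        _ ≤ H * H + H * H := by rw [abs_mul, abs_mul]; gcongr
        _ = _ := by ring
    have f3 : |(B:ℝ) * F - C * E| ≤ 2 * H^2 := by
      calc _ ≤ |(B:ℝ) * F| + |(C:ℝ) * E| := abs_sub _ _
        _ ≤ H * H + H * H := by rw [abs_mul, abs_mul]; gcongr
        _ = _ := by ring
    calc _ ≤ |((A:ℝ) * F - C * D)^2| + |((A:ℝ) * E - B * D) * (B * F - C * E)| := abs_sub _ _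
      _ ≤ (2*H^2)^2 + (2*H^2)*(2*H^2) := by rw [abs_mul, abs_pow]; gcongr
      _ = _ := by ring
  · exact hinj
  · intro P hP
    obtain ⟨h1, h2, h3⟩ := hV P hP
    refine ⟨by linarith, by linarith, ?_⟩
    obtain ⟨d1, d2⟩ := hdv P hP
    set g := bform 4 (c4 (-F) (-E-2*C) (F-D-2*B) (E-2*A) D) P.a P.b
    apply cop_dvd 3 h1.coprime
    · have : ((A * F - C * D) ^ 2 - (A * E - B * D) * (B * F - C * E)) * P.a ^ 3 =
        qf A B C P * (((A * F - C * D)) * P.a * F - (B * F - C * E) * P.a * E - (B*F-C*E) * P.b * F) +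
        qf D E F P * (-((A * F - C * D)) * P.a * C + (B * F - C * E) * P.a * B + (B*F-C*E) * P.b * C) := by
        simp only [qf]; ring
      rw [this]
      exact dvd_add (Dvd.dvd.mul_right d1 _) (Dvd.dvd.mul_right d2 _)
    · have : ((A * F - C * D) ^ 2 - (A * E - B * D) * (B * F - C * E)) * P.b ^ 3 =
        qf A B C P * (-((A * F - C * D)) * P.b * D + (A * E - B * D) * P.b * E + (A*E-B*D) * P.a * D) +
        qf D E F P * (((A * F - C * D)) * P.b * A - (A * E - B * D) * P.b * B - (A*E-B*D) * P.a * A) := by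
        simp only [qf]; ring
      rw [this]
      exact dvd_add (Dvd.dvd.mul_right d1 _) (Dvd.dvd.mul_right d2 _)
  · intro c r q h hc hrq hh hform W hW hWl
    have i0 := hform 0 (by norm_num)
    have i1 := hform 1 (by norm_num)
    have i2 := hform 2 (by norm_num)
    have i3 := hform 3 (by norm_num)
    have i4 := hform 4 (by norm_num)
    simp [c4, Nat.choose] at i0 i1 i2 i3 i4
    refine hline A B C D E F c r q h hc hrq hh ?_ ?_ ?_ ?_ ?_ W hW (fun P hP => ⟨hWl P hP, hcurve P (hW hP)⟩)
    · rw [i4]; ring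
    · rw [i3]; ring
    · rw [i2]; ring
    · rw [i1]; ring
    · rw [i0]

end SFV


namespace SFV
open Finset

lemma cnt1 (ε : ℝ) (hε : 0 < ε) : ∃ K : ℝ, 1 ≤ K ∧ ∀ (A B D E : ℤ) (H : ℝ), 1 ≤ H →
    |(A:ℝ)| ≤ H → |(B:ℝ)| ≤ H → |(D:ℝ)| ≤ H → |(E:ℝ)| ≤ H →
    A * E - B * D ≠ 0 →
    ∀ V : Finset Pt, (∀ P ∈ V, IsPt P ∧ |(P.a : ℝ)| ≤ H ∧ |(P.b:ℝ)| ≤ H) → InjAB V → LineHyp V →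
    (∀ P ∈ V, P.v * (A * P.a + B * P.b) + P.u * (D * P.a + E * P.b) = 0) →
    (V.card : ℝ) ≤ K * (8 * H ^ 4) ^ ε := by
  obtain ⟨K, hK, hm⟩ := pts_form_count ε hε 3 (by norm_num)
  refine ⟨K, hK, ?_⟩
  intro A B D E H hH hA hB hD hE hR V hV hinj hline hcurve
  have hH4 : H ≤ H ^ 4 := le_self_pow₀ hH (by norm_num)
  have hH24 : H ^ 2 ≤ H ^ 4 := pow_le_pow_right₀ hH (by norm_num)
  have key : ∀ P ∈ V, bform 3 (c4 (-E) (-D-2*B) (E-2*A) D 0) P.a P.b =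
      (D * P.a + E * P.b) * (P.a^2-P.b^2) - 2 * (A * P.a + B * P.b) * P.a * P.b := by
    intro P _
    simp only [bform, Finset.sum_range_succ, Finset.sum_range_zero, c4]
    norm_num
    ring
  have hdv : ∀ P ∈ V, bform 3 (c4 (-E) (-D-2*B) (E-2*A) D 0) P.a P.b ∣ (A * P.a + B * P.b) ∧
      bform 3 (c4 (-E) (-D-2*B) (E-2*A) D 0) P.a P.b ∣ (D * P.a + E * P.b) := by
    intro P hP
    rw [key P hP]
    have e1 := (hV P hP).1.2
    have e2 := hcurve P hP
    constructor
    · refine ⟨-P.u, ?_⟩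
      linear_combination (-(A * P.a + B * P.b)) * e1 + (P.a^2-P.b^2) * e2
    · refine ⟨P.v, ?_⟩
      linear_combination (-(D * P.a + E * P.b)) * e1 + (2*P.a*P.b) * e2
  apply hm (c4 (-E) (-D-2*B) (E-2*A) D 0) _ (8*H^4) hR (by linarith)
  · apply c4_bound
    all_goals
      push_cast
      rw [abs_le] at *
      constructor <;> linarith [hA.1, hA.2, hB.1, hB.2]
  · push_cast
    calc _ ≤ |(A:ℝ) * E| + |(B:ℝ) * D| := abs_sub _ _
        _ ≤ H * H + H * H := by rw [abs_mul, abs_mul]; gcongr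
        _ ≤ _ := by nlinarith
  · exact hinj
  · intro P hP
    obtain ⟨h1, h2, h3⟩ := hV P hP
    refine ⟨by linarith, by linarith, ?_⟩
    obtain ⟨d1, d2⟩ := hdv P hP
    set g := bform 3 (c4 (-E) (-D-2*B) (E-2*A) D 0) P.a P.b
    apply cop_dvd 1 h1.coprime
    · have : (A * E - B * D) * P.a ^ 1 = (A * P.a + B * P.b) * E + (D * P.a + E * P.b) * (-B) := by ring
      rw [this]
      exact dvd_add (Dvd.dvd.mul_right d1 _) (Dvd.dvd.mul_right d2 _)
    · have : (A * E - B * D) * P.b ^ 1 = (A * P.a + B * P.b) * (-D) + (D * P.a + E * P.b) * A := by ring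
      rw [this]
      exact dvd_add (Dvd.dvd.mul_right d1 _) (Dvd.dvd.mul_right d2 _)
  · intro c r q h hc hrq hh hform W hW hWl
    have i0 := hform 0 (by norm_num)
    have i1 := hform 1 (by norm_num)
    have i2 := hform 2 (by norm_num)
    have i3 := hform 3 (by norm_num)
    simp [c4, Nat.choose] at i0 i1 i2 i3
    refine hline (-A*q) (A*r-B*q) (B*r) (-D*q) (D*r-E*q) (E*r) c r q h hc hrq hh ?_ ?_ ?_ ?_ ?_ W hW
      (fun P hP => ⟨hWl P hP, ?_⟩)
    · rw [i3]; ring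
    · linear_combination r * i3 - q * i2
    · linear_combination r * i2 - q * i1
    · linear_combination r * i1 - q * i0
    · linear_combination r * i0
    · have := hcurve P (hW hP)
      simp only [qf]
      linear_combination (r * P.b - q * P.a) * this

lemma cnt0 (ε : ℝ) (hε : 0 < ε) : ∃ K : ℝ, 1 ≤ K ∧ ∀ (A D : ℤ) (H : ℝ), 1 ≤ H →
    |(A:ℝ)| ≤ H → |(D:ℝ)| ≤ H → ¬ (A = 0 ∧ D = 0) →
    ∀ V : Finset Pt, (∀ P ∈ V, IsPt P ∧ |(P.a : ℝ)| ≤ H ∧ |(P.b:ℝ)| ≤ H) → InjAB V →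
    (∀ P ∈ V, P.v * A + P.u * D = 0) →
    (V.card : ℝ) ≤ K * (8 * H ^ 4) ^ ε := by
  obtain ⟨K, hK, hm⟩ := pts_form_count ε hε 2 (by norm_num)
  refine ⟨K, hK, ?_⟩
  intro A D H hH hA hD hR V hV hinj hcurve
  have hH4 : H ≤ H ^ 4 := le_self_pow₀ hH (by norm_num)
  have key : ∀ P ∈ V, bform 2 (c4 (-D) (-2*A) D 0 0) P.a P.b =
      D * (P.a^2-P.b^2) - 2 * A * P.a * P.b := by
    intro P _
    simp only [bform, Finset.sum_range_succ, Finset.sum_range_zero, c4]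
    norm_num
    ring
  have hdv : ∀ P ∈ V, bform 2 (c4 (-D) (-2*A) D 0 0) P.a P.b ∣ A ∧
      bform 2 (c4 (-D) (-2*A) D 0 0) P.a P.b ∣ D := by
    intro P hP
    rw [key P hP]
    have e1 := (hV P hP).1.2
    have e2 := hcurve P hP
    constructor
    · refine ⟨-P.u, ?_⟩
      linear_combination (-A) * e1 + (P.a^2-P.b^2) * e2
    · refine ⟨P.v, ?_⟩
      linear_combination (-D) * e1 + (2*P.a*P.b) * e2
  have main : ∀ R : ℤ, R ≠ 0 → |(R:ℝ)| ≤ H → (∀ P ∈ V, bform 2 (c4 (-D) (-2*A) D 0 0) P.a P.b ∣ R) →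
      (V.card : ℝ) ≤ K * (8 * H ^ 4) ^ ε := by
    intro R hR0 hRH hRd
    apply hm (c4 (-D) (-2*A) D 0 0) R (8*H^4) hR0 (by linarith)
    · apply c4_bound
      all_goals
        push_cast
        rw [abs_le] at *
        constructor <;> linarith [hA.1, hA.2, hD.1, hD.2]
    · linarith
    · exact hinj
    · intro P hP
      obtain ⟨h1, h2, h3⟩ := hV P hP
      exact ⟨by linarith, by linarith, hRd P hP⟩
    · intro c r q h hc hrq hh hform W hW hWl
      exfalso
      have i0 := hform 0 (by norm_num)
      have i2 := hform 2 (by norm_num)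
      simp [c4, Nat.choose] at i0 i2
      have : c * (q ^ 2 + r ^ 2) = 0 := by linear_combination -i0 - i2
      rcases mul_eq_zero.1 this with h0 | h0
      · exact hc h0
      · have hq : q = 0 := by nlinarith [sq_nonneg q, sq_nonneg r]
        have hr : r = 0 := by nlinarith [sq_nonneg q, sq_nonneg r]
        obtain ⟨s, t, hst⟩ := hrq
        rw [hq, hr] at hst
        omega
  by_cases hA0 : A = 0
  · have hD0 : D ≠ 0 := fun h => hR ⟨hA0, h⟩
    exact main D hD0 hD (fun P hP => (hdv P hP).2)
  · exact main A hA0 hA (fun P hP => (hdv P hP).1)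

lemma curve_count (ε : ℝ) (hε : 0 < ε) : ∃ K : ℝ, 1 ≤ K ∧ ∀ (A B C D E F : ℤ) (H : ℝ), 1 ≤ H →
    |(A:ℝ)| ≤ H → |(B:ℝ)| ≤ H → |(C:ℝ)| ≤ H → |(D:ℝ)| ≤ H → |(E:ℝ)| ≤ H → |(F:ℝ)| ≤ H →
    ¬ (A = 0 ∧ B = 0 ∧ C = 0 ∧ D = 0 ∧ E = 0 ∧ F = 0) →
    ∀ V : Finset Pt, (∀ P ∈ V, IsPt P ∧ |(P.a : ℝ)| ≤ H ∧ |(P.b:ℝ)| ≤ H) → InjAB V → LineHyp V →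
    (∀ P ∈ V, P.v * qf A B C P + P.u * qf D E F P = 0) → (V.card : ℝ) ≤ K * H ^ ε := by
  classical
  set δ := ε / 12 with hδ
  have hδ0 : 0 < δ := by positivity
  obtain ⟨K2, hK2, h2⟩ := cnt2 δ hδ0
  obtain ⟨K1, hK1, h1⟩ := cnt1 δ hδ0
  obtain ⟨K0, hK0, h0⟩ := cnt0 δ hδ0
  refine ⟨(K2 + K1 + K0 + 2) * (2048:ℝ) ^ δ, ?_, ?_⟩
  · apply one_le_mul_of_one_le_of_one_le (by linarith) (Real.one_le_rpow (by norm_num) hδ0.le)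
  intro A B C D E F H hH hA hB hC hD hE hF hne V hV hinj hline hcurve
  set Y := (8 * (4 * H ^ 3) ^ 4) ^ δ with hY
  have hYe : Y = (2048:ℝ) ^ δ * H ^ ε := by
    rw [hY, show 8 * (4 * H ^ 3) ^ 4 = 2048 * H ^ 12 by ring, Real.mul_rpow (by norm_num) (by positivity),
      ← Real.rpow_natCast H, ← Real.rpow_mul (by linarith)]
    congr 2
    rw [hδ]; push_cast; field_simp
  have hY1 : 1 ≤ Y := by
    rw [hYe]
    exact one_le_mul_of_one_le_of_one_le (Real.one_le_rpow (by norm_num) hδ0.le) (Real.one_le_rpow hH hε.le)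
  have hgoal : (K2 + K1 + K0 + 2) * (2048:ℝ) ^ δ * H ^ ε = (K2 + K1 + K0 + 2) * Y := by rw [hYe]; ring
  rw [hgoal]
  have hHH : H ≤ 4 * H ^ 3 := by
    have := le_self_pow₀ hH (show (3:ℕ) ≠ 0 by norm_num)
    nlinarith
  have hYY : (8 * H ^ 4) ^ δ ≤ Y := by
    rw [hY]; gcongr
  have hV' : ∀ P ∈ V, IsPt P ∧ |(P.a : ℝ)| ≤ 4 * H ^ 3 ∧ |(P.b:ℝ)| ≤ 4 * H ^ 3 :=
    fun P hP => ⟨(hV P hP).1, (hV P hP).2.1.trans hHH, (hV P hP).2.2.trans hHH⟩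
  have b2 : ∀ x y z w : ℤ, |(x:ℝ)| ≤ H → |(y:ℝ)| ≤ H → |(z:ℝ)| ≤ H → |(w:ℝ)| ≤ H →
      |((x * y - z * w : ℤ) : ℝ)| ≤ 2 * H ^ 2 := by
    intro x y z w hx hy hz hw
    push_cast
    calc _ ≤ |(x:ℝ) * y| + |(z:ℝ) * w| := abs_sub _ _
        _ ≤ H * H + H * H := by rw [abs_mul, abs_mul]; gcongr
        _ = _ := by ring
  have b3 : ∀ x y : ℤ, |(x:ℝ)| ≤ H → |(y:ℝ)| ≤ 2 * H ^ 2 → |((x * y : ℤ) : ℝ)| ≤ 2 * H ^ 3 := by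
    intro x y hx hy
    push_cast
    rw [abs_mul]
    calc |(x:ℝ)| * |(y:ℝ)| ≤ H * (2 * H ^ 2) := by gcongr
      _ = _ := by ring
  have hH3 : 0 ≤ H ^ 3 := by positivity
  by_cases hRes : (A * F - C * D) ^ 2 - (A * E - B * D) * (B * F - C * E) = 0
  swap
  · have := h2 A B C D E F H hH hA hB hC hD hE hF hRes V hV hinj hline hcurve
    nlinarith
  -- split helper
  have split : ∀ (T : ℝ) (p : Pt → Prop) [DecidablePred p] (A' B' C' : ℤ), ¬ (A' = 0 ∧ B' = 0 ∧ C' = 0) →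
      (∀ P ∈ V, ¬ p P → qf A' B' C' P = 0) → (((V.filter p).card : ℝ) ≤ T * Y) → T ≤ K2 + K1 + K0 →
      (V.card : ℝ) ≤ (K2 + K1 + K0 + 2) * Y := by
    intro T p _ A' B' C' hn0 hz hT hTK
    have e1 := zero_count (V.filter (fun P => ¬ p P)) (fun P hP => (hV P (Finset.mem_filter.1 hP).1).1)
      (hinj.subset (Finset.filter_subset _ _)) A' B' C' hn0
      (fun P hP => hz P (Finset.mem_filter.1 hP).1 (Finset.mem_filter.1 hP).2)
    have e2 := Finset.card_filter_add_card_filter_not (s := V) p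
    have e3 : (V.card : ℝ) ≤ (V.filter p).card + 2 := by
      have : V.card ≤ (V.filter p).card + 2 := by omega
      exact_mod_cast this
    nlinarith
  by_cases hal : A * E - B * D = 0
  swap
  · set al := A * E - B * D with hal_def
    set be := A * F - C * D with hbe_def
    have ba := b2 A E B D hA hE hB hD
    have bb := b2 A F C D hA hF hC hD
    rw [← hal_def] at ba
    rw [← hbe_def] at bb
    refine split K1 (fun P => P.v * ((A*al) * P.a + (B*al-A*be) * P.b) + P.u * ((D*al) * P.a + (E*al-D*be) * P.b) = 0)
      0 al be (fun h => hal h.2.1) ?_ ?_ (by linarith)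
    · intro P hP hnp
      have hc := hcurve P hP
      have hid : (al * P.a + be * P.b) * (P.v * ((A*al) * P.a + (B*al-A*be) * P.b) + P.u * ((D*al) * P.a + (E*al-D*be) * P.b)) = 0 := by
        have e1 : (al * P.a + be * P.b) * ((A*al) * P.a + (B*al-A*be) * P.b) = al ^ 2 * qf A B C P := by
          simp only [qf]
          linear_combination (-A * P.b ^ 2) * hRes
        have e2 : (al * P.a + be * P.b) * ((D*al) * P.a + (E*al-D*be) * P.b) = al ^ 2 * qf D E F P := by
          simp only [qf]
          linear_combination (-D * P.b ^ 2) * hRes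
        linear_combination P.v * e1 + P.u * e2 + al ^ 2 * hc
      rcases mul_eq_zero.1 hid with h | h
      · simp only [qf]
        linear_combination P.b * h
      · exact absurd h hnp
    · have hdel : (A*al) * (E*al-D*be) - (B*al-A*be) * (D*al) ≠ 0 := by
        have : (A*al) * (E*al-D*be) - (B*al-A*be) * (D*al) = al ^ 3 := by rw [hal_def]; ring
        rw [this]; exact pow_ne_zero _ hal
      have s1 : ∀ x y : ℤ, |((x * al : ℤ) : ℝ)| ≤ 2 * H ^ 3 → |((y * be : ℤ) : ℝ)| ≤ 2 * H ^ 3 →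
          |((x * al - y * be : ℤ) : ℝ)| ≤ 4 * H ^ 3 := by
        intro x y hx hy
        push_cast at hx hy ⊢
        have := abs_sub ((x:ℝ) * al) (y * be)
        linarith
      have c1 := b3 A al hA ba
      have c2 := b3 D al hD ba
      refine h1 (A*al) (B*al-A*be) (D*al) (E*al-D*be) (4*H^3) (by linarith) (by linarith)
        (s1 _ _ (b3 B al hB ba) (b3 A be hA bb)) (by linarith) (s1 _ _ (b3 E al hE ba) (b3 D be hD bb)) hdel _
        (fun P hP => hV' P (Finset.mem_filter.1 hP).1) (hinj.subset (Finset.filter_subset _ _))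
        (hline.subset (Finset.filter_subset _ _)) (fun P hP => (Finset.mem_filter.1 hP).2)
  have hbe : A * F - C * D = 0 := by
    rw [hal] at hRes
    have : (A * F - C * D) ^ 2 = 0 := by linear_combination hRes
    exact pow_eq_zero_iff (two_ne_zero) |>.1 this
  by_cases hga : B * F - C * E = 0
  swap
  · have hA0 : A = 0 := by
      have : A * (B * F - C * E) = 0 := by linear_combination B * hbe - C * hal
      exact (mul_eq_zero.1 this).resolve_right hga
    have hD0 : D = 0 := by
      have : D * (B * F - C * E) = 0 := by linear_combination E * hbe - F * hal
      exact (mul_eq_zero.1 this).resolve_right hga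
    have := h1 B C E F H hH hB hC hE hF hga V hV hinj hline (by
      intro P hP
      have hb := (hV P hP).1.1
      have hc := hcurve P hP
      simp only [qf, hA0, hD0] at hc
      have : P.b * (P.v * (B * P.a + C * P.b) + P.u * (E * P.a + F * P.b)) = 0 := by
        linear_combination hc
      exact (mul_eq_zero.1 this).resolve_left hb.ne')
    nlinarith
  -- proportional
  have prop : ∀ S T : ℤ, |(S:ℝ)| ≤ H → |(T:ℝ)| ≤ H → ¬ (S = 0 ∧ T = 0) →
      (∀ P : Pt, S * qf D E F P = T * qf A B C P) → (V.card : ℝ) ≤ (K2 + K1 + K0 + 2) * Y := by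
    intro S T hS hT hST hpr
    have hq : ∀ P ∈ V, P.v * S + P.u * T ≠ 0 → qf A B C P = 0 ∧ qf D E F P = 0 := by
      intro P hP hn
      have hc := hcurve P hP
      have hp := hpr P
      constructor
      · have : qf A B C P * (P.v * S + P.u * T) = 0 := by linear_combination S * hc - P.u * hp
        exact (mul_eq_zero.1 this).resolve_right hn
      · have : qf D E F P * (P.v * S + P.u * T) = 0 := by linear_combination T * hc + P.v * hp
        exact (mul_eq_zero.1 this).resolve_right hn
    have hcc : (((V.filter (fun P => P.v * S + P.u * T = 0)).card : ℝ) ≤ K0 * Y) := by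
      have := h0 S T H hH hS hT hST (V.filter (fun P => P.v * S + P.u * T = 0))
        (fun P hP => hV P (Finset.mem_filter.1 hP).1) (hinj.subset (Finset.filter_subset _ _))
        (fun P hP => (Finset.mem_filter.1 hP).2)
      nlinarith
    by_cases hq1 : A = 0 ∧ B = 0 ∧ C = 0
    · exact split K0 (fun P => P.v * S + P.u * T = 0) D E F (fun h => hne ⟨hq1.1, hq1.2.1, hq1.2.2, h⟩)
        (fun P hP hn => (hq P hP hn).2) hcc (by linarith)
    · exact split K0 (fun P => P.v * S + P.u * T = 0) A B C hq1
        (fun P hP hn => (hq P hP hn).1) hcc (by linarith)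
  by_cases hAD : A = 0 ∧ D = 0
  · by_cases hBE : B = 0 ∧ E = 0
    · by_cases hCF : C = 0 ∧ F = 0
      · exact absurd ⟨hAD.1, hBE.1, hCF.1, hAD.2, hBE.2, hCF.2⟩ hne
      · refine prop C F hC hF hCF ?_
        intro P; simp only [qf]
        linear_combination (-P.a^2) * hbe - (P.a * P.b) * hga
    · refine prop B E hB hE hBE ?_
      intro P; simp only [qf]
      linear_combination (-P.a^2) * hal + (P.b ^ 2) * hga
  · refine prop A D hA hD hAD ?_
    intro P; simp only [qf]
    linear_combination (P.a * P.b) * hal + (P.b^2) * hbe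

end SFV


namespace SFV
open Finset

def nval (P : Pt) : ℤ := (P.a ^ 2 - P.b ^ 2) * P.u - 2 * P.a * P.b * P.v

set_option maxHeartbeats 400000 in
/-- difference lemma -/
lemma core2 (X X' h S S' m n n' x ρ : ℝ) (hh : h ≠ 0) (hS : S = X ^ 2 + h ^ 2) (hS' : S' = X' ^ 2 + h ^ 2)
    (hm : 0 < m) (h1 : m < S) (h2 : S ≤ 2 * m) (h1' : m < S') (h2' : S' ≤ 2 * m)
    (hsmall : 100 * h ^ 2 ≤ m) (hpos : 0 ≤ X * X' + h ^ 2)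
    (hn : n * (2 * h ^ 3) = X ^ 3 + 3 * h ^ 2 * X + 2 * h ^ 3 * ρ * S ^ 2)
    (hn' : n' * (2 * h ^ 3) = X' ^ 3 + 3 * h ^ 2 * X' + 2 * h ^ 3 * ρ * S' ^ 2)
    (n0 : 0 ≤ n) (nx : n ≤ x) (n0' : 0 ≤ n') (nx' : n' ≤ x) :
    |X - X'| * m ≤ 10 * x * |h| ^ 3 := by
  have hh2 : 0 < h ^ 2 := by positivity
  have hX2 : (99/100) * m ≤ X ^ 2 := by linarith
  have hX2' : (99/100) * m ≤ X' ^ 2 := by linarith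
  have hXX : (99/100) * m ≤ X * X' := by
    have e1 : ((99/100) * m) ^ 2 ≤ (X * X') ^ 2 := by
      rw [mul_pow X X']
      calc ((99/100) * m) ^ 2 = ((99/100) * m) * ((99/100) * m) := by ring
        _ ≤ X ^ 2 * X' ^ 2 := by gcongr
    have e2 := abs_le_of_sq_le_sq' (a := (99/100)*m) (b := |X * X'|) (by rw [sq_abs]; exact e1) (abs_nonneg _)
    rcases abs_cases (X * X') with ⟨e3, _⟩ | ⟨e3, _⟩
    · rw [e3] at e2; exact e2.2
    · rw [e3] at e2
      exfalso; linarith [e2.2]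
  have hG : (n * S' ^ 2 - n' * S ^ 2) * (2 * h ^ 3) = (X - X') *
      -((X * X' - h ^ 2) * (S * S') + 2 * h ^ 2 * (2 * h ^ 2 * (X * X') - h ^ 4 + X * X' * (X ^ 2 + X * X' + X' ^ 2))) := by
    have : (n * S' ^ 2 - n' * S ^ 2) * (2 * h ^ 3) = (n * (2 * h ^ 3)) * S' ^ 2 - (n' * (2 * h ^ 3)) * S ^ 2 := by ring
    rw [this, hn, hn', hS, hS']; ring
  have hlow : (98/100) * m * (m * m) ≤ ((X * X' - h ^ 2) * (S * S') + 2 * h ^ 2 * (2 * h ^ 2 * (X * X') - h ^ 4 + X * X' * (X ^ 2 + X * X' + X' ^ 2))) := by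
    have e1 : (98/100) * m * (m * m) ≤ (X * X' - h ^ 2) * (S * S') := by
      have : (98/100) * m ≤ X * X' - h ^ 2 := by linarith
      have hp1 : 0 ≤ X * X' - h ^ 2 := by linarith
      have hp2 : m * m ≤ S * S' := mul_le_mul h1.le h1'.le hm.le (by linarith)
      exact mul_le_mul this hp2 (by positivity) hp1
    have e2 : 0 ≤ 2 * h ^ 2 * (X * X') - h ^ 4 + X * X' * (X ^ 2 + X * X' + X' ^ 2) := by
      have e3 : 0 ≤ X * X' := by linarith
      have e4 : h ^ 2 ≤ X * X' := by linarith
      have e5 : h ^ 4 ≤ h ^ 2 * (X * X') := by nlinarith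
      have e6 : 0 ≤ X * X' * (X ^ 2 + X * X' + X' ^ 2) := by positivity
      have e7 : 0 ≤ h ^ 2 * (X * X') := by positivity
      linarith
    have e3 : 0 ≤ 2 * h ^ 2 * (2 * h ^ 2 * (X * X') - h ^ 4 + X * X' * (X ^ 2 + X * X' + X' ^ 2)) := by positivity
    linarith
  set G := ((X * X' - h ^ 2) * (S * S') + 2 * h ^ 2 * (2 * h ^ 2 * (X * X') - h ^ 4 + X * X' * (X ^ 2 + X * X' + X' ^ 2))) with hGdef
  have hx0 : 0 ≤ x := n0.trans nx
  have hup : |n * S' ^ 2 - n' * S ^ 2| ≤ x * (4 * (m * m)) := by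
    have e1 : n * S' ^ 2 ≤ x * (4 * (m * m)) := by
      have : S' ^ 2 ≤ 4 * (m * m) := (pow_le_pow_left₀ (by linarith) h2' 2).trans_eq (by ring)
      gcongr
    have e2 : n' * S ^ 2 ≤ x * (4 * (m * m)) := by
      have : S ^ 2 ≤ 4 * (m * m) := (pow_le_pow_left₀ (by linarith) h2 2).trans_eq (by ring)
      gcongr
    have e3 : 0 ≤ n * S' ^ 2 := by positivity
    have e4 : 0 ≤ n' * S ^ 2 := by positivity
    rw [abs_le]; constructor <;> linarith
  have habs := congrArg abs hG
  have hG0 : 0 ≤ G := le_trans (by positivity) hlow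
  rw [abs_mul, abs_mul (X - X'), abs_neg, abs_of_nonneg hG0, abs_mul 2, abs_pow, abs_of_pos (by norm_num : (0:ℝ) < 2)] at habs
  have h3 : |X - X'| * ((98/100) * m * (m * m)) ≤ x * (4 * (m * m)) * (2 * |h| ^ 3) := by
    calc _ ≤ |X - X'| * G := by gcongr
      _ = _ := habs.symm
      _ ≤ _ := by gcongr
  have hmm : 0 < m * m := by positivity
  have h4 : (|X - X'| * ((98/100) * m)) * (m * m) ≤ (8 * x * |h| ^ 3) * (m * m) := by linarith
  have h5 := le_of_mul_le_mul_right h4 hmm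
  have h6 : 0 ≤ x * |h| ^ 3 := by positivity
  linarith

/-- bound on rho -/
lemma core3 (X h S m r n x ρ : ℝ) (hh : h ≠ 0) (hS : S = X ^ 2 + h ^ 2) (hr : 0 < r) (hm : m = r ^ 2) (h1 : m < S)
    (hn : n * (2 * h ^ 3) = X ^ 3 + 3 * h ^ 2 * X + 2 * h ^ 3 * ρ * S ^ 2)
    (n0 : 0 ≤ n) (nx : n ≤ x) :
    |ρ| ≤ x / m ^ 2 + 3 / (2 * |h| ^ 3 * r) := by
  have hm0 : 0 < m := by rw [hm]; positivity
  have hS0 : 0 < S := hm0.trans h1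
  have hsS : r ≤ Real.sqrt S := by
    apply Real.le_sqrt_of_sq_le; linarith
  set s := Real.sqrt S with hs
  have hss : s ^ 2 = S := Real.sq_sqrt hS0.le
  have hs0 : 0 < s := Real.sqrt_pos.2 hS0
  have hXs : |X| ≤ s := by
    apply abs_le_of_sq_le_sq _ hs0.le; rw [hss, hS]; nlinarith [sq_nonneg h]
  have hh3 : 0 < |h| ^ 3 := by positivity
  have e1 : 2 * h ^ 3 * ρ * S ^ 2 = n * (2 * h ^ 3) - X * (X ^ 2 + 3 * h ^ 2) := by linarith
  have e2 : 2 * |h| ^ 3 * |ρ| * S ^ 2 ≤ x * (2 * |h| ^ 3) + s * (3 * S) := by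
    have : |2 * h ^ 3 * ρ * S ^ 2| = 2 * |h| ^ 3 * |ρ| * S ^ 2 := by
      rw [abs_mul, abs_mul, abs_mul, abs_pow, abs_of_pos (by norm_num : (0:ℝ) < 2), abs_of_pos (by positivity : 0 < S ^ 2)]
    rw [← this, e1]
    calc _ ≤ |n * (2 * h ^ 3)| + |X * (X ^ 2 + 3 * h ^ 2)| := abs_sub _ _
      _ ≤ _ := by
        rw [abs_mul, abs_mul, abs_mul, abs_pow, abs_of_pos (by norm_num : (0:ℝ) < 2), abs_of_nonneg n0,
          abs_of_nonneg (by positivity : 0 ≤ X ^ 2 + 3 * h ^ 2)]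
        have : X ^ 2 + 3 * h ^ 2 ≤ 3 * S := by rw [hS]; nlinarith [sq_nonneg X]
        gcongr
  have e3 : |ρ| ≤ x / S ^ 2 + 3 / (2 * |h| ^ 3 * s) := by
    have : x / S ^ 2 + 3 / (2 * |h| ^ 3 * s) = (x * (2 * |h| ^ 3) + s * (3 * S)) / (2 * |h| ^ 3 * S ^ 2) := by
      rw [← hss]; field_simp
    rw [this, le_div_iff₀ (by positivity)]
    linarith
  refine e3.trans ?_
  have hx0 : 0 ≤ x := n0.trans nx
  gcongr

lemma bez2 (p q : ℤ) (h : IsCoprime p q) : ∃ s t : ℤ, s * (p ^ 2 - q ^ 2) + t * (2 * p * q) = 2 := by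
  have h1 : IsCoprime (p ^ 2 - q ^ 2) p := by
    have : IsCoprime (-(q^2)) p := (h.symm.pow_left).neg_left
    have e : p ^ 2 - q ^ 2 = -(q^2) + p * p := by ring
    rw [e]; exact this.add_mul_left_left p
  have h2 : IsCoprime (p ^ 2 - q ^ 2) q := by
    have : IsCoprime (p^2) q := h.pow_left
    have e : p ^ 2 - q ^ 2 = p^2 + q * (-q) := by ring
    rw [e]; exact this.add_mul_left_left (-q)
  obtain ⟨s, t, hst⟩ := h1.mul_right h2
  exact ⟨2 * s, t, by linear_combination 2 * hst⟩

lemma kappa_bound (p q m1 m2 : ℤ) (h : IsCoprime p q) (κ : ℝ) (hκ : κ ≠ 0)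
    (h1 : (m1:ℝ) = (p ^ 2 - q ^ 2) * κ) (h2 : (m2:ℝ) = -(2 * p * q) * κ) : 1 / 2 ≤ |κ| := by
  obtain ⟨s, t, hst⟩ := bez2 p q h
  have hst' : (s:ℝ) * (p ^ 2 - q ^ 2) + t * (2 * p * q) = 2 := by exact_mod_cast hst
  have e : ((s * m1 - t * m2 : ℤ) : ℝ) = 2 * κ := by
    push_cast
    rw [h1, h2]; linear_combination κ * hst'
  have hne : (s * m1 - t * m2 : ℤ) ≠ 0 := by
    intro h0
    rw [h0] at e
    apply hκ
    push_cast at e; linarith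
  have h3 : (1:ℝ) ≤ |((s * m1 - t * m2 : ℤ) : ℝ)| := by exact_mod_cast Int.one_le_abs hne
  rw [e, abs_mul, abs_of_pos (by norm_num : (0:ℝ) < 2)] at h3
  linarith

/-- integer formula for n on a line -/
lemma n_formula (A B C D E F c p q h : ℤ) (h1 : D = c * q ^ 4) (h2 : E - 2 * A = -4 * c * p * q ^ 3)
    (h3 : F - D - 2 * B = 6 * c * p ^ 2 * q ^ 2) (h4 : -E - 2 * C = -4 * c * p ^ 3 * q) (h5 : -F = c * p ^ 4)
    (P : Pt) (hP : IsPt P) (hl : p * P.b - q * P.a = h) (hc : P.v * qf A B C P + P.u * qf D E F P = 0) :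
    2 * c * h ^ 4 * nval P = c * h * ((P.a * p + P.b * q) ^ 3 + 3 * h ^ 2 * (P.a * p + P.b * q)) +
      (-E + c * p * q * (p ^ 2 - q ^ 2)) * (P.a ^ 2 + P.b ^ 2) ^ 2 := by
  have hg : qf D E F P * (P.a^2-P.b^2) - 2 * qf A B C P * P.a * P.b = c * h ^ 4 := by
    rw [← hl]; simp only [qf]
    linear_combination P.a ^ 4 * h1 + P.a ^ 3 * P.b * h2 + P.a^2 * P.b ^ 2 * h3 + P.a * P.b ^ 3 * h4 + P.b ^ 4 * h5
  have e1 := hP.2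
  have hu : c * h ^ 4 * P.u = - qf A B C P := by
    rw [← hg]; linear_combination (-qf A B C P) * e1 + (P.a^2-P.b^2) * hc
  have hv : c * h ^ 4 * P.v = qf D E F P := by
    rw [← hg]; linear_combination (qf D E F P) * e1 - (2*P.a*P.b) * hc
  have hn : c * h ^ 4 * nval P = - (P.a^2-P.b^2) * qf A B C P - 2 * P.a * P.b * qf D E F P := by
    rw [nval]; linear_combination (P.a^2-P.b^2) * hu - 2 * P.a * P.b * hv
  have hF : F = - c * p ^ 4 := by linarith
  have hA : 2 * A = E + 4 * c * p * q ^ 3 := by linarith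
  have hB : 2 * B = - c * p ^ 4 - c * q ^ 4 - 6 * c * p ^ 2 * q ^ 2 := by linarith
  have hC : 2 * C = -E + 4 * c * p ^ 3 * q := by linarith
  have : 2 * (c * h ^ 4 * nval P) = - (P.a^2-P.b^2) * (2 * A * P.a ^ 2 + 2 * B * P.a * P.b + 2 * C * P.b ^ 2)
     - 4 * P.a * P.b * (D * P.a ^ 2 + E * P.a * P.b + F * P.b ^ 2) := by
    rw [hn]; simp only [qf]; ring
  have e3 : 2 * c * h ^ 4 * nval P = 2 * (c * h ^ 4 * nval P) := by ring
  rw [e3, this, hA, hB, hC, hF, h1, ← hl]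
  ring

end SFV


namespace SFV
open Finset

lemma fin1 (A Z H T x M ρ : ℝ) (hA : 0 < A) (hZ : 0 < Z) (hH : 1 ≤ H) (hT : 0 < T) (hM : 0 < M) (hx : 0 ≤ x)
    (h1 : T * H * M ≤ 2 * A ^ 2) (h2 : T * Z ^ 4 * A ^ 2 ≤ 10 * x * H ^ 3)
    (hρ : |ρ| ≤ x / (Z ^ 2 * A ^ 2) ^ 2 + 3 / (2 * H ^ 3 * (Z * A)))
    (hk : 1 / 2 ≤ |ρ| * Z ^ 4 * T ^ 3) (h3 : 32 * x * A ^ 2 ≤ M ^ 3) :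
    A * Z * H * M ^ 2 ≤ 240 * x * A ^ 2 := by
  have hH0 : 0 < H := by linarith
  have e1 : 1 / 2 ≤ T ^ 3 * x / A ^ 4 + 3 * Z ^ 3 * T ^ 3 / (2 * H ^ 3 * A) := by
    have : T ^ 3 * x / A ^ 4 + 3 * Z ^ 3 * T ^ 3 / (2 * H ^ 3 * A) =
        (x / (Z ^ 2 * A ^ 2) ^ 2 + 3 / (2 * H ^ 3 * (Z * A))) * Z ^ 4 * T ^ 3 := by
      field_simp
    rw [this]
    refine hk.trans ?_
    gcongr
  have e2 : T ^ 3 * x / A ^ 4 ≤ 1 / 4 := by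
    rw [div_le_iff₀ (by positivity)]
    have a1 : (T * H * M) ^ 3 ≤ (2 * A ^ 2) ^ 3 := pow_le_pow_left₀ (by positivity) h1 3
    have a2 : (T * M) ^ 3 ≤ (T * H * M) ^ 3 := by
      apply pow_le_pow_left₀ (by positivity)
      have : T * M * 1 ≤ T * M * H := by gcongr
      linarith
    have a3 : T ^ 3 * (32 * x * A ^ 2) ≤ T ^ 3 * M ^ 3 := by gcongr
    have a4 : T ^ 3 * x * 32 * A ^ 2 ≤ 8 * A ^ 4 * A ^ 2 := by
      calc _ = T ^ 3 * (32 * x * A ^ 2) := by ring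
        _ ≤ (T * M) ^ 3 := by rw [mul_pow]; exact a3
        _ ≤ (2 * A ^ 2) ^ 3 := a2.trans a1
        _ = _ := by ring
    have := le_of_mul_le_mul_right a4 (by positivity)
    linarith
  have e3 : H ^ 3 * A ≤ 6 * Z ^ 3 * T ^ 3 := by
    have : 1 / 4 ≤ 3 * Z ^ 3 * T ^ 3 / (2 * H ^ 3 * A) := by linarith
    rw [le_div_iff₀ (by positivity)] at this
    linarith
  have e4 : Z * A ^ 3 ≤ 60 * x * T ^ 2 := by
    have a1 : T * Z ^ 4 * A ^ 2 * A ≤ 10 * x * H ^ 3 * A := by gcongr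
    have a2 : 10 * x * (H ^ 3 * A) ≤ 10 * x * (6 * Z ^ 3 * T ^ 3) := by gcongr
    have a3 : (Z * A ^ 3) * (T * Z ^ 3) ≤ (60 * x * T ^ 2) * (T * Z ^ 3) := by linarith
    exact le_of_mul_le_mul_right a3 (by positivity)
  have e5 : Z * A ^ 3 * (H ^ 2 * M ^ 2) ≤ 60 * x * (2 * A ^ 2) ^ 2 := by
    calc _ ≤ 60 * x * T ^ 2 * (H ^ 2 * M ^ 2) := by gcongr
      _ = 60 * x * (T * H * M) ^ 2 := by ring
      _ ≤ _ := by gcongr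
  have e6 : (Z * A * H ^ 2 * M ^ 2) * A ^ 2 ≤ (240 * x * A ^ 2) * A ^ 2 := by linarith
  have e7 := le_of_mul_le_mul_right e6 (by positivity)
  have e8 : (A * Z * M ^ 2 * H) * 1 ≤ (A * Z * M ^ 2 * H) * H := by gcongr
  linarith

lemma fin2 (A Z H T x M X h : ℝ) (hA : 0 < A) (hZ : 0 < Z) (hH : 1 ≤ H) (hT : 0 < T) (hM : 0 < M) (hx : 0 ≤ x)
    (h1 : T * H * M ≤ 2 * A ^ 2) (h2 : H ^ 3 ≤ Z ^ 2 * T) (hMD : M ≤ A ^ 2)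
    (h3 : |X| * (X ^ 2 + 3 * h ^ 2) ≤ 2 * x * H ^ 3) (h4 : 100 * h ^ 2 ≤ Z ^ 2 * A ^ 2) (h5 : Z ^ 2 * A ^ 2 ≤ X ^ 2 + h ^ 2) :
    A * Z * H * M ^ 2 ≤ 240 * x * A ^ 2 := by
  have hX : Z * A / 2 ≤ |X| := by
    apply abs_le_of_sq_le_sq' _ (abs_nonneg _) |>.2
    rw [sq_abs]
    have : 0 < Z ^ 2 * A ^ 2 := by positivity
    nlinarith
  have e1 : Z * A / 2 * (Z ^ 2 * A ^ 2) ≤ 2 * x * H ^ 3 := by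
    refine le_trans ?_ h3
    have : Z ^ 2 * A ^ 2 ≤ X ^ 2 + 3 * h ^ 2 := by nlinarith [sq_nonneg h]
    gcongr
  have hH0 : 0 < H := by linarith
  have e2 : H ^ 4 * M ≤ 2 * (Z ^ 2 * A ^ 2) := by
    calc H ^ 4 * M = H ^ 3 * (H * M) := by ring
      _ ≤ Z ^ 2 * T * (H * M) := by gcongr
      _ = Z ^ 2 * (T * H * M) := by ring
      _ ≤ Z ^ 2 * (2 * A ^ 2) := by gcongr
      _ = _ := by ring
  have e3 : (Z * A * H * M) * (Z ^ 2 * A ^ 2) ≤ (8 * x) * (Z ^ 2 * A ^ 2) := by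
    calc _ = 2 * (Z * A / 2 * (Z ^ 2 * A ^ 2)) * (H * M) := by ring
      _ ≤ 2 * (2 * x * H ^ 3) * (H * M) := by gcongr
      _ = 4 * x * (H ^ 4 * M) := by ring
      _ ≤ 4 * x * (2 * (Z ^ 2 * A ^ 2)) := by gcongr
      _ = _ := by ring
  have e4 := le_of_mul_le_mul_right e3 (by positivity)
  calc _ = (Z * A * H * M) * M := by ring
    _ ≤ 8 * x * M := by gcongr
    _ ≤ 8 * x * A ^ 2 := by gcongr
    _ ≤ _ := by
      have : 0 ≤ x * A ^ 2 := by positivity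
      linarith

lemma uv_formula (a b u v p q h n X N S R : ℝ) (hh : h ≠ 0) (hN : N = p ^ 2 + q ^ 2) (hX : X = a * p + b * q)
    (hS : S = X ^ 2 + h ^ 2) (hS0 : S ≠ 0)
    (hl : p * b - q * a = h) (e1 : (a^2-b^2) * v + 2 * a * b * u = 1) (e2 : n = (a^2-b^2) * u - 2 * a * b * v)
    (hn : n * (2 * h ^ 3) = X ^ 3 + 3 * h ^ 2 * X + R * S ^ 2) :
    2 * h ^ 3 * u = (p^2-q^2) * (X + R * (X ^ 2 - h ^ 2)) + 2 * p * q * (- 2 * h - 2 * R * X * h) ∧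
    2 * h ^ 3 * v = (p^2-q^2) * (- 2 * h - 2 * R * X * h) - 2 * p * q * (X + R * (X ^ 2 - h ^ 2)) := by
  have ha : a * N = X * p - h * q := by rw [hX, hN, ← hl]; ring
  have hb : b * N = X * q + h * p := by rw [hX, hN, ← hl]; ring
  have hab : S = N * (a ^ 2 + b ^ 2) := by rw [hS, hX, hN, ← hl]; ring
  have f1 : (a^2+b^2)^2 * u = (a^2-b^2) * n + 2 * a * b := by rw [e2]; linear_combination (2 * a * b) * e1
  have f2 : (a^2+b^2)^2 * v = (a^2-b^2) - 2 * a * b * n := by rw [e2]; linear_combination (a^2-b^2) * e1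
  have g1 : N ^ 2 * (a^2-b^2) = (p^2-q^2) * (X^2-h^2) - 4 * p * q * X * h := by
    linear_combination (a * N + (X * p - h * q)) * ha - (b * N + (X * q + h * p)) * hb
  have g2 : N ^ 2 * (2 * a * b) = 2 * p * q * (X^2-h^2) + 2 * (p^2-q^2) * X * h := by
    linear_combination 2 * b * N * ha + 2 * (X * p - h * q) * hb
  have k1 : S ^ 2 * u = ((p^2-q^2) * (X^2-h^2) - 4 * p * q * X * h) * n + (2 * p * q * (X^2-h^2) + 2 * (p^2-q^2) * X * h) := by
    rw [← g1, ← g2, hab]; linear_combination N ^ 2 * f1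
  have k2 : S ^ 2 * v = ((p^2-q^2) * (X^2-h^2) - 4 * p * q * X * h) - (2 * p * q * (X^2-h^2) + 2 * (p^2-q^2) * X * h) * n := by
    rw [← g1, ← g2, hab]; linear_combination N ^ 2 * f2
  have hS2 : S ^ 2 ≠ 0 := pow_ne_zero _ hS0
  constructor
  · apply mul_left_cancel₀ hS2
    have : S ^ 2 * (2 * h ^ 3 * u) = 2 * h ^ 3 * (S ^ 2 * u) := by ring
    rw [this, k1]
    rw [hS] at hn ⊢
    linear_combination ((p^2-q^2) * (X^2-h^2) - 4 * p * q * X * h) * hn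
  · apply mul_left_cancel₀ hS2
    have : S ^ 2 * (2 * h ^ 3 * v) = 2 * h ^ 3 * (S ^ 2 * v) := by ring
    rw [this, k2]
    rw [hS] at hn ⊢
    linear_combination - (2 * p * q * (X^2-h^2) + 2 * (p^2-q^2) * X * h) * hn

end SFV


namespace SFV
open Finset

def InBox (D x : ℝ) (P : Pt) : Prop := IsPt P ∧ |P.a| ≤ P.b ∧ D < (P.a:ℝ)^2 + (P.b:ℝ)^2 ∧
  (P.a:ℝ)^2 + (P.b:ℝ)^2 ≤ 2 * D ∧ 0 ≤ (nval P : ℝ) ∧ (nval P : ℝ) ≤ x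

def Close (M : ℝ) (P Q : Pt) : Prop := |(P.a:ℝ) * Q.b - Q.a * P.b| * M ≤ P.b * Q.b

lemma line_pt (p q h : ℤ) (hc : IsCoprime p q) (P Q : Pt) (hP : p * P.b - q * P.a = h) (hQ : p * Q.b - q * Q.a = h) :
    ∃ t : ℤ, Q.a = P.a + t * p ∧ Q.b = P.b + t * q := by
  have e : p * (Q.b - P.b) = q * (Q.a - P.a) := by linarith
  have e1 : p ∣ Q.a - P.a := hc.dvd_of_dvd_mul_left ⟨_, e.symm⟩
  have e2 : q ∣ Q.b - P.b := hc.symm.dvd_of_dvd_mul_left ⟨_, e⟩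
  obtain ⟨s, hs⟩ := e1
  obtain ⟨t, ht⟩ := e2
  by_cases hp : p = 0
  · refine ⟨t, ?_, by linarith⟩
    rw [hp] at hs ⊢; linarith
  · refine ⟨s, by linarith, ?_⟩
    rw [hs] at e
    have : Q.b - P.b = q * s := mul_left_cancel₀ hp (by rw [e]; ring)
    linarith

set_option maxHeartbeats 800000 in
/-- data for pair on a line -/
lemma pair_bounds (D x M ρ : ℝ) (hD : 0 < D) (hM : 0 < M) (hDM : 400 * D ≤ M ^ 2)
    (p q h t : ℤ) (hh : h ≠ 0) (ht : t ≠ 0) (hN : 1 ≤ p ^ 2 + q ^ 2) (P Q : Pt) (hP : InBox D x P) (hQ : InBox D x Q)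
    (hPQ : Close M P Q) (hl : p * P.b - q * P.a = h) (hl' : p * Q.b - q * Q.a = h)
    (h1 : Q.a = P.a + t * p) (h2 : Q.b = P.b + t * q)
    (hn : ∀ P' : Pt, P' = P ∨ P' = Q → (nval P' : ℝ) * (2 * (h:ℝ) ^ 3) = ((P'.a:ℝ) * p + P'.b * q) ^ 3 + 3 * (h:ℝ) ^ 2 * ((P'.a:ℝ) * p + P'.b * q)
      + 2 * (h:ℝ) ^ 3 * ρ * (((P'.a:ℝ) * p + P'.b * q) ^ 2 + (h:ℝ) ^ 2) ^ 2) :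
    |(t:ℝ)| * |(h:ℝ)| * M ≤ 2 * D ∧ 100 * (h:ℝ) ^ 2 ≤ (p ^ 2 + q ^ 2) * D ∧
      |(t:ℝ)| * (p ^ 2 + q ^ 2) ^ 2 * D ≤ 10 * x * |(h:ℝ)| ^ 3 := by
  obtain ⟨hP0, hPa, hPD, hPD2, hPn, hPx⟩ := hP
  obtain ⟨hQ0, hQa, hQD, hQD2, hQn, hQx⟩ := hQ
  have hlR : (p:ℝ) * P.b - q * P.a = h := by exact_mod_cast hl
  have hlR' : (p:ℝ) * Q.b - q * Q.a = h := by exact_mod_cast hl'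
  have h1R : (Q.a:ℝ) = P.a + t * p := by exact_mod_cast h1
  have h2R : (Q.b:ℝ) = P.b + t * q := by exact_mod_cast h2
  have hNR : (1:ℝ) ≤ (p:ℝ) ^ 2 + (q:ℝ) ^ 2 := by exact_mod_cast hN
  have hPb : (0:ℝ) < P.b := by exact_mod_cast hP0.1
  have hQb : (0:ℝ) < Q.b := by exact_mod_cast hQ0.1
  have hhR : (h:ℝ) ≠ 0 := by exact_mod_cast hh
  have htR : (1:ℝ) ≤ |(t:ℝ)| := by exact_mod_cast Int.one_le_abs ht
  have c1 : |(t:ℝ)| * |(h:ℝ)| * M ≤ 2 * D := by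
    have e : (P.a:ℝ) * Q.b - Q.a * P.b = - (t * h) := by rw [h1R, h2R, ← hlR]; ring
    unfold Close at hPQ
    rw [e, abs_neg, abs_mul] at hPQ
    refine hPQ.trans ?_
    linarith [two_mul_le_add_sq (P.b:ℝ) Q.b, sq_nonneg (P.a:ℝ), sq_nonneg (Q.a:ℝ)]
  have c0 : |(h:ℝ)| * M ≤ 2 * D := by
    refine le_trans ?_ c1
    have : 1 * (|(h:ℝ)| * M) ≤ |(t:ℝ)| * (|(h:ℝ)| * M) := by gcongr
    linarith
  have c2 : 100 * (h:ℝ) ^ 2 ≤ (p ^ 2 + q ^ 2) * D := by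
    have e1 : (|(h:ℝ)| * M) ^ 2 ≤ (2 * D) ^ 2 := pow_le_pow_left₀ (by positivity) c0 2
    rw [mul_pow, sq_abs] at e1
    have e2 : (h:ℝ) ^ 2 * (400 * D) ≤ (h:ℝ) ^ 2 * M ^ 2 := by gcongr
    have e3 : (100 * (h:ℝ) ^ 2) * (4 * D) ≤ D * (4 * D) := by linarith
    have e4 := le_of_mul_le_mul_right e3 (by positivity)
    have e5 : 1 * D ≤ ((p:ℝ) ^ 2 + q ^ 2) * D := by gcongr
    linarith
  refine ⟨c1, c2, ?_⟩
  have i1 : ((P.a:ℝ) * p + P.b * q) ^ 2 + (h:ℝ) ^ 2 = ((p:ℝ) ^ 2 + q ^ 2) * ((P.a:ℝ)^2 + (P.b:ℝ)^2) := by rw [← hlR]; ring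
  have i2 : ((Q.a:ℝ) * p + Q.b * q) ^ 2 + (h:ℝ) ^ 2 = ((p:ℝ) ^ 2 + q ^ 2) * ((Q.a:ℝ)^2 + (Q.b:ℝ)^2) := by rw [← hlR']; ring
  have i3 : ((P.a:ℝ) * p + P.b * q) * ((Q.a:ℝ) * p + Q.b * q) + (h:ℝ) ^ 2 = ((p:ℝ) ^ 2 + q ^ 2) * ((P.a:ℝ) * Q.a + P.b * Q.b) := by
    rw [sq (h:ℝ)]; nth_rw 1 [← hlR]; rw [← hlR']; ring
  have i4 : (0:ℝ) ≤ (P.a:ℝ) * Q.a + P.b * Q.b := by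
    have a1 : |(P.a:ℝ)| ≤ P.b := by exact_mod_cast hPa
    have a2 : |(Q.a:ℝ)| ≤ Q.b := by exact_mod_cast hQa
    have : |(P.a:ℝ) * Q.a| ≤ P.b * Q.b := by rw [abs_mul]; gcongr
    have := (abs_le.1 this).1
    linarith
  have hN0 : (0:ℝ) < (p:ℝ) ^ 2 + (q:ℝ) ^ 2 := by linarith
  have := core2 ((P.a:ℝ) * p + P.b * q) ((Q.a:ℝ) * p + Q.b * q) h _ _ (((p:ℝ) ^ 2 + q ^ 2) * D) (nval P) (nval Q) x ρ hhR rfl rfl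
    (by positivity) (by rw [i1]; gcongr) (by rw [i1]; exact (mul_le_mul_of_nonneg_left hPD2 hN0.le).trans_eq (by ring)) (by rw [i2]; gcongr) (by rw [i2]; exact (mul_le_mul_of_nonneg_left hQD2 hN0.le).trans_eq (by ring)) c2
    (by rw [i3]; positivity) (hn P (Or.inl rfl)) (hn Q (Or.inr rfl)) hPn hPx hQn hQx
  have e : ((P.a:ℝ) * p + P.b * q) - ((Q.a:ℝ) * p + Q.b * q) = - (t * ((p:ℝ) ^ 2 + q ^ 2)) := by rw [h1R, h2R]; ring
  rw [e, abs_neg, abs_mul, abs_of_pos hN0] at this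
  linarith

set_option maxHeartbeats 800000 in
lemma line3 (D x M ρ : ℝ) (hD : 0 < D) (hM : 0 < M) (hx : 0 ≤ x) (hDM : 400 * D ≤ M ^ 2) (h32 : 32 * x * D ≤ M ^ 3) (hMD : M ≤ D)
    (p q h s t : ℤ) (hpq : IsCoprime p q) (hh : h ≠ 0) (hs : s ≠ 0) (ht : t ≠ 0) (hst : s ≠ t) (P Q R : Pt)
    (hP : InBox D x P) (hQ : InBox D x Q) (hR : InBox D x R)
    (hPQ : Close M P Q) (hPR : Close M P R) (hQR : Close M Q R)
    (hlP : p * P.b - q * P.a = h) (hlQ : p * Q.b - q * Q.a = h) (hlR : p * R.b - q * R.a = h)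
    (h1 : Q.a = P.a + s * p) (h2 : Q.b = P.b + s * q)
    (h3 : R.a = P.a + t * p) (h4 : R.b = P.b + t * q)
    (hn : ∀ P' : Pt, P' = P ∨ P' = Q ∨ P' = R → (nval P' : ℝ) * (2 * (h:ℝ) ^ 3) = ((P'.a:ℝ) * p + P'.b * q) ^ 3 + 3 * (h:ℝ) ^ 2 * ((P'.a:ℝ) * p + P'.b * q)
      + 2 * (h:ℝ) ^ 3 * ρ * (((P'.a:ℝ) * p + P'.b * q) ^ 2 + (h:ℝ) ^ 2) ^ 2) :
    Real.sqrt D * Real.sqrt (p ^ 2 + q ^ 2) * |(h:ℝ)| * M ^ 2 ≤ 240 * x * D := by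
  have hN : 1 ≤ p ^ 2 + q ^ 2 := by
    by_contra hcon
    have a1 : p = 0 := by nlinarith [sq_nonneg p, sq_nonneg q]
    have a2 : q = 0 := by nlinarith [sq_nonneg p, sq_nonneg q]
    obtain ⟨u, v, e⟩ := hpq
    rw [a1, a2] at e; simp at e
  have hNR : (1:ℝ) ≤ (p:ℝ) ^ 2 + (q:ℝ) ^ 2 := by exact_mod_cast hN
  obtain ⟨a1, a2, a3⟩ := pair_bounds D x M ρ hD hM hDM p q h s hh hs hN P Q hP hQ hPQ hlP hlQ h1 h2
    (fun P' hP' => hn P' (by tauto))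
  obtain ⟨b1, b2, b3⟩ := pair_bounds D x M ρ hD hM hDM p q h t hh ht hN P R hP hR hPR hlP hlR h3 h4
    (fun P' hP' => hn P' (by tauto))
  obtain ⟨c1, c2, c3⟩ := pair_bounds D x M ρ hD hM hDM p q h (t - s) hh (sub_ne_zero.2 hst.symm) hN Q R hQ hR hQR hlQ hlR
    (by linarith) (by linarith) (fun P' hP' => hn P' (by tauto))
  have hhR : (h:ℝ) ≠ 0 := by exact_mod_cast hh
  have hH1 : (1:ℝ) ≤ |(h:ℝ)| := by exact_mod_cast Int.one_le_abs hh
  have hT1 : (1:ℝ) ≤ |(s:ℝ)| := by exact_mod_cast Int.one_le_abs hs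
  set N : ℝ := (p:ℝ) ^ 2 + (q:ℝ) ^ 2 with hNdef
  obtain ⟨T, hsT, htT, htsT, hT1', hT2⟩ : ∃ T : ℝ, |(s:ℝ)| ≤ T ∧ |(t:ℝ)| ≤ T ∧ |((t - s : ℤ):ℝ)| ≤ T ∧
      T * |(h:ℝ)| * M ≤ 2 * D ∧ T * N ^ 2 * D ≤ 10 * x * |(h:ℝ)| ^ 3 := by
    refine ⟨max |(s:ℝ)| (max |(t:ℝ)| |((t - s : ℤ):ℝ)|), le_max_left _ _, (le_max_left _ _).trans (le_max_right _ _), (le_max_right _ _).trans (le_max_right _ _), ?_⟩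
    rcases max_choice |(s:ℝ)| (max |(t:ℝ)| |((t - s : ℤ):ℝ)|) with e | e
    · rw [e]; exact ⟨a1, a3⟩
    · rcases max_choice |(t:ℝ)| |((t - s : ℤ):ℝ)| with e' | e'
      · rw [e, e']; exact ⟨b1, b3⟩
      · rw [e, e']; exact ⟨c1, c3⟩
  have hA2 : Real.sqrt D ^ 2 = D := Real.sq_sqrt hD.le
  have hN0 : 0 < N := by linarith
  have hZ2 : Real.sqrt N ^ 2 = N := Real.sq_sqrt hN0.le
  have hA : 0 < Real.sqrt D := Real.sqrt_pos.2 hD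
  have hZ : 0 < Real.sqrt N := Real.sqrt_pos.2 hN0
  set A := Real.sqrt D
  set Z := Real.sqrt N
  have hZ4 : Z ^ 4 = N ^ 2 := by rw [← hZ2]; ring
  have hT0 : 0 < T := by linarith
  have uv : ∀ P' : Pt, (P' = P ∨ P' = Q ∨ P' = R) → _ := fun P' hP' =>
    uv_formula (P'.a:ℝ) P'.b P'.u P'.v p q h (nval P') ((P'.a:ℝ) * p + P'.b * q) N _ (2 * (h:ℝ) ^ 3 * ρ) hhR hNdef rfl rfl
      (by positivity) (by rcases hP' with rfl | rfl | rfl <;> [exact_mod_cast hlP; exact_mod_cast hlQ; exact_mod_cast hlR])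
      (by rcases hP' with rfl | rfl | rfl <;> [exact_mod_cast hP.1.2; exact_mod_cast hQ.1.2; exact_mod_cast hR.1.2])
      (by rw [nval]; push_cast; ring) (hn P' hP')
  have uvP := uv P (by tauto)
  have uvQ := uv Q (by tauto)
  have uvR := uv R (by tauto)
  have h1R : (Q.a:ℝ) = P.a + s * p := by exact_mod_cast h1
  have h2R : (Q.b:ℝ) = P.b + s * q := by exact_mod_cast h2
  have h3R : (R.a:ℝ) = P.a + t * p := by exact_mod_cast h3
  have h4R : (R.b:ℝ) = P.b + t * q := by exact_mod_cast h4
  have XQ : (Q.a:ℝ) * p + Q.b * q = ((P.a:ℝ) * p + P.b * q) + s * N := by rw [h1R, h2R]; ring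
  have XR : (R.a:ℝ) * p + R.b * q = ((P.a:ℝ) * p + P.b * q) + t * N := by rw [h3R, h4R]; ring
  rw [XQ] at uvQ
  rw [XR] at uvR
  have hlPR : (p:ℝ) * P.b - q * P.a = h := by exact_mod_cast hlP
  have i1 : ((P.a:ℝ) * p + P.b * q) ^ 2 + (h:ℝ) ^ 2 = N * ((P.a:ℝ)^2 + (P.b:ℝ)^2) := by rw [← hlPR]; ring
  have hnP := hn P (by tauto)
  set X := (P.a:ℝ) * p + P.b * q
  have h3ne : 2 * (h:ℝ) ^ 3 ≠ 0 := by positivity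
  have hmS : N * D < X ^ 2 + (h:ℝ) ^ 2 := by rw [i1]; exact mul_lt_mul_of_pos_left hP.2.2.1 hN0
  by_cases hρ : ρ = 0
  · rw [hρ] at uvP uvQ
    have hk : 2 * (h:ℝ) ^ 3 * (s * N / (2 * h ^ 3)) = s * N := by field_simp
    have kb := kappa_bound p q (Q.u - P.u) (Q.v - P.v) hpq (s * N / (2 * h ^ 3)) (by
        have : (s:ℝ) ≠ 0 := by exact_mod_cast hs
        positivity)
      (by
        apply mul_left_cancel₀ h3ne
        push_cast
        linear_combination uvQ.1 - uvP.1 - ((p:ℝ)^2-q^2) * hk) (by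
        apply mul_left_cancel₀ h3ne
        push_cast
        linear_combination uvQ.2 - uvP.2 + (2 * p * q) * hk)
    rw [abs_div, abs_mul, abs_mul, abs_pow, abs_of_pos hN0, abs_of_pos (by norm_num : (0:ℝ) < 2),
      div_le_div_iff₀ (by norm_num) (by positivity)] at kb
    rw [← hA2]
    have hb2 : 100 * (h:ℝ) ^ 2 ≤ N * D := b2
    refine fin2 A Z |(h:ℝ)| |(s:ℝ)| x M X h hA hZ hH1 (by linarith) hM hx (by rw [hA2]; exact a1) (by rw [hZ2]; linarith)
      (by rw [hA2]; exact hMD) ?_ (by rw [hZ2, hA2]; exact hb2) (by rw [hZ2, hA2]; exact hmS.le)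
    rw [hρ] at hnP
    have e : X * (X ^ 2 + 3 * (h:ℝ) ^ 2) = nval P * (2 * (h:ℝ)^3) := by linarith
    have e2 := congrArg abs e
    rw [abs_mul, abs_mul, abs_mul, abs_pow, abs_of_pos (by norm_num : (0:ℝ) < 2), abs_of_pos (by positivity : 0 < X ^ 2 + 3 * (h:ℝ) ^ 2),
      abs_of_nonneg hP.2.2.2.2.1] at e2
    rw [e2]
    have : (nval P : ℝ) * (2 * |(h:ℝ)| ^ 3) ≤ x * (2 * |(h:ℝ)| ^ 3) := by
      have := hP.2.2.2.2.2
      gcongr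
    linarith
  · have kb := kappa_bound p q ((s - t) * P.u + t * Q.u - s * R.u) ((s - t) * P.v + t * Q.v - s * R.v) hpq
      (ρ * N ^ 2 * (s * t * (s - t))) (by
        have e1 : (s:ℝ) ≠ 0 := by exact_mod_cast hs
        have e2 : (t:ℝ) ≠ 0 := by exact_mod_cast ht
        have e3 : (s:ℝ) - t ≠ 0 := sub_ne_zero.2 (by exact_mod_cast hst)
        positivity)
      (by
        apply mul_left_cancel₀ h3ne
        push_cast
        linear_combination (s - t : ℝ) * uvP.1 + (t:ℝ) * uvQ.1 - (s:ℝ) * uvR.1) (by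
        apply mul_left_cancel₀ h3ne
        push_cast
        linear_combination (s - t : ℝ) * uvP.2 + (t:ℝ) * uvQ.2 - (s:ℝ) * uvR.2)
    have c3 := core3 X h _ (N * D) (Z * A) (nval P) x ρ hhR rfl (by positivity) (by rw [mul_pow, hZ2, hA2]) hmS hnP
      hP.2.2.2.2.1 hP.2.2.2.2.2
    rw [← hA2]
    refine fin1 A Z |(h:ℝ)| T x M ρ hA hZ hH1 hT0 hM hx (by rw [hA2]; exact hT1') (by rw [hA2, hZ4]; exact hT2)
      (by rw [hZ2, hA2]; exact c3) ?_ (by rw [hA2]; exact h32)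
    refine kb.trans ?_
    rw [hZ4, abs_mul, abs_mul, abs_mul, abs_mul, abs_of_pos (by positivity : 0 < N ^ 2)]
    have e : |(s:ℝ) - t| ≤ T := by rw [abs_sub_comm]; push_cast at htsT; exact htsT
    have : |(s:ℝ)| * |(t:ℝ)| * |(s:ℝ) - t| ≤ T ^ 3 := by
      calc _ ≤ T * T * T := by gcongr
        _ = _ := by ring
    gcongr

end SFV


namespace SFV
open Finset

def Bad (D K : ℝ) (P : Pt) : Prop := ∃ p q h : ℤ, IsCoprime p q ∧ h ≠ 0 ∧ p * P.b - q * P.a = h ∧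
  Real.sqrt D * Real.sqrt ((p:ℝ) ^ 2 + (q:ℝ) ^ 2) * |(h:ℝ)| ≤ K

lemma lineHyp_of (D x M : ℝ) (hD : 0 < D) (hM : 0 < M) (hx : 0 ≤ x) (hDM : 400 * D ≤ M ^ 2) (h32 : 32 * x * D ≤ M ^ 3) (hMD : M ≤ D)
    (V : Finset Pt) (hV : ∀ P ∈ V, InBox D x P) (hI : InjAB V) (hcl : ∀ P ∈ V, ∀ Q ∈ V, Close M P Q)
    (hB : ∀ P ∈ V, ¬ Bad D (240 * x * D / M ^ 2) P) : LineHyp V := by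
  intro A B C D' E F c p q h hc hpq hh h1 h2 h3 h4 h5 W hW hWc
  by_contra hcard
  push Not at hcard
  obtain ⟨P, hP, Q, hQ, R, hR, hPQ, hPR, hQR⟩ := Finset.two_lt_card.1 hcard
  have lP := (hWc P hP).1
  have lQ := (hWc Q hQ).1
  have lR := (hWc R hR).1
  obtain ⟨s, s1, s2⟩ := line_pt p q h hpq P Q lP lQ
  obtain ⟨t, t1, t2⟩ := line_pt p q h hpq P R lP lR
  have hs : s ≠ 0 := by
    rintro rfl
    exact hPQ (hI P (hW hP) Q (hW hQ) (by simp [s1]) (by simp [s2]))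
  have ht : t ≠ 0 := by
    rintro rfl
    exact hPR (hI P (hW hP) R (hW hR) (by simp [t1]) (by simp [t2]))
  have hst : s ≠ t := by
    rintro rfl
    exact hQR (hI Q (hW hQ) R (hW hR) (by rw [s1, t1]) (by rw [s2, t2]))
  apply hB P (hW hP)
  refine ⟨p, q, h, hpq, hh, lP, ?_⟩
  rw [le_div_iff₀ (by positivity)]
  have hN : (p:ℝ) ^ 2 + (q:ℝ) ^ 2 ≠ 0 := by
    intro h0
    have a1 : (p:ℝ) = 0 := by nlinarith [sq_nonneg (p:ℝ), sq_nonneg (q:ℝ)]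
    have a2 : (q:ℝ) = 0 := by nlinarith [sq_nonneg (p:ℝ), sq_nonneg (q:ℝ)]
    obtain ⟨u, v, e⟩ := hpq
    have a1' : p = 0 := by exact_mod_cast a1
    have a2' : q = 0 := by exact_mod_cast a2
    rw [a1', a2'] at e; simp at e
  have hcR : (c:ℝ) ≠ 0 := by exact_mod_cast hc
  have hhR : (h:ℝ) ≠ 0 := by exact_mod_cast hh
  refine line3 D x M ((-E + c * p * q * (p ^ 2 - q ^ 2)) / (2 * c * h ^ 4 * ((p:ℝ) ^ 2 + (q:ℝ) ^ 2) ^ 2)) hD hM hx hDM h32 hMD p q h s t hpq hh hs ht hst P Q R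
    (hV P (hW hP)) (hV Q (hW hQ)) (hV R (hW hR)) (hcl _ (hW hP) _ (hW hQ)) (hcl _ (hW hP) _ (hW hR))
    (hcl _ (hW hQ) _ (hW hR)) lP lQ lR s1 s2 t1 t2 ?_
  intro P' hP'
  have hP'W : P' ∈ W := by rcases hP' with rfl | rfl | rfl <;> assumption
  have lP' : (p:ℝ) * P'.b - q * P'.a = h := by exact_mod_cast (hWc P' hP'W).1
  have f := n_formula A B C D' E F c p q h h1 h2 h3 h4 h5 P' (hV P' (hW hP'W)).1 (hWc P' hP'W).1 (hWc P' hP'W).2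
  have fR : 2 * (c:ℝ) * h ^ 4 * nval P' = c * h * (((P'.a:ℝ) * p + P'.b * q) ^ 3 + 3 * h ^ 2 * ((P'.a:ℝ) * p + P'.b * q)) +
      (-E + c * p * q * (p ^ 2 - q ^ 2)) * ((P'.a:ℝ) ^ 2 + P'.b ^ 2) ^ 2 := by exact_mod_cast f
  have i1 : ((P'.a:ℝ) * p + P'.b * q) ^ 2 + (h:ℝ) ^ 2 = ((p:ℝ) ^ 2 + (q:ℝ) ^ 2) * ((P'.a:ℝ)^2 + (P'.b:ℝ)^2) := by rw [← lP']; ring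
  rw [i1]
  set lam : ℝ := (-E + c * p * q * (p ^ 2 - q ^ 2))
  set N : ℝ := (p:ℝ) ^ 2 + (q:ℝ) ^ 2
  set S : ℝ := (P'.a:ℝ)^2 + (P'.b:ℝ)^2
  have e : 2 * (h:ℝ) ^ 3 * (lam / (2 * c * h ^ 4 * N ^ 2)) * (N * S) ^ 2 = lam * S ^ 2 / (c * h) := by field_simp
  rw [e]
  apply mul_left_cancel₀ (mul_ne_zero hcR hhR)
  have e2 : (c:ℝ) * h * (lam * S ^ 2 / (c * h)) = lam * S ^ 2 := by field_simp
  linear_combination fR - e2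

end SFV


namespace SFV
open Finset

attribute [local instance] Matrix.seminormedAddCommGroup in
lemma siegel_aux {κ : Type} [Fintype κ] (L : ℝ) (hL : 1 ≤ L) (A : Matrix κ (Fin 6) ℤ) (hA : ∀ i k, |(A i k : ℝ)| ≤ L)
    (h5 : Fintype.card κ < 6) : ∃ c : Fin 6 → ℤ, c ≠ 0 ∧ (∀ k, |(c k : ℝ)| ≤ (6 * L) ^ 5) ∧ ∀ i, ∑ k, A i k * c k = 0 := by
  rcases Nat.eq_zero_or_pos (Fintype.card κ) with h0 | h0
  · refine ⟨Pi.single 0 1, ?_, ?_, ?_⟩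
    · intro h; have := congrFun h 0; simp at this
    · intro k
      have : (1:ℝ) ≤ (6 * L) ^ 5 := one_le_pow₀ (by linarith)
      by_cases hk : k = 0
      · subst hk; simpa using this
      · simp [Pi.single_apply, hk]; linarith
    · intro i; exact (Fintype.card_eq_zero_iff.1 h0).elim i
  · obtain ⟨t, ht, hAt, hn⟩ := Int.Matrix.exists_ne_zero_int_vec_norm_le A (by simpa using h5) h0
    refine ⟨t, ht, ?_, ?_⟩
    · intro k
      have h1 : |(t k : ℝ)| ≤ ‖t‖ := by
        have := norm_le_pi_norm t k
        rwa [Int.norm_eq_abs] at this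
      refine h1.trans (hn.trans ?_)
      have h2 : ‖A‖ ≤ L := by
        rw [Matrix.norm_le_iff (by linarith)]
        intro i j; rw [Int.norm_eq_abs]; exact hA i j
      have h3 : max 1 ‖A‖ ≤ L := max_le hL h2
      have h4 : (Fintype.card (Fin 6) : ℝ) * max 1 ‖A‖ ≤ 6 * L := by simp; exact ⟨hL, h2⟩
      have h6 : (1:ℝ) ≤ (Fintype.card (Fin 6) : ℝ) * max 1 ‖A‖ := by
        simp only [Fintype.card_fin]; push_cast
        have := le_max_left 1 ‖A‖
        linarith
      have h7 : (Fintype.card κ : ℝ) / ((Fintype.card (Fin 6) : ℝ) - Fintype.card κ) ≤ (5:ℕ) := by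
        have : (Fintype.card κ : ℝ) ≤ 5 := by exact_mod_cast Nat.lt_succ_iff.1 h5
        simp only [Fintype.card_fin]; push_cast
        rw [div_le_iff₀ (by linarith)]
        linarith
      calc _ ≤ ((Fintype.card (Fin 6) : ℝ) * max 1 ‖A‖) ^ ((5:ℕ):ℝ) := Real.rpow_le_rpow_of_exponent_le h6 h7
        _ = ((Fintype.card (Fin 6) : ℝ) * max 1 ‖A‖) ^ 5 := Real.rpow_natCast _ _
        _ ≤ _ := pow_le_pow_left₀ (by linarith) h4 5
    · intro i
      have := congrFun hAt i
      simpa [Matrix.mulVec, dotProduct] using this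

lemma exists_coef (V : Finset Pt) (r : Pt → Fin 6 → ℤ) (L : ℝ) (hL : 1 ≤ L) (hr : ∀ P ∈ V, ∀ k, |(r P k : ℝ)| ≤ L)
    (hdet : ∀ f : Fin 6 → Pt, (∀ i, f i ∈ V) → (Matrix.of (fun i k => r (f i) k)).det = 0) :
    ∃ c : Fin 6 → ℤ, c ≠ 0 ∧ (∀ k, |(c k : ℝ)| ≤ (6 * L) ^ 5) ∧ ∀ P ∈ V, ∑ k, r P k * c k = 0 := by
  obtain ⟨κ, a, ha, hsp, hli⟩ := exists_linearIndependent' ℚ (fun P : V => (fun k => (r P.1 k : ℚ) : Fin 6 → ℚ))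
  haveI : Finite κ := Finite.of_injective a ha
  haveI : Fintype κ := Fintype.ofFinite κ
  have hcard : Fintype.card κ < 6 := by
    by_contra hcon
    push Not at hcon
    obtain ⟨g⟩ : Nonempty (Fin 6 ↪ κ) := Function.Embedding.nonempty_of_card_le (by simpa using hcon)
    have h1 := hli.comp g g.injective
    have h2 := hdet (fun i => (a (g i)).1) (fun i => (a (g i)).2)
    have h3 : LinearIndependent ℚ (Matrix.of (fun i k => ((r (a (g i)).1 k : ℤ) : ℚ)) : Matrix (Fin 6) (Fin 6) ℚ).row := h1
    rw [Matrix.linearIndependent_rows_iff_isUnit, Matrix.isUnit_iff_isUnit_det] at h3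
    have h4 : (Matrix.of (fun i k => ((r (a (g i)).1 k : ℤ) : ℚ)) : Matrix (Fin 6) (Fin 6) ℚ) =
      (Int.castRingHom ℚ).mapMatrix (Matrix.of (fun i k => r (a (g i)).1 k)) := by ext; simp
    rw [h4, ← RingHom.map_det, h2] at h3
    simp at h3
  obtain ⟨c, hc, hcb, hcs⟩ := siegel_aux L hL (fun i k => r (a i).1 k : Matrix κ (Fin 6) ℤ) (fun i k => hr _ (a i).2 k) hcard
  refine ⟨c, hc, hcb, ?_⟩
  intro P hP
  let φ : (Fin 6 → ℚ) →ₗ[ℚ] ℚ := ∑ k, (c k : ℚ) • LinearMap.proj k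
  have hφ : ∀ y, φ y = ∑ k, (c k : ℚ) * y k := by intro y; simp [φ]
  have h1 : Submodule.span ℚ (Set.range ((fun P : V => (fun k => (r P.1 k : ℚ) : Fin 6 → ℚ)) ∘ a)) ≤ LinearMap.ker φ := by
    rw [Submodule.span_le]
    rintro _ ⟨i, rfl⟩
    simp only [SetLike.mem_coe, LinearMap.mem_ker, hφ, Function.comp]
    have := hcs i
    have h2 : ((∑ k, r (a i).1 k * c k : ℤ) : ℚ) = 0 := by rw [this]; simp
    push_cast at h2
    rw [← h2]
    exact Finset.sum_congr rfl (fun k _ => mul_comm _ _)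
  rw [hsp] at h1
  have h2 : (fun k => (r P k : ℚ) : Fin 6 → ℚ) ∈ LinearMap.ker φ := h1 (Submodule.subset_span ⟨⟨P, hP⟩, rfl⟩)
  rw [LinearMap.mem_ker, hφ] at h2
  have : ((∑ k, r P k * c k : ℤ) : ℚ) = 0 := by
    push_cast
    rw [← h2]
    exact Finset.sum_congr rfl (fun k _ => mul_comm _ _)
  exact_mod_cast this

end SFV


namespace SFV
open Finset

lemma det_bound (A : Matrix (Fin 6) (Fin 6) ℝ) (B : Fin 6 → ℝ) (h : ∀ i k, |A i k| ≤ B k) :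
    |A.det| ≤ 720 * ∏ k, B k := by
  rw [Matrix.det_apply']
  refine (Finset.abs_sum_le_sum_abs _ _).trans ?_
  have : ∀ σ ∈ (Finset.univ : Finset (Equiv.Perm (Fin 6))), |((Equiv.Perm.sign σ : ℤ) : ℝ) * ∏ i, A (σ i) i| ≤ ∏ k, B k := by
    intro σ _
    rw [abs_mul, Finset.abs_prod]
    have : |((Equiv.Perm.sign σ : ℤ) : ℝ)| = 1 := by
      rcases Int.units_eq_one_or (Equiv.Perm.sign σ) with h | h <;> simp [h]
    rw [this, one_mul]
    exact Finset.prod_le_prod (fun i _ => abs_nonneg _) (fun i _ => h _ _)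
  refine (Finset.sum_le_card_nsmul _ _ _ this).trans ?_
  rw [Finset.card_univ, Fintype.card_perm, Fintype.card_fin, nsmul_eq_mul]
  norm_num [Nat.factorial]

def orow (P : Pt) : Fin 6 → ℤ := ![P.a^2 * P.v, P.a * P.b * P.v, P.b^2 * P.v, P.a^2 * P.u, P.a * P.b * P.u, P.b^2 * P.u]

/-- new columns -/
noncomputable def nrow (t a b u v : ℝ) : Fin 6 → ℝ :=
  ![b^2 * (t*v+u), b * (a-t*b) * (t*v+u), (a-t*b)^2 * (t*v+u),
    b^2 * ((t^2-1)*v+2*t*u) + 2 * b * (a-t*b) * (t*v+u) + (a-t*b)^2 * v,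
    b * (a-t*b) * ((t^2-1)*v+2*t*u) + 2 * (a-t*b)^2 * (t*v+u), (a-t*b)^2 * ((t^2-1)*v+2*t*u)]

noncomputable def cX2v (t s : ℝ) : Fin 6 → ℝ := ![2*t*s, 2*s, 2*t*s^2, -s, 0, -s^2]
noncomputable def cXYv (t s : ℝ) : Fin 6 → ℝ := ![0, 2*t*s, 2*s, 0, -s, 0]
noncomputable def cY2v (t s : ℝ) : Fin 6 → ℝ := ![0, 0, 2*t*s, 0, 0, -s]
noncomputable def cX2u (t s : ℝ) : Fin 6 → ℝ := ![1-t*(2*t*s), -t*(2*s), -t*(2*t*s^2), t*s, 0, t*s^2]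
noncomputable def cXYu (t s : ℝ) : Fin 6 → ℝ := ![0, 1-t*(2*t*s), -t*(2*s), 0, t*s, 0]
noncomputable def cY2u (t s : ℝ) : Fin 6 → ℝ := ![0, 0, 1-t*(2*t*s), 0, 0, t*s]

noncomputable def Tm (t s : ℝ) : Matrix (Fin 6) (Fin 6) ℝ := fun j => ![
  cY2v t s j + 2*t*cXYv t s j + t^2*cX2v t s j, cXYv t s j + t * cX2v t s j, cX2v t s j,
  cY2u t s j + 2*t*cXYu t s j + t^2*cX2u t s j, cXYu t s j + t * cX2u t s j, cX2u t s j]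

lemma T_lem (t s a b u v : ℝ) (hs : s * (1 + t^2) = 1) :
   (∑ j, nrow t a b u v j * cX2v t s j = b^2 * v) ∧ (∑ j, nrow t a b u v j * cXYv t s j = b * (a-t*b) * v) ∧
   (∑ j, nrow t a b u v j * cY2v t s j = (a-t*b)^2 * v) ∧ 
   (∑ j, nrow t a b u v j * cX2u t s j = b^2 * u) ∧ (∑ j, nrow t a b u v j * cXYu t s j = b * (a-t*b) * u) ∧
   (∑ j, nrow t a b u v j * cY2u t s j = (a-t*b)^2 * u) := by
  simp only [Fin.sum_univ_six, nrow, cX2v, cXYv, cY2v, cX2u, cXYu, cY2u, Matrix.cons_val]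
  refine ⟨?_, ?_, ?_, ?_, ?_, ?_⟩
  · linear_combination (b^2*v - s * (-(a-t*b)^2*v)) * hs
  · linear_combination (b*(a-t*b)*v) * hs
  · linear_combination ((a-t*b)^2*v) * hs
  · linear_combination (-t) * (b^2*v - s * (-(a-t*b)^2*v)) * hs
  · linear_combination (-t) * (b*(a-t*b)*v) * hs
  · linear_combination (-t) * ((a-t*b)^2*v) * hs

lemma abs_cols (t s : ℝ) (ht : |t| ≤ 1) (hs0 : 0 ≤ s) (hs1 : s ≤ 1) (j : Fin 6) :
    |cX2v t s j| ≤ 3 ∧ |cXYv t s j| ≤ 3 ∧ |cY2v t s j| ≤ 3 ∧ |cX2u t s j| ≤ 3 ∧ |cXYu t s j| ≤ 3 ∧ |cY2u t s j| ≤ 3 := by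
  have hs : |s| ≤ 1 := by rw [abs_of_nonneg hs0]; exact hs1
  have h1 : |t * s| ≤ 1 := by rw [abs_mul]; nlinarith [abs_nonneg t, abs_nonneg s]
  have h2 : |t * (t * s)| ≤ 1 := by rw [abs_mul]; nlinarith [abs_nonneg t, abs_nonneg (t*s)]
  have h3 : |s * s| ≤ 1 := by rw [abs_mul]; nlinarith [abs_nonneg s]
  have h4 : |t * (s * s)| ≤ 1 := by rw [abs_mul]; nlinarith [abs_nonneg t, abs_nonneg (s*s)]
  have h5 : |t * (t * (s * s))| ≤ 1 := by rw [abs_mul]; nlinarith [abs_nonneg t, abs_nonneg (t*(s*s))]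
  have a1 := abs_le.1 h1
  have a2 := abs_le.1 h2
  have a3 := abs_le.1 h3
  have a4 := abs_le.1 h4
  have a5 := abs_le.1 h5
  simp only [abs_le]
  fin_cases j <;> simp only [cX2v, cXYv, cY2v, cX2u, cXYu, cY2u, Matrix.cons_val, Fin.mk_zero, Fin.mk_one, Fin.reduceFinMk, Fin.isValue, Fin.zero_eta] <;>
    refine ⟨⟨?_, ?_⟩, ⟨?_, ?_⟩, ⟨?_, ?_⟩, ⟨?_, ?_⟩, ⟨?_, ?_⟩, ⟨?_, ?_⟩⟩ <;> linarith

lemma Tm_bound (t s : ℝ) (ht : |t| ≤ 1) (hs0 : 0 ≤ s) (hs1 : s ≤ 1) (j k : Fin 6) : |Tm t s j k| ≤ 12 := by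
  obtain ⟨h1, h2, h3, h4, h5, h6⟩ := abs_cols t s ht hs0 hs1 j
  have key : ∀ y z w : ℝ, |y| ≤ 3 → |z| ≤ 3 → |w| ≤ 3 → |y + 2 * t * z + t^2 * w| ≤ 12 ∧ |z + t * w| ≤ 12 ∧ |w| ≤ 12 := by
    intro y z w hy hz hw
    have e1 : |t * z| ≤ 3 := by rw [abs_mul]; nlinarith [abs_nonneg t, abs_nonneg z]
    have e2 : |t * w| ≤ 3 := by rw [abs_mul]; nlinarith [abs_nonneg t, abs_nonneg w]
    have e3 : |t * (t * w)| ≤ 3 := by rw [abs_mul]; nlinarith [abs_nonneg t, abs_nonneg (t * w)]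
    rw [abs_le] at *
    rw [abs_le, abs_le]
    refine ⟨⟨?_, ?_⟩, ⟨?_, ?_⟩, ⟨?_, ?_⟩⟩ <;> linarith
  obtain ⟨k1, k2, k3⟩ := key _ _ _ h3 h2 h1
  obtain ⟨k4, k5, k6⟩ := key _ _ _ h6 h5 h4
  fin_cases k
  · exact k1
  · exact k2
  · exact k3
  · exact k4
  · exact k5
  · exact k6

lemma orow_eq (t s : ℝ) (P : Pt) (hs : s * (1 + t^2) = 1) (k : Fin 6) :
    (orow P k : ℝ) = ∑ j, nrow t P.a P.b P.u P.v j * Tm t s j k := by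
  obtain ⟨h1, h2, h3, h4, h5, h6⟩ := T_lem t s P.a P.b P.u P.v hs
  have key : ∀ (f g h : Fin 6 → ℝ), (∑ j, nrow t P.a P.b P.u P.v j * (f j + 2 * t * g j + t^2 * h j) =
     (∑ j, nrow t P.a P.b P.u P.v j * f j) + 2 * t * (∑ j, nrow t P.a P.b P.u P.v j * g j) + t^2 * (∑ j, nrow t P.a P.b P.u P.v j * h j)) ∧
     (∑ j, nrow t P.a P.b P.u P.v j * (g j + t * h j) =
     (∑ j, nrow t P.a P.b P.u P.v j * g j) + t * (∑ j, nrow t P.a P.b P.u P.v j * h j)) := by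
    intro f g h
    simp only [Fin.sum_univ_six]
    constructor <;> ring
  have kv := key (cY2v t s) (cXYv t s) (cX2v t s)
  have ku := key (cY2u t s) (cXYu t s) (cX2u t s)
  rw [h1, h2, h3] at kv
  rw [h4, h5, h6] at ku
  fin_cases k
  · refine Eq.trans ?_ kv.1.symm; simp [orow]; ring
  · refine Eq.trans ?_ kv.2.symm; simp [orow]; ring
  · refine Eq.trans ?_ h1.symm; simp [orow]
  · refine Eq.trans ?_ ku.1.symm; simp [orow]; ring
  · refine Eq.trans ?_ ku.2.symm; simp [orow]; ring
  · refine Eq.trans ?_ h4.symm; simp [orow]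

end SFV


namespace SFV
open Finset

lemma w_bound (D x : ℝ) (hD : 0 < D) (hx : 1 ≤ x) (P : Pt) (hP : InBox D x P) :
    |(P.u:ℝ)| * D ≤ 2 * x ∧ |(P.v:ℝ)| * D ≤ 2 * x := by
  obtain ⟨⟨hb, h1⟩, _, h2, _, h4, h5⟩ := hP
  have h1R : ((P.a:ℝ)^2 - P.b^2) * P.v + 2 * P.a * P.b * P.u = 1 := by exact_mod_cast h1
  have hn : (nval P : ℝ) = ((P.a:ℝ)^2 - P.b^2) * P.u - 2 * P.a * P.b * P.v := by rw [nval]; push_cast; ring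
  set S := (P.a:ℝ)^2 + (P.b:ℝ)^2 with hS
  have e : ((P.u:ℝ) * S)^2 + ((P.v:ℝ) * S)^2 = (nval P : ℝ)^2 + 1 := by
    have : (nval P : ℝ)^2 + 1 = (((P.a:ℝ)^2 - P.b^2) * P.u - 2 * P.a * P.b * P.v)^2 + (((P.a:ℝ)^2 - P.b^2) * P.v + 2 * P.a * P.b * P.u)^2 := by
      rw [h1R, hn]; ring
    rw [this, hS]; ring
  have e2 : (nval P : ℝ)^2 + 1 ≤ (2 * x)^2 := by nlinarith
  have key : ∀ w : ℝ, (w * S)^2 ≤ (2*x)^2 → |w| * D ≤ 2 * x := by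
    intro w hw
    have := abs_le_of_sq_le_sq hw (by linarith)
    rw [abs_mul, abs_of_pos (hD.trans h2)] at this
    refine le_trans ?_ this
    gcongr
  exact ⟨key _ (by nlinarith [sq_nonneg ((P.v:ℝ) * S)]), key _ (by nlinarith [sq_nonneg ((P.u:ℝ) * S)])⟩

set_option maxHeartbeats 800000 in
lemma nrow_bound (D x M t : ℝ) (hD : 0 < D) (hM : 1 ≤ M) (hMx : M ≤ x) (h4 : 4 * x ≤ M ^ 2) (ht : |t| ≤ 1)
    (P : Pt) (hP : InBox D x P) (hc : |(P.a:ℝ) - t * P.b| * M ≤ P.b) (k : Fin 6) :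
    |nrow t P.a P.b P.u P.v k| ≤ (![8 * x, 8 * x / M, 8 * x / M^2, 1, 2 / M, 18 * x / M^3] : Fin 6 → ℝ) k := by
  obtain ⟨hu, hv⟩ := w_bound D x hD (hM.trans hMx) P hP
  obtain ⟨⟨hb, h1⟩, _, h2, h3, _, _⟩ := hP
  have h1R : ((P.a:ℝ)^2 - P.b^2) * P.v + 2 * P.a * P.b * P.u = 1 := by exact_mod_cast h1
  have hbR : (0:ℝ) < P.b := by exact_mod_cast hb
  have hM0 : 0 < M := by linarith
  have hx0 : 0 < x := by linarith
  generalize (P.a:ℝ) = a at *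
  generalize (P.b:ℝ) = b at *
  generalize (P.u:ℝ) = u at *
  generalize (P.v:ℝ) = v at *
  have hb2 : b^2 ≤ 2 * D := by linarith [sq_nonneg a]
  have hY : |a - t * b| ≤ b / M := by rw [le_div_iff₀ hM0]; exact hc
  set Y := a - t * b with hYdef
  set W := t * v + u with hW
  set Q := (t^2-1)*v+2*t*u with hQ
  have hWD : |W| * D ≤ 4 * x := by
    have : |W| ≤ |v| + |u| := by
      refine (abs_add_le _ _).trans ?_
      rw [abs_mul]; nlinarith [abs_nonneg v, abs_nonneg t]
    nlinarith
  have hbW : b^2 * |W| ≤ 8 * x := by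
    have : b^2 * |W| ≤ 2 * D * |W| := by gcongr
    linarith
  have hbv : b^2 * |v| ≤ 4 * x := by
    have : b^2 * |v| ≤ 2 * D * |v| := by gcongr
    linarith
  have i1 : b^2 * Q + 2 * b * Y * W + Y^2 * v = 1 := by rw [← h1R, hQ, hW, hYdef]; ring
  have hYv : |Y^2 * v| ≤ 1 := by
    rw [abs_mul, abs_pow]
    calc |Y|^2 * |v| ≤ (b/M)^2 * |v| := by gcongr
      _ = b^2 * |v| / M^2 := by ring
      _ ≤ 4 * x / M^2 := by gcongr
      _ ≤ 1 := by rw [div_le_one (by positivity)]; exact h4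
  have hbYW : |b * Y * W| ≤ 8 * x / M := by
    rw [abs_mul, abs_mul, abs_of_pos hbR]
    calc b * |Y| * |W| ≤ b * (b / M) * |W| := by gcongr
      _ = b^2 * |W| / M := by ring
      _ ≤ _ := by gcongr
  have hYYW : |Y^2 * W| ≤ 8 * x / M^2 := by
    rw [abs_mul, abs_pow]
    calc |Y|^2 * |W| ≤ (b/M)^2 * |W| := by gcongr
      _ = b^2 * |W| / M^2 := by ring
      _ ≤ _ := by gcongr
  have c5 : |b * Y * Q + 2 * Y^2 * W| ≤ 2 / M := by
    have e : b * (b * Y * Q + 2 * Y^2 * W) = Y * (1 - Y^2 * v) := by linear_combination Y * i1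
    have e2 := congrArg abs e
    rw [abs_mul, abs_mul, abs_of_pos hbR] at e2
    have e3 : |1 - Y^2 * v| ≤ 2 := by rw [abs_le] at *; constructor <;> linarith [hYv.1, hYv.2]
    have e4 : b * |b * Y * Q + 2 * Y^2 * W| ≤ b * (2 / M) := by
      rw [e2]
      calc |Y| * |1 - Y^2 * v| ≤ (b / M) * 2 := by gcongr
        _ = _ := by ring
    exact le_of_mul_le_mul_left e4 hbR
  have c6 : |Y^2 * Q| ≤ 18 * x / M^3 := by
    have e : b^2 * (Y^2 * Q) = Y^2 * (1 - 2 * (b * Y * W) - Y^2 * v) := by linear_combination Y^2 * i1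
    have e2 := congrArg abs e
    rw [abs_mul, abs_mul (Y^2) (1 - _ - _), abs_of_pos (by positivity : 0 < b^2), abs_pow] at e2
    have hxM : 1 ≤ x / M := by rw [le_div_iff₀ hM0]; linarith
    have e3 : |1 - 2 * (b * Y * W) - Y^2 * v| ≤ 18 * x / M := by
      have : 18 * x / M = 2 * (x / M) + 2 * (8 * x / M) := by ring
      rw [this]
      rw [abs_le] at hYv hbYW ⊢
      constructor <;> linarith [hYv.1, hYv.2, hbYW.1, hbYW.2]
    have e4 : b^2 * |Y^2 * Q| ≤ b^2 * (18 * x / M^3) := by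
      rw [e2]
      calc |Y|^2 * |1 - 2 * (b * Y * W) - Y^2 * v| ≤ (b / M)^2 * (18 * x / M) := by gcongr
        _ = _ := by field_simp
    exact le_of_mul_le_mul_left e4 (by positivity)
  fin_cases k
  · show |b^2 * W| ≤ 8 * x
    rw [abs_mul, abs_of_pos (by positivity : 0 < b^2)]; exact hbW
  · exact hbYW
  · exact hYYW
  · show |b^2 * Q + 2 * b * Y * W + Y^2 * v| ≤ 1
    rw [i1]; simp
  · exact c5
  · exact c6

lemma det_zero (D x M t : ℝ) (hD : 0 < D) (hM : 1 ≤ M) (hMx : M ≤ x) (h4 : 4 * x ≤ M ^ 2) (ht : |t| ≤ 1)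
    (h7 : 720 * 720 * 12^6 * 18432 * x^4 < M^7)
    (f : Fin 6 → Pt) (hP : ∀ i, InBox D x (f i)) (hc : ∀ i, |((f i).a:ℝ) - t * (f i).b| * M ≤ (f i).b) :
    (Matrix.of (fun i k => orow (f i) k)).det = 0 := by
  have hs0 : 0 < 1 + t^2 := by positivity
  set s := 1 / (1 + t^2) with hs
  have hs1 : s * (1 + t^2) = 1 := by rw [hs]; field_simp
  have hsle : s ≤ 1 := by rw [hs, div_le_one hs0]; nlinarith [sq_nonneg t]
  have e : (Int.castRingHom ℝ).mapMatrix (Matrix.of (fun i k => orow (f i) k)) =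
      (Matrix.of (fun i k => nrow t (f i).a (f i).b (f i).u (f i).v k)) * Tm t s := by
    ext i k
    simp only [RingHom.mapMatrix_apply, Matrix.map_apply, Matrix.of_apply, Matrix.mul_apply]
    exact orow_eq t s (f i) hs1 k
  have e2 := congrArg Matrix.det e
  rw [← RingHom.map_det, Matrix.det_mul] at e2
  have b1 := det_bound (Matrix.of (fun i k => nrow t (f i).a (f i).b (f i).u (f i).v k)) _
    (fun i k => nrow_bound D x M t hD hM hMx h4 ht (f i) (hP i) (hc i) k)
  have b2 := det_bound (Tm t s) (fun _ => 12) (fun i k => Tm_bound t s ht (by positivity) hsle i k)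
  rw [Fin.prod_univ_six] at b1 b2
  simp only [Matrix.cons_val] at b1
  by_contra hne
  have hge : (1:ℝ) ≤ |((Matrix.of (fun i k => orow (f i) k)).det : ℝ)| := by exact_mod_cast Int.one_le_abs hne
  have hM0 : 0 < M := by linarith
  have hx0 : 0 < x := by linarith
  have e3 : ((Matrix.of (fun i k => orow (f i) k)).det : ℝ) = _ := e2
  rw [e3, abs_mul] at hge
  have := hge.trans (mul_le_mul b1 b2 (abs_nonneg _) (by positivity))
  have e4 : 720 * (8 * x * (8 * x / M) * (8 * x / M ^ 2) * 1 * (2 / M) * (18 * x / M ^ 3)) * (720 * (12 * 12 * 12 * 12 * 12 * 12)) =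
      (720 * 720 * 12^6 * 18432 * x^4) / M^7 := by field_simp; norm_num
  rw [e4, le_div_iff₀ (by positivity)] at this
  linarith

set_option maxHeartbeats 1000000 in
theorem interval_count (ε : ℝ) (hε : 0 < ε) : ∃ K : ℝ, 1 ≤ K ∧ ∀ D x M : ℝ, 1 ≤ D → 1 ≤ M → M ≤ x → D ≤ x → M ≤ D →
    400 * D ≤ M ^ 2 → 32 * x * D ≤ M ^ 3 → 720 * 720 * 12^6 * 18432 * x^4 < M^7 →
    ∀ V : Finset Pt, (∀ P ∈ V, InBox D x P) → InjAB V → (∀ P ∈ V, ∀ Q ∈ V, Close M P Q) →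
    (∀ P ∈ V, ¬ Bad D (240 * x * D / M ^ 2) P) → (V.card : ℝ) ≤ K * x ^ ε := by
  obtain ⟨K, hK, hcc⟩ := curve_count (ε / 5) (by positivity)
  refine ⟨K * 24 ^ ε, ?_, ?_⟩
  · have : (1:ℝ) ≤ 24 ^ ε := Real.one_le_rpow (by norm_num) hε.le
    nlinarith
  intro D x M hD hM hMx hDx hMD h400 h32 h7 V hV hI hcl hB
  have hD0 : 0 < D := by linarith
  have hM0 : 0 < M := by linarith
  have hx1 : 1 ≤ x := by linarith
  have h4 : 4 * x ≤ M ^ 2 := by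
    have : (32 * x) * M ≤ M^2 * M := by
      calc (32 * x) * M ≤ 32 * x * D := by gcongr
        _ ≤ M^3 := h32
        _ = _ := by ring
    have := le_of_mul_le_mul_right this hM0
    linarith
  rcases V.eq_empty_or_nonempty with rfl | ⟨P0, hP0⟩
  · simp; positivity
  have hb0 : (0:ℝ) < P0.b := by exact_mod_cast (hV P0 hP0).1.1
  have ht : |(P0.a:ℝ) / P0.b| ≤ 1 := by
    rw [abs_div, abs_of_pos hb0, div_le_one hb0]
    exact_mod_cast (hV P0 hP0).2.1
  have hc : ∀ P ∈ V, |(P.a:ℝ) - (P0.a:ℝ) / P0.b * P.b| * M ≤ P.b := by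
    intro P hP
    have := hcl P hP P0 hP0
    unfold Close at this
    have e : (P.a:ℝ) - (P0.a:ℝ) / P0.b * P.b = (P.a * P0.b - P0.a * P.b) / P0.b := by field_simp
    rw [e, abs_div, abs_of_pos hb0, div_mul_eq_mul_div, div_le_iff₀ hb0]
    exact this
  have hlin := lineHyp_of D x M hD0 hM0 (by linarith) h400 h32 hMD V hV hI hcl hB
  have hab : ∀ P ∈ V, (P.a:ℝ)^2 ≤ 2 * D ∧ |(P.a:ℝ) * P.b| ≤ 2 * D ∧ (P.b:ℝ)^2 ≤ 2 * D := by
    intro P hP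
    have := (hV P hP).2.2.2.1
    refine ⟨by linarith [sq_nonneg (P.b:ℝ)], ?_, by linarith [sq_nonneg (P.a:ℝ)]⟩
    rw [abs_le]
    have s1 := sq_nonneg ((P.a:ℝ) - P.b)
    have s2 := sq_nonneg ((P.a:ℝ) + P.b)
    have s3 := sq_nonneg (P.a:ℝ)
    have s4 := sq_nonneg (P.b:ℝ)
    constructor <;> linarith
  obtain ⟨c, hc0, hcb, hcs⟩ := exists_coef V orow (4 * x) (by linarith) (by
      intro P hP k
      obtain ⟨wu, wv⟩ := w_bound D x hD0 hx1 P (hV P hP)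
      obtain ⟨m1, m2, m3⟩ := hab P hP
      have key : ∀ m w : ℝ, |m| ≤ 2 * D → |w| * D ≤ 2 * x → |m * w| ≤ 4 * x := by
        intro m w h1 h2
        rw [abs_mul]
        have : |m| * |w| ≤ 2 * D * |w| := by gcongr
        linarith
      have m1' : |(P.a:ℝ)^2| ≤ 2 * D := by rw [abs_of_nonneg (sq_nonneg _)]; exact m1
      have m3' : |(P.b:ℝ)^2| ≤ 2 * D := by rw [abs_of_nonneg (sq_nonneg _)]; exact m3
      fin_cases k
      · simpa [orow] using key _ _ m1' wv
      · simpa [orow] using key _ _ m2 wv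
      · simpa [orow] using key _ _ m3' wv
      · simpa [orow] using key _ _ m1' wu
      · simpa [orow] using key _ _ m2 wu
      · simpa [orow] using key _ _ m3' wu)
    (fun f hf => det_zero D x M _ hD0 hM hMx h4 ht h7 f (fun i => hV _ (hf i)) (fun i => hc _ (hf i)))
  set H : ℝ := (6 * (4 * x))^5 with hH
  have hH1 : 1 ≤ H := one_le_pow₀ (by linarith)
  have hxH : 2 * x ≤ H := by
    have e1 : (1:ℝ) ≤ (6 * (4 * x))^4 := one_le_pow₀ (by linarith)
    have e2 : H = (6 * (4 * x))^4 * (6 * (4 * x)) := by rw [hH]; ring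
    nlinarith
  have hmain := hcc (c 0) (c 1) (c 2) (c 3) (c 4) (c 5) H hH1 (hcb 0) (hcb 1) (hcb 2) (hcb 3) (hcb 4) (hcb 5)
    (by
      rintro ⟨h0, h1, h2, h3, h4, h5⟩
      apply hc0; funext k; fin_cases k <;> [exact h0; exact h1; exact h2; exact h3; exact h4; exact h5]) V
    (by
      intro P hP
      obtain ⟨m1, m2, m3⟩ := hab P hP
      have key : ∀ z : ℤ, (z:ℝ)^2 ≤ 2 * D → |(z:ℝ)| ≤ H := by
        intro z hz
        have : |(z:ℝ)| ≤ (z:ℝ)^2 := by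
          have : |z| ≤ z^2 := by
            rcases eq_or_ne z 0 with rfl | h
            · simp
            · have := Int.one_le_abs h
              rw [← sq_abs]; nlinarith
          exact_mod_cast this
        linarith
      exact ⟨(hV P hP).1, key _ m1, key _ m3⟩) hI hlin
    (by
      intro P hP
      have := hcs P hP
      rw [Fin.sum_univ_six] at this
      simp only [orow, Matrix.cons_val] at this
      simp only [qf]
      linarith)
  refine hmain.trans_eq ?_
  rw [hH, ← Real.rpow_natCast, ← Real.rpow_mul (by linarith), mul_assoc K]
  congr 1
  have : ((5:ℕ):ℝ) * (ε / 5) = ε := by push_cast; ring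
  rw [this, ← Real.mul_rpow (by norm_num) (by linarith)]
  congr 1; ring

end SFV


namespace SFV
open Finset

lemma int_card_le (S : Finset ℤ) (y : ℝ) (hy : 0 ≤ y) (h : ∀ t ∈ S, |(t:ℝ)| ≤ y) : (S.card : ℝ) ≤ 2 * y + 1 := by
  have h1 : S ⊆ Finset.Icc (-⌊y⌋) ⌊y⌋ := by
    intro t ht
    have := abs_le.1 (h t ht)
    rw [Finset.mem_Icc]
    constructor
    · have : -t ≤ ⌊y⌋ := by rw [Int.le_floor]; push_cast; linarith
      linarith
    · rw [Int.le_floor]; exact this.2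
  have h2 := Finset.card_le_card h1
  rw [Int.card_Icc] at h2
  have h0 : 0 ≤ ⌊y⌋ := Int.floor_nonneg.2 hy
  have h3 : (S.card : ℤ) ≤ 2 * ⌊y⌋ + 1 := by omega
  have h4 : (S.card : ℝ) ≤ 2 * (⌊y⌋:ℝ) + 1 := by exact_mod_cast h3
  have := Int.floor_le y
  linarith

lemma int_card_ne_le (S : Finset ℤ) (y : ℝ) (hy : 0 ≤ y) (h : ∀ t ∈ S, t ≠ 0 ∧ |(t:ℝ)| ≤ y) : (S.card : ℝ) ≤ 2 * y := by
  have := int_card_le (insert 0 S) y hy (by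
    intro t ht
    rcases Finset.mem_insert.1 ht with rfl | ht
    · simpa using hy
    · exact (h t ht).2)
  rw [Finset.card_insert_of_notMem (fun h0 => (h 0 h0).1 rfl)] at this
  push_cast at this; linarith

lemma fiber_count (D x : ℝ) (hD : 1 ≤ D) (p q h : ℤ) (hpq : IsCoprime p q) (hN : (p:ℝ)^2 + (q:ℝ)^2 ≤ D)
    (hN1 : 1 ≤ (p:ℝ)^2 + (q:ℝ)^2)
    (W : Finset Pt) (hW : ∀ P ∈ W, InBox D x P ∧ p * P.b - q * P.a = h) (hI : InjAB W) :
    (W.card : ℝ) ≤ 7 * (Real.sqrt D / Real.sqrt ((p:ℝ)^2 + (q:ℝ)^2)) := by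
  set N := (p:ℝ)^2 + (q:ℝ)^2 with hNd
  have hN0 : 0 < N := by linarith
  have hZ : 0 < Real.sqrt N := Real.sqrt_pos.2 hN0
  have hy1 : 1 ≤ Real.sqrt D / Real.sqrt N := by rw [le_div_iff₀ hZ, one_mul]; exact Real.sqrt_le_sqrt hN
  rcases W.eq_empty_or_nonempty with rfl | ⟨P0, hP0⟩
  · simp; positivity
  choose! f hf using fun P (hP : P ∈ W) => line_pt p q h hpq P0 P (hW P0 hP0).2 (hW P hP).2
  have hinj : Set.InjOn f W := by
    intro P hP Q hQ hPQ
    apply hI P hP Q hQ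
    · rw [(hf P hP).1, (hf Q hQ).1, hPQ]
    · rw [(hf P hP).2, (hf Q hQ).2, hPQ]
  rw [← Finset.card_image_of_injOn hinj]
  have hD2 : Real.sqrt D ^ 2 = D := Real.sq_sqrt (by linarith)
  have hZ2 : Real.sqrt N ^ 2 = N := Real.sq_sqrt hN0.le
  have := int_card_le (W.image f) (3 * (Real.sqrt D / Real.sqrt N)) (by positivity) (by
    intro t ht
    obtain ⟨P, hP, rfl⟩ := Finset.mem_image.1 ht
    have e1 : (P.a:ℝ) = P0.a + f P * p := by exact_mod_cast (hf P hP).1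
    have e2 : (P.b:ℝ) = P0.b + f P * q := by exact_mod_cast (hf P hP).2
    have b1 := (hW P hP).1.2.2.2.1
    have b0 := (hW P0 hP0).1.2.2.2.1
    have e3 : ((f P:ℝ))^2 * N = ((P.a:ℝ) - P0.a)^2 + ((P.b:ℝ) - P0.b)^2 := by rw [e1, e2, hNd]; ring
    have e4 : ((f P:ℝ))^2 * N ≤ 8 * D := by
      rw [e3]
      nlinarith [sq_nonneg ((P.a:ℝ) + P0.a), sq_nonneg ((P.b:ℝ) + P0.b)]
    apply abs_le_of_sq_le_sq _ (by positivity)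
    rw [mul_pow, div_pow, hD2, hZ2, ← mul_div_assoc, le_div_iff₀ hN0]
    linarith)
  linarith

lemma sum_inv_le (B : ℕ) : ∑ p ∈ Finset.Icc (-(B:ℤ)) B, 1 / (|(p:ℝ)| + 1) ≤ 2 * (1 + Real.log (B + 1)) := by
  have h1 : ∑ p ∈ Finset.Icc (-(B:ℤ)) B, 1 / (|(p:ℝ)| + 1) ≤ 2 * ∑ j ∈ Finset.range (B+1), 1 / ((j:ℝ) + 1) := by
    rw [← Finset.sum_fiberwise_of_maps_to (s := Finset.Icc (-(B:ℤ)) B) (t := Finset.range (B+1)) (g := Int.natAbs)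
      (by intro p hp; rw [Finset.mem_Icc] at hp; rw [Finset.mem_range]; omega), Finset.mul_sum]
    apply Finset.sum_le_sum
    intro j hj
    have hc : ((Finset.Icc (-(B:ℤ)) B).filter (fun p => p.natAbs = j)).card ≤ 2 := by
      have : (Finset.Icc (-(B:ℤ)) B).filter (fun p => p.natAbs = j) ⊆ {(j:ℤ), -(j:ℤ)} := by
        intro p hp
        rw [Finset.mem_filter] at hp
        simp only [Finset.mem_insert, Finset.mem_singleton]
        omega
      exact (Finset.card_le_card this).trans Finset.card_le_two
    have : ∀ p ∈ (Finset.Icc (-(B:ℤ)) B).filter (fun p => p.natAbs = j), 1 / (|(p:ℝ)| + 1) ≤ 1 / ((j:ℝ) + 1) := by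
      intro p hp
      rw [Finset.mem_filter] at hp
      have : |(p:ℝ)| = j := by rw [← hp.2, Nat.cast_natAbs]; push_cast; rfl
      rw [this]
    refine (Finset.sum_le_card_nsmul _ _ _ this).trans ?_
    rw [nsmul_eq_mul]
    have : (((Finset.Icc (-(B:ℤ)) B).filter (fun p => p.natAbs = j)).card : ℝ) ≤ 2 := by exact_mod_cast hc
    gcongr
  have h2 := harmonic_le_one_add_log (B+1)
  rw [harmonic] at h2
  push_cast at h2
  simp only [one_div] at h1 ⊢
  linarith

open Classical in
lemma bad_count0 (D x K : ℝ) (hD : 1 ≤ D) (hK : 0 ≤ K) (hKD : K ≤ D)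
    (V : Finset Pt) (hV : ∀ P ∈ V, InBox D x P) (hI : InjAB V) (hB : ∀ P ∈ V, Bad D K P) :
    (V.card : ℝ) ≤ 224 * K * (1 + Real.log (K + 1)) ^ 2 := by
  choose! fp fq fh hf using hB
  set A := Real.sqrt D with hA
  have hA1 : 1 ≤ A := Real.one_le_sqrt.2 hD
  have hA0 : 0 < A := by linarith
  have hA2 : A ^ 2 = D := Real.sq_sqrt (by linarith)
  let I := Finset.Icc (-(⌊K⌋₊:ℤ)) ⌊K⌋₊
  let Good : ℤ × ℤ → Prop := fun c => IsCoprime c.1 c.2 ∧ A * Real.sqrt ((c.1:ℝ)^2 + (c.2:ℝ)^2) ≤ K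
  let T := (I ×ˢ I).filter Good
  have hN1 : ∀ c : ℤ × ℤ, IsCoprime c.1 c.2 → 1 ≤ (c.1:ℝ)^2 + (c.2:ℝ)^2 := by
    intro c hc
    have : 1 ≤ c.1^2 + c.2^2 := by
      by_contra hcon
      have a1 : c.1 = 0 := by nlinarith [sq_nonneg c.1, sq_nonneg c.2]
      have a2 : c.2 = 0 := by nlinarith [sq_nonneg c.1, sq_nonneg c.2]
      obtain ⟨u, v, e⟩ := hc
      rw [a1, a2] at e; simp at e
    exact_mod_cast this
  have hgood : ∀ P ∈ V, Good (fp P, fq P) := by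
    intro P hP
    obtain ⟨h1, h2, h3, h4⟩ := hf P hP
    refine ⟨h1, le_trans ?_ h4⟩
    have : (1:ℝ) ≤ |(fh P:ℝ)| := by exact_mod_cast Int.one_le_abs h2
    exact le_mul_of_one_le_right (by positivity) this
  have hmem : ∀ P ∈ V, (fp P, fq P) ∈ T := by
    intro P hP
    have hg := hgood P hP
    rw [Finset.mem_filter, Finset.mem_product]
    refine ⟨?_, hg⟩
    have hs : Real.sqrt ((fp P:ℝ)^2 + (fq P:ℝ)^2) ≤ K := by
      refine le_trans ?_ hg.2
      exact le_mul_of_one_le_left (Real.sqrt_nonneg _) hA1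
    have key : ∀ z : ℤ, |(z:ℝ)| ≤ K → z ∈ I := by
      intro z hz
      have h1 : z.natAbs ≤ ⌊K⌋₊ := by
        apply Nat.le_floor; rw [Nat.cast_natAbs]; push_cast; exact hz
      simp only [I, Finset.mem_Icc]; omega
    constructor
    · apply key; refine le_trans ?_ hs; apply Real.abs_le_sqrt; nlinarith [sq_nonneg (fq P:ℝ)]
    · apply key; refine le_trans ?_ hs; apply Real.abs_le_sqrt; nlinarith [sq_nonneg (fp P:ℝ)]
  have hcard : (V.card : ℝ) = ∑ c ∈ T, ((V.filter (fun P => (fp P, fq P) = c)).card : ℝ) := by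
    rw [Finset.card_eq_sum_card_fiberwise (s := V) (t := T) (f := fun P => (fp P, fq P)) hmem]
    push_cast; rfl
  have hper : ∀ c ∈ T, ((V.filter (fun P => (fp P, fq P) = c)).card : ℝ) ≤ 56 * K * ((1 / (|(c.1:ℝ)| + 1)) * (1 / (|(c.2:ℝ)| + 1))) := by
    intro c hc
    obtain ⟨_, hg⟩ := Finset.mem_filter.1 hc
    have hN := hN1 c hg.1
    set N := (c.1:ℝ)^2 + (c.2:ℝ)^2 with hNd
    have hN0 : 0 < N := by linarith
    have hZ : 0 < Real.sqrt N := Real.sqrt_pos.2 hN0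
    have hZ2 : Real.sqrt N ^ 2 = N := Real.sq_sqrt hN0.le
    have hND : N ≤ D := by
      have h1 : A * Real.sqrt N ≤ A * A := by
        calc _ ≤ K := hg.2
          _ ≤ D := hKD
          _ = A * A := by rw [← hA2]; ring
      have h2 := le_of_mul_le_mul_left h1 hA0
      rw [← hZ2, ← hA2]
      exact pow_le_pow_left₀ hZ.le h2 2
    set W := V.filter (fun P => (fp P, fq P) = c) with hW
    set S := W.image fh with hS
    have hScard : (S.card : ℝ) ≤ 2 * (K / (A * Real.sqrt N)) := by
      apply int_card_ne_le _ _ (by positivity)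
      intro t ht
      obtain ⟨P, hP, rfl⟩ := Finset.mem_image.1 ht
      obtain ⟨hPV, hPc⟩ := Finset.mem_filter.1 hP
      obtain ⟨h1, h2, h3, h4⟩ := hf P hPV
      refine ⟨h2, ?_⟩
      rw [le_div_iff₀ (by positivity)]
      have : (c.1, c.2) = (fp P, fq P) := hPc.symm
      simp only [Prod.mk.injEq] at this
      rw [hNd, this.1, this.2]
      linarith
    have hfib : ∀ t ∈ S, ((W.filter (fun P => fh P = t)).card : ℝ) ≤ 7 * (A / Real.sqrt N) := by
      intro t ht
      apply fiber_count D x hD c.1 c.2 t hg.1 hND hN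
      · intro P hP
        obtain ⟨hPW, hPt⟩ := Finset.mem_filter.1 hP
        obtain ⟨hPV, hPc⟩ := Finset.mem_filter.1 hPW
        refine ⟨hV P hPV, ?_⟩
        rw [← hPc, ← hPt]
        exact (hf P hPV).2.2.1
      · intro P hP Q hQ
        exact hI P (Finset.mem_filter.1 (Finset.mem_filter.1 hP).1).1 Q (Finset.mem_filter.1 (Finset.mem_filter.1 hQ).1).1
    have hWc : (W.card : ℝ) = ∑ t ∈ S, ((W.filter (fun P => fh P = t)).card : ℝ) := by
      rw [Finset.card_eq_sum_card_image fh W]; push_cast; rfl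
    have h14 : (W.card : ℝ) ≤ 14 * K * (1 / N) := by
      rw [hWc]
      refine (Finset.sum_le_card_nsmul _ _ _ hfib).trans ?_
      rw [nsmul_eq_mul]
      calc _ ≤ 2 * (K / (A * Real.sqrt N)) * (7 * (A / Real.sqrt N)) := by gcongr
        _ = 14 * K * (1 / Real.sqrt N ^ 2) := by field_simp; ring
        _ = _ := by rw [hZ2]
    refine h14.trans ?_
    have h4 : 1 / N ≤ 4 * ((1 / (|(c.1:ℝ)| + 1)) * (1 / (|(c.2:ℝ)| + 1))) := by
      have e0 : 4 * ((1 / (|(c.1:ℝ)| + 1)) * (1 / (|(c.2:ℝ)| + 1))) = 4 / ((|(c.1:ℝ)| + 1) * (|(c.2:ℝ)| + 1)) := by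
        field_simp
      rw [e0, div_le_div_iff₀ hN0 (by positivity)]
      have e1 : N = |(c.1:ℝ)|^2 + |(c.2:ℝ)|^2 := by rw [sq_abs, sq_abs]
      have := abs_nonneg (c.1:ℝ)
      have := abs_nonneg (c.2:ℝ)
      nlinarith [sq_nonneg (|(c.1:ℝ)| - |(c.2:ℝ)|), sq_nonneg (|(c.1:ℝ)| - 1), sq_nonneg (|(c.2:ℝ)| - 1)]
    calc _ ≤ 14 * K * (4 * ((1 / (|(c.1:ℝ)| + 1)) * (1 / (|(c.2:ℝ)| + 1)))) := by gcongr
      _ = _ := by ring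
  rw [hcard]
  refine (Finset.sum_le_sum hper).trans ?_
  rw [← Finset.mul_sum]
  have hsum : ∑ c ∈ T, ((1 / (|(c.1:ℝ)| + 1)) * (1 / (|(c.2:ℝ)| + 1))) ≤ (2 * (1 + Real.log (K + 1)))^2 := by
    calc _ ≤ ∑ c ∈ I ×ˢ I, ((1 / (|(c.1:ℝ)| + 1)) * (1 / (|(c.2:ℝ)| + 1))) :=
          Finset.sum_le_sum_of_subset_of_nonneg (Finset.filter_subset _ _) (fun c _ _ => by positivity)
      _ = (∑ p ∈ I, 1 / (|(p:ℝ)| + 1)) * (∑ q ∈ I, 1 / (|(q:ℝ)| + 1)) := by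
          rw [Finset.sum_mul_sum, ← Finset.sum_product']
      _ = (∑ p ∈ I, 1 / (|(p:ℝ)| + 1))^2 := by ring
      _ ≤ _ := by
          apply pow_le_pow_left₀ (Finset.sum_nonneg (fun _ _ => by positivity))
          refine (sum_inv_le _).trans ?_
          have : (⌊K⌋₊:ℝ) ≤ K := Nat.floor_le hK
          gcongr
  calc _ ≤ 56 * K * (2 * (1 + Real.log (K + 1)))^2 := by gcongr
    _ = _ := by ring

lemma log_bound (ε : ℝ) (hε : 0 < ε) : ∃ C : ℝ, 1 ≤ C ∧ ∀ x : ℝ, 1 ≤ x → 1 + Real.log (x + 1) ≤ C * x ^ ε := by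
  refine ⟨1 + 2 ^ ε / ε, by have : (0:ℝ) < 2 ^ ε / ε := by positivity
                            linarith, ?_⟩
  intro x hx
  have h1 := Real.log_le_rpow_div (by linarith : 0 ≤ x + 1) hε
  have h2 : (x + 1) ^ ε ≤ (2 * x) ^ ε := Real.rpow_le_rpow (by linarith) (by linarith) hε.le
  rw [Real.mul_rpow (by norm_num) (by linarith)] at h2
  have h3 : 1 ≤ x ^ ε := Real.one_le_rpow hx hε.le
  have h4 : (x+1) ^ ε / ε ≤ 2 ^ ε * x ^ ε / ε := by gcongr
  have h5 : 2 ^ ε * x ^ ε / ε = 2 ^ ε / ε * x ^ ε := by ring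
  rw [add_mul, one_mul]; linarith

theorem bad_count (ε : ℝ) (hε : 0 < ε) : ∃ C : ℝ, 1 ≤ C ∧ ∀ D x K : ℝ, 1 ≤ D → 1 ≤ x → 0 ≤ K → K ≤ D → K ≤ x →
    ∀ V : Finset Pt, (∀ P ∈ V, InBox D x P) → InjAB V → (∀ P ∈ V, Bad D K P) → (V.card : ℝ) ≤ C * K * x ^ ε := by
  obtain ⟨C, hC, hlog⟩ := log_bound (ε / 2) (by positivity)
  refine ⟨224 * C ^ 2, by nlinarith, ?_⟩
  intro D x K hD hx hK hKD hKx V hV hI hB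
  refine (bad_count0 D x K hD hK hKD V hV hI hB).trans ?_
  have h0 : 0 ≤ 1 + Real.log (K + 1) := by
    have := Real.log_nonneg (by linarith : 1 ≤ K + 1); linarith
  have h1 : 1 + Real.log (K + 1) ≤ C * x ^ (ε / 2) := by
    refine le_trans ?_ (hlog x hx)
    gcongr
  have h2 : (1 + Real.log (K + 1)) ^ 2 ≤ (C * x ^ (ε / 2)) ^ 2 := pow_le_pow_left₀ h0 h1 2
  have h3 : (x ^ (ε / 2)) ^ 2 = x ^ ε := by
    rw [← Real.rpow_natCast, ← Real.rpow_mul (by linarith)]; congr 1; push_cast; ring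
  rw [mul_pow, h3] at h2
  calc _ ≤ 224 * K * (C ^ 2 * x ^ ε) := by gcongr
    _ = _ := by ring

end SFV


namespace SFV
open Finset

theorem box_count (ε : ℝ) (hε : 0 < ε) : ∃ C : ℝ, 1 ≤ C ∧ ∀ D x M : ℝ, 1 ≤ D → 1 ≤ M → M ≤ x → D ≤ x → M ≤ D →
    400 * D ≤ M^2 → 32 * x * D ≤ M^3 → 720*720*12^6*18432*x^4 < M^7 → 240 * x ≤ M^2 →
    ∀ V : Finset Pt, (∀ P ∈ V, InBox D x P) → InjAB V → (V.card : ℝ) ≤ C * (M + x * D / M^2) * x ^ ε := by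
  obtain ⟨K1, hK1, hI⟩ := interval_count ε hε
  obtain ⟨C1, hC1, hB⟩ := bad_count ε hε
  refine ⟨5 * K1 + 240 * C1, by linarith, ?_⟩
  intro D x M hD hM hMx hDx hMD h400 h32 hbig h240 V hV hInj
  classical
  have hx : 1 ≤ x := hM.trans hMx
  set K := 240 * x * D / M^2 with hK
  have hM2 : 0 < M^2 := by positivity
  have hbad : ((V.filter (fun P => Bad D K P)).card : ℝ) ≤ C1 * K * x ^ ε := by
    apply hB D x K hD hx (by positivity)
    · rw [hK, div_le_iff₀ hM2]; nlinarith
    · rw [hK, div_le_iff₀ hM2]; nlinarith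
    · intro P hP; exact hV P (Finset.mem_filter.1 hP).1
    · intro P hP Q hQ; exact hInj P (Finset.mem_filter.1 hP).1 Q (Finset.mem_filter.1 hQ).1
    · intro P hP; exact (Finset.mem_filter.1 hP).2
  set W := V.filter (fun P => ¬ Bad D K P) with hW
  have hWV : ∀ P ∈ W, P ∈ V := fun P hP => (Finset.mem_filter.1 hP).1
  set f : Pt → ℤ := fun P => ⌊(P.a:ℝ) * M / P.b⌋ with hf
  have hb : ∀ P ∈ W, (0:ℝ) < P.b := fun P hP => by exact_mod_cast (hV P (hWV P hP)).1.1
  have hS : ((W.image f).card : ℝ) ≤ 2 * (M + 1) + 1 := by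
    apply int_card_le _ _ (by linarith)
    intro t ht
    obtain ⟨P, hP, rfl⟩ := Finset.mem_image.1 ht
    have h1 : |(P.a:ℝ)| ≤ P.b := by exact_mod_cast (hV P (hWV P hP)).2.1
    have h2 : |(P.a:ℝ) * M / P.b| ≤ M := by
      rw [abs_div, abs_mul, abs_of_pos (hb P hP), abs_of_pos (by linarith : 0 < M), div_le_iff₀ (hb P hP)]
      nlinarith
    have h3 := Int.floor_le ((P.a:ℝ) * M / P.b)
    have h4 := Int.lt_floor_add_one ((P.a:ℝ) * M / P.b)
    have h5 := abs_le.1 h2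
    rw [abs_le]; constructor <;> simp only [hf] <;> linarith
  have hfib : ∀ t ∈ W.image f, ((W.filter (fun P => f P = t)).card : ℝ) ≤ K1 * x ^ ε := by
    intro t ht
    have hm : ∀ P ∈ W.filter (fun P => f P = t), P ∈ W ∧ f P = t := fun P hP => Finset.mem_filter.1 hP
    apply hI D x M hD hM hMx hDx hMD h400 h32 hbig
    · intro P hP; exact hV P (hWV P (hm P hP).1)
    · intro P hP Q hQ; exact hInj P (hWV P (hm P hP).1) Q (hWV Q (hm Q hQ).1)
    · intro P hP Q hQ
      have hP0 := hb P (hm P hP).1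
      have hQ0 := hb Q (hm Q hQ).1
      have h3 := Int.floor_le ((P.a:ℝ) * M / P.b)
      have h4 := Int.lt_floor_add_one ((P.a:ℝ) * M / P.b)
      have h3' := Int.floor_le ((Q.a:ℝ) * M / Q.b)
      have h4' := Int.lt_floor_add_one ((Q.a:ℝ) * M / Q.b)
      have e1 : ⌊(P.a:ℝ) * M / P.b⌋ = t := (hm P hP).2
      have e2 : ⌊(Q.a:ℝ) * M / Q.b⌋ = t := (hm Q hQ).2
      rw [e1] at h3 h4
      rw [e2] at h3' h4'
      have h5 : |(P.a:ℝ) * M / P.b - (Q.a:ℝ) * M / Q.b| ≤ 1 := by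
        rw [abs_le]; constructor <;> linarith
      unfold Close
      have h6 : ((P.a:ℝ) * Q.b - Q.a * P.b) * M = ((P.a:ℝ) * M / P.b - (Q.a:ℝ) * M / Q.b) * (P.b * Q.b) := by
        field_simp
      have h7 : |((P.a:ℝ) * Q.b - Q.a * P.b) * M| = |((P.a:ℝ) * M / P.b - (Q.a:ℝ) * M / Q.b) * (P.b * Q.b)| := by rw [h6]
      rw [abs_mul, abs_mul, abs_of_pos (by linarith : 0 < M), abs_of_pos (mul_pos hP0 hQ0)] at h7
      rw [h7]
      have := mul_pos hP0 hQ0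
      nlinarith
    · intro P hP; exact (Finset.mem_filter.1 (hm P hP).1).2
  have hWc : (W.card : ℝ) ≤ (2 * (M + 1) + 1) * (K1 * x ^ ε) := by
    rw [Finset.card_eq_sum_card_image f W]; push_cast
    refine (Finset.sum_le_card_nsmul _ _ _ hfib).trans ?_
    rw [nsmul_eq_mul]; gcongr
  have hsplit : (V.card : ℝ) = (V.filter (fun P => Bad D K P)).card + W.card := by
    rw [hW]; exact_mod_cast (Finset.card_filter_add_card_filter_not (s := V) (fun P => Bad D K P)).symm
  have hxe : 0 < x ^ ε := by positivity
  have hK0 : K = 240 * (x * D / M^2) := by rw [hK]; ring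
  rw [hsplit]
  have hR : 0 ≤ x * D / M^2 := by positivity
  set R := x * D / M^2
  have hbad' := hbad.trans_eq (show C1 * K * x ^ ε = C1 * (240 * R) * x ^ ε by rw [hK0])
  have a1 : (2 * (M + 1) + 1) * (K1 * x ^ ε) ≤ (5 * K1 * M) * x ^ ε := by
    have : 2 * (M + 1) + 1 ≤ 5 * M := by linarith
    calc _ ≤ (5 * M) * (K1 * x ^ ε) := by gcongr
      _ = _ := by ring
  have a2 : 0 ≤ (5 * K1 * R + 240 * C1 * M) * x ^ ε := by positivity
  calc _ ≤ C1 * (240 * R) * x ^ ε + (5 * K1 * M) * x ^ ε := by linarith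
    _ ≤ _ := by linear_combination a2

end SFV


namespace SFV
open Finset

lemma odd_of_sq_dvd (n d : ℤ) (h : d^2 ∣ n^2+1) : ∃ s t : ℤ, s * d + t * 2 = 1 := by
  rcases Int.even_or_odd d with ⟨k, hk⟩ | ⟨k, hk⟩
  · exfalso
    obtain ⟨m, hm⟩ := h
    have h4 : n^2 + 1 = 4 * (k^2 * m) := by rw [hm, hk]; ring
    rcases Int.even_or_odd n with ⟨l, hl⟩ | ⟨l, hl⟩
    · have : n^2 = 4 * l^2 := by rw [hl]; ring
      omega
    · have : n^2 = 4 * (l^2 + l) + 1 := by rw [hl]; ring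
      omega
  · exact ⟨1, -k, by rw [hk]; ring⟩

lemma gauss_factor (n d : ℤ) (hd : 0 < d) (h : d^2 ∣ n^2+1) :
    ∃ z w : GaussianInt, z^2 * w = ⟨n, 1⟩ ∧ z.norm = d := by
  obtain ⟨s, t, hst⟩ := odd_of_sq_dvd n d h
  set g : GaussianInt := ⟨n, 1⟩ with hg
  set g' : GaussianInt := ⟨n, -1⟩ with hg'
  have hgs : star g = g' := by ext <;> simp [hg, hg']
  have hgg : g * g' = ((n^2+1 : ℤ) : GaussianInt) := by
    have e : ((n^2+1 : ℤ) : GaussianInt) = ⟨n^2+1, 0⟩ := by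
      ext <;> simp only [Zsqrtd.re_intCast, Zsqrtd.im_intCast]
    rw [e]
    ext <;> simp [hg, hg', Zsqrtd.re_mul, Zsqrtd.im_mul]
    ring
  have hst' : (s : GaussianInt) * d + t * 2 = 1 := by exact_mod_cast congrArg (Int.cast : ℤ → GaussianInt) hst
  set I : GaussianInt := ⟨0, 1⟩ with hI
  have hII : I * I = -1 := by ext <;> simp [hI]
  have hd2 : g - g' = 2 * I := by
    have : (2 : GaussianInt) = ⟨2, 0⟩ := by ext <;> simp
    rw [this]
    ext <;> simp [hg, hg', hI] 
  set z := EuclideanDomain.gcd (d : GaussianInt) g with hz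
  obtain ⟨k, hk⟩ : z ∣ (d : GaussianInt) := EuclideanDomain.gcd_dvd_left _ _
  obtain ⟨l, hl⟩ : z ∣ g := EuclideanDomain.gcd_dvd_right _ _
  obtain ⟨al, be, hab⟩ : ∃ al be : GaussianInt, z = d * al + g * be := ⟨_, _, EuclideanDomain.gcd_eq_gcd_ab _ _⟩
  have hks : (d : GaussianInt) = star z * star k := by
    have := congrArg star hk
    rw [star_mul'] at this
    rw [← this]; ext <;> simp
  have hls : g' = star z * star l := by
    have := congrArg star hl
    rw [star_mul', hgs] at this
    exact this
  have habs : star z = d * star al + g' * star be := by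
    have := congrArg star hab
    rw [star_add, star_mul', star_mul', hgs] at this
    rw [this]; congr 2
  obtain ⟨m, hm⟩ := h
  have hm' : g * g' = (d : GaussianInt)^2 * m := by rw [hgg, hm]; push_cast; ring
  have hN := Zsqrtd.norm_eq_mul_conj z
  have h1 : (d : GaussianInt) ∣ ((z.norm : ℤ) : GaussianInt) := by
    rw [hN]
    refine ⟨d * al * star al + al * g' * star be + g * be * star al + d * m * be * star be, ?_⟩
    rw [habs]
    conv_lhs => rw [hab]
    linear_combination (be * star be) * hm'
  have h2 : ((z.norm : ℤ) : GaussianInt) ∣ (d : GaussianInt) := by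
    rw [hN]
    have e1 : z * star z ∣ (d : GaussianInt) * d := by
      conv_rhs => rw [mul_comm]
      exact mul_dvd_mul ⟨k, hk⟩ ⟨star k, hks⟩
    have e2 : z * star z ∣ g * d := mul_dvd_mul ⟨l, hl⟩ ⟨star k, hks⟩
    have e3 : z * star z ∣ (d : GaussianInt) * g' := mul_dvd_mul ⟨k, hk⟩ ⟨star l, hls⟩
    have e4 : (d : GaussianInt) = s * (d * d) + (-(t * I)) * (g * d) + (t * I) * (d * g') := by
      linear_combination (-(d:GaussianInt)) * hst' - (-(t * I)) * d * hd2 + 2 * t * d * hII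
    rw [e4]
    exact dvd_add (dvd_add (e1.mul_left _) (e2.mul_left _)) (e3.mul_left _)
  have h1' : d ∣ z.norm := (Zsqrtd.intCast_dvd_intCast _ _).1 h1
  have h2' : z.norm ∣ d := (Zsqrtd.intCast_dvd_intCast _ _).1 h2
  have hn0 : 0 ≤ z.norm := GaussianInt.norm_nonneg z
  have hnd : z.norm = d := Int.dvd_antisymm hn0 hd.le h2' h1'
  have hcop : IsCoprime z g' := by
    refine ⟨s * k - t * I * l, t * I, ?_⟩
    linear_combination hst' - (s:GaussianInt) * hk + t * I * hl - t * I * hd2 - 2 * t * hII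
  have hdiv : z^2 ∣ g * g' := by
    rw [hm', hk]; exact ⟨k^2 * m, by ring⟩
  obtain ⟨w, hw⟩ := (hcop.pow_left (m := 2)).dvd_of_dvd_mul_right hdiv
  exact ⟨z, w, hw.symm, hnd⟩

lemma int_factor (n d : ℤ) (hd : 0 < d) (h : d^2 ∣ n^2+1) :
    ∃ a b u v : ℤ, (a^2-b^2)*v+2*a*b*u=1 ∧ (a^2-b^2)*u-2*a*b*v=n ∧ a^2+b^2=d := by
  obtain ⟨z, w, h1, h2⟩ := gauss_factor n d hd h
  have hre := congrArg Zsqrtd.re h1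
  have him := congrArg Zsqrtd.im h1
  simp only [pow_two, Zsqrtd.re_mul, Zsqrtd.im_mul] at hre him
  rw [Zsqrtd.norm_def] at h2
  exact ⟨z.re, z.im, w.re, w.im, by linear_combination him, by linear_combination hre, by linear_combination h2⟩

lemma pt_exists (n d : ℤ) (hd : 0 < d) (h : d^2 ∣ n^2+1) :
    ∃ P : Pt, IsPt P ∧ |P.a| ≤ P.b ∧ P.a^2+P.b^2=d ∧ nval P = n := by
  obtain ⟨a, b, u, v, h1, h2, h3⟩ := int_factor n d hd h
  rcases le_or_gt |a| |b| with hab | hab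
  · rcases lt_trichotomy b 0 with hb | hb | hb
    · refine ⟨⟨-a, -b, u, v⟩, ⟨by simpa using hb, by simp only; linear_combination h1⟩, ?_, by simp only; linear_combination h3,
        by simp only [nval]; linear_combination h2⟩
      simp only [abs_neg]; rw [abs_of_neg hb] at hab; exact hab
    · subst hb
      have : a = 0 := by simpa using hab
      subst this; simp at h3; omega
    · refine ⟨⟨a, b, u, v⟩, ⟨hb, by simp only; linear_combination h1⟩, ?_, by simp only; linear_combination h3,
        by simp only [nval]; linear_combination h2⟩
      simp only; rw [abs_of_pos hb] at hab; exact hab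
  · rcases lt_trichotomy a 0 with hb | hb | hb
    · refine ⟨⟨b, -a, -u, -v⟩, ⟨by simpa using hb, by simp only; linear_combination h1⟩, ?_, by simp only; linear_combination h3,
        by simp only [nval]; linear_combination h2⟩
      simp only; rw [abs_of_neg hb] at hab; exact hab.le
    · subst hb
      have := abs_nonneg b
      simp at hab; omega
    · refine ⟨⟨-b, a, -u, -v⟩, ⟨hb, by simp only; linear_combination h1⟩, ?_, by simp only; linear_combination h3,
        by simp only [nval]; linear_combination h2⟩
      simp only [abs_neg]; rw [abs_of_pos hb] at hab; exact hab.le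

lemma pt_inj (P Q : Pt) (hP : IsPt P) (hQ : IsPt Q) (ha : P.a = Q.a) (hb : P.b = Q.b)
    (hn : |nval P - nval Q| < (P.a^2+P.b^2)^2) : P = Q := by
  obtain ⟨a, b, u, v⟩ := P
  obtain ⟨a', b', u', v'⟩ := Q
  simp only at ha hb
  subst ha hb
  obtain ⟨hb, e1⟩ := hP
  obtain ⟨-, e2⟩ := hQ
  simp only [nval] at hb e1 e2 hn ⊢
  set m := (a^2-b^2)*u-2*a*b*v - ((a^2-b^2)*u'-2*a*b*v') with hm
  have h1 : (a^2+b^2)^2 * (u - u') = (a^2-b^2) * m := by rw [hm]; linear_combination (2*a*b) * (e1 - e2)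
  have h2 : (a^2+b^2)^2 * (v - v') = -(2*a*b) * m := by rw [hm]; linear_combination (a^2-b^2) * (e1 - e2)
  have h3 : m = (a^2+b^2)^2 * (v * (u-u') - u * (v-v')) := by linear_combination (-m) * e1 - v * h1 + u * h2
  have hm0 : m = 0 := Int.eq_zero_of_abs_lt_dvd ⟨_, h3⟩ hn
  have hp : (a^2+b^2)^2 ≠ 0 := by positivity
  rw [hm0, mul_zero] at h1 h2
  have := (mul_eq_zero.1 h1).resolve_left hp
  have := (mul_eq_zero.1 h2).resolve_left hp
  ext <;> simp only <;> omega

lemma pair_count (D x B : ℝ) (hD : 1 ≤ D) (hDx : x ≤ D^2)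
    (hB : ∀ V : Finset Pt, (∀ P ∈ V, InBox D x P) → InjAB V → (V.card : ℝ) ≤ B)
    (V : Finset (ℕ × ℕ)) (hV : ∀ p ∈ V, (p.1 : ℝ) ≤ x ∧ p.2^2 ∣ p.1^2+1 ∧ D < p.2 ∧ (p.2:ℝ) ≤ 2*D) :
    (V.card : ℝ) ≤ B := by
  classical
  have hex : ∀ p : ℕ × ℕ, ∃ P : Pt, p ∈ V → IsPt P ∧ |P.a| ≤ P.b ∧ P.a^2+P.b^2=(p.2:ℤ) ∧ nval P = (p.1:ℤ) := by
    intro p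
    by_cases hp : p ∈ V
    · have hp' := hV p hp
      have h0 : 0 < (p.2:ℤ) := by
        have : (0:ℝ) < p.2 := by linarith [hp'.2.2.1]
        exact_mod_cast this
      obtain ⟨P, hP⟩ := pt_exists (p.1:ℤ) (p.2:ℤ) h0 (by exact_mod_cast hp'.2.1)
      exact ⟨P, fun _ => hP⟩
    · exact ⟨⟨0,0,0,0⟩, fun h => absurd h hp⟩
  choose f hf using hex
  have hcard : (V.image f).card = V.card := by
    apply Finset.card_image_of_injOn
    intro p hp q hq hpq
    have h1 := hf p hp
    have h2 := hf q hq
    have hpq' : f p = f q := hpq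
    rw [hpq'] at h1
    have e1 : (p.2:ℤ) = q.2 := h1.2.2.1.symm.trans h2.2.2.1
    have e2 : (p.1:ℤ) = q.1 := h1.2.2.2.symm.trans h2.2.2.2
    ext
    · exact_mod_cast e2
    · exact_mod_cast e1
  rw [← hcard]
  apply hB
  · intro P hP
    obtain ⟨p, hp, rfl⟩ := Finset.mem_image.1 hP
    obtain ⟨h1, h2, h3, h4⟩ := hf p hp
    obtain ⟨g1, g2, g3, g4⟩ := hV p hp
    have e : (((f p).a:ℝ)^2+((f p).b:ℝ)^2) = p.2 := by exact_mod_cast h3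
    refine ⟨h1, h2, ?_, ?_, ?_, ?_⟩
    · rw [e]; exact g3
    · rw [e]; exact g4
    · rw [h4]; positivity
    · rw [h4]; exact_mod_cast g1
  · intro P hP Q hQ ha hb
    obtain ⟨p, hp, rfl⟩ := Finset.mem_image.1 hP
    obtain ⟨q, hq, rfl⟩ := Finset.mem_image.1 hQ
    obtain ⟨h1, h2, h3, h4⟩ := hf p hp
    obtain ⟨k1, k2, k3, k4⟩ := hf q hq
    apply pt_inj _ _ h1 k1 ha hb
    rw [h4, k4, h3]
    have g1 := (hV p hp).1
    have g2 := (hV q hq).1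
    have g3 := (hV p hp).2.2.1
    have : |(p.1:ℝ) - q.1| < (p.2:ℝ)^2 := by
      have : x < (p.2:ℝ)^2 := by nlinarith
      have a1 : (0:ℝ) ≤ p.1 := by positivity
      have a2 : (0:ℝ) ≤ q.1 := by positivity
      rw [abs_lt]; constructor <;> linarith
    exact_mod_cast this

lemma dyadic_count (x M Y B : ℝ) (hM : 1 ≤ M)
    (h : ∀ D, M ≤ D → D ≤ Y → ∀ V : Finset (ℕ × ℕ),
      (∀ p ∈ V, (p.1 : ℝ) ≤ x ∧ p.2^2 ∣ p.1^2+1 ∧ D < p.2 ∧ (p.2:ℝ) ≤ 2*D) → (V.card : ℝ) ≤ B) (hB : 0 ≤ B) (k : ℕ) :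
    ∀ V : Finset (ℕ × ℕ), (∀ p ∈ V, (p.1 : ℝ) ≤ x ∧ p.2^2 ∣ p.1^2+1 ∧ M < p.2 ∧ (p.2:ℝ) ≤ 2^k*M ∧ (p.2:ℝ) ≤ Y) →
    (V.card : ℝ) ≤ k * B := by
  classical
  induction k with
  | zero =>
    intro V hV
    have : V = ∅ := by
      rw [Finset.eq_empty_iff_forall_notMem]
      intro p hp
      have := hV p hp
      linarith [this.2.2.1, this.2.2.2.1]
    simp [this]
  | succ k ih =>
    intro V hV
    have h1 := ih (V.filter (fun p => (p.2:ℝ) ≤ 2^k*M)) (by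
      intro p hp
      obtain ⟨hp, hk⟩ := Finset.mem_filter.1 hp
      have := hV p hp
      exact ⟨this.1, this.2.1, this.2.2.1, hk, this.2.2.2.2⟩)
    have h2 : ((V.filter (fun p => ¬ (p.2:ℝ) ≤ 2^k*M)).card : ℝ) ≤ B := by
      rcases (V.filter (fun p => ¬ (p.2:ℝ) ≤ 2^k*M)).eq_empty_or_nonempty with he | ⟨q, hq⟩
      · rw [he]; simpa using hB
      · apply h (2^k*M)
        · have : (1:ℝ) ≤ 2^k := one_le_pow₀ (by norm_num)
          nlinarith
        · obtain ⟨hq, hk⟩ := Finset.mem_filter.1 hq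
          have := hV q hq
          push Not at hk
          linarith [this.2.2.2.2]
        · intro p hp
          obtain ⟨hp, hk⟩ := Finset.mem_filter.1 hp
          push Not at hk
          have := hV p hp
          refine ⟨this.1, this.2.1, hk, ?_⟩
          have := this.2.2.2.1
          rw [pow_succ] at this; linarith
    have hs : (V.card : ℝ) = (V.filter (fun p => (p.2:ℝ) ≤ 2^k*M)).card + (V.filter (fun p => ¬ (p.2:ℝ) ≤ 2^k*M)).card := by
      exact_mod_cast (Finset.card_filter_add_card_filter_not (s := V) (fun p => (p.2:ℝ) ≤ 2^k*M)).symm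
    rw [hs]; push_cast; linarith

end SFV


namespace SFV
open Finset Filter

lemma ev_lt (c a b : ℝ) (h : a < b) : ∀ᶠ x : ℝ in atTop, c * x ^ a < x ^ b := by
  have h1 := (tendsto_rpow_atTop (sub_pos.2 h)).eventually (eventually_gt_atTop c)
  filter_upwards [h1, eventually_gt_atTop 0] with x hx hx0
  have : x ^ b = x ^ (b - a) * x ^ a := by rw [← Real.rpow_add hx0]; congr 1; ring
  rw [this]
  exact mul_lt_mul_of_pos_right hx (Real.rpow_pos_of_pos hx0 a)

lemma exists_two_pow (ε : ℝ) (hε : 0 < ε) : ∃ C : ℝ, 1 ≤ C ∧ ∀ x : ℝ, 1 ≤ x → ∃ k : ℕ, x ≤ 2^k ∧ (k:ℝ) ≤ C * x ^ ε := by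
  obtain ⟨C, hC, h⟩ := log_bound ε hε
  refine ⟨2 * C, by linarith, ?_⟩
  intro x hx
  refine ⟨⌈Real.logb 2 x⌉₊, ?_, ?_⟩
  · have h1 := Nat.le_ceil (Real.logb 2 x)
    rw [Real.logb_le_iff_le_rpow (by norm_num) (by linarith)] at h1
    rwa [Real.rpow_natCast] at h1
  · have h0 : 0 ≤ Real.logb 2 x := Real.logb_nonneg (by norm_num) hx
    have h1 := Nat.ceil_lt_add_one h0
    have h2 : Real.logb 2 x ≤ 2 * Real.log (x+1) := by
      rw [Real.logb, div_le_iff₀ (Real.log_pos (by norm_num))]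
      have h3 : Real.log x ≤ Real.log (x+1) := Real.log_le_log (by linarith) (by linarith)
      have h4 : 0 ≤ Real.log (x+1) := Real.log_nonneg (by linarith)
      have h5 := Real.log_two_gt_d9
      nlinarith
    have := h x hx
    nlinarith

theorem middle_count (ε : ℝ) (hε : 0 < ε) : ∃ C : ℝ, 1 ≤ C ∧ ∀ᶠ x : ℝ in atTop,
    ∀ V : Finset (ℕ × ℕ), (∀ p ∈ V, (p.1 : ℝ) ≤ x ∧ p.2^2 ∣ p.1^2+1 ∧ x ^ (23/40:ℝ) < p.2 ∧ (p.2:ℝ) ≤ x ^ (57/80:ℝ)) →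
    (V.card : ℝ) ≤ C * x ^ (23/40 + ε) := by
  obtain ⟨C1, hC1, hbox⟩ := box_count (ε/2) (by positivity)
  obtain ⟨C2, hC2, hpow⟩ := exists_two_pow (ε/2) (by positivity)
  refine ⟨C2 * (C1 * 2), by nlinarith, ?_⟩
  filter_upwards [ev_lt 400 (57/80) (46/40) (by norm_num), ev_lt 32 (137/80) (69/40) (by norm_num),
    ev_lt (720*720*12^6*18432) 4 (161/40) (by norm_num), ev_lt 240 1 (46/40) (by norm_num),
    eventually_ge_atTop 1] with x h1 h2 h3 h4 hx V hV
  have hx0 : 0 < x := by linarith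
  set M := x ^ (23/40:ℝ) with hMd
  set Y := x ^ (57/80:ℝ) with hYd
  have hM : 1 ≤ M := Real.one_le_rpow hx (by norm_num)
  have hMx : M ≤ x := by
    conv_rhs => rw [← Real.rpow_one x]
    exact Real.rpow_le_rpow_of_exponent_le hx (by norm_num)
  have hYx : Y ≤ x := by
    conv_rhs => rw [← Real.rpow_one x]
    exact Real.rpow_le_rpow_of_exponent_le hx (by norm_num)
  have hM2 : M^2 = x ^ (46/40:ℝ) := by
    rw [hMd, ← Real.rpow_natCast, ← Real.rpow_mul hx0.le]; norm_num
  have hM3 : M^3 = x ^ (69/40:ℝ) := by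
    rw [hMd, ← Real.rpow_natCast, ← Real.rpow_mul hx0.le]; norm_num
  have hM7 : M^7 = x ^ (161/40:ℝ) := by
    rw [hMd, ← Real.rpow_natCast, ← Real.rpow_mul hx0.le]; norm_num
  have hxY : x * Y = x ^ (137/80:ℝ) := by
    rw [hYd, mul_comm, ← Real.rpow_add_one hx0.ne']; norm_num
  have hx4 : x ^ (4:ℝ) = x^4 := by rw [← Real.rpow_natCast]; norm_num
  rw [Real.rpow_one, ← hM2] at h4
  rw [← hM2] at h1
  rw [← hM3, ← hxY] at h2
  rw [← hM7, hx4] at h3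
  set B := C1 * (2 * M) * x ^ (ε/2) with hB
  obtain ⟨k, hk1, hk2⟩ := hpow x hx
  have hxe : 0 < x ^ (ε/2) := by positivity
  have hcount := dyadic_count x M Y B hM (by
    intro D hMD hDY W hW
    apply pair_count D x B (by linarith) (by nlinarith) _ W hW
    intro U hU hI
    have hD0 : 0 < D := by linarith
    refine (hbox D x M (by linarith) hM hMx (by linarith) hMD (by linarith) ?_ h3 h4.le U hU hI).trans ?_
    · nlinarith
    · rw [hB]
      have : x * D / M^2 ≤ M := by
        rw [div_le_iff₀ (by positivity)]; nlinarith
      have e : M + x * D / M^2 ≤ 2 * M := by linarith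
      gcongr) (by positivity) k V (by
    intro p hp
    have := hV p hp
    refine ⟨this.1, this.2.1, this.2.2.1, ?_, this.2.2.2⟩
    have : Y ≤ 2^k * M := by
      have : (0:ℝ) < 2^k := by positivity
      nlinarith
    linarith [(hV p hp).2.2.2])
  refine hcount.trans ?_
  have e1 : x ^ (23/40 + ε) = M * x ^ (ε/2) * x ^ (ε/2) := by
    rw [hMd, ← Real.rpow_add hx0, ← Real.rpow_add hx0]; congr 1; ring
  rw [e1]
  calc (k:ℝ) * B ≤ (C2 * x ^ (ε/2)) * B := by gcongr
    _ = _ := by rw [hB]; ring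

end SFV


namespace SFV
open Finset Filter

lemma pell_gap (e n d n' d' : ℤ) (he : 0 < e) (hn : 0 < n) (hd : 0 < d) (hd' : 0 < d')
    (h : n^2+1 = e*d^2) (h' : n'^2+1 = e*d'^2) (hlt : n < n') : 2 * n ≤ n' := by
  set X := e*d*d' - n*n' with hX
  set Y := n'*d - n*d' with hY
  have hn' : 0 < n' := hn.trans hlt
  have e1 : X^2 = 1 + e*Y^2 := by rw [hX, hY]; linear_combination (n'^2-e*d'^2)*h - h'
  have e2 : n' = n*X + e*d*Y := by rw [hX, hY]; linear_combination n' * h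
  have hdd : d^2 < d'^2 := by
    have : n^2 < n'^2 := by nlinarith
    have : e * d^2 < e * d'^2 := by linarith
    exact lt_of_mul_lt_mul_left this he.le
  have hY0 : 0 < Y := by
    have : (n*d')^2 < (n'*d)^2 := by
      have : (n'*d)^2 - (n*d')^2 = d'^2 - d^2 := by linear_combination d^2 * h' - d'^2 * h
      linarith
    have := lt_of_pow_lt_pow_left₀ 2 (by positivity) this
    rw [hY]; linarith
  have hX0 : 0 < X := by
    have : (n*n')^2 < (e*d*d')^2 := by
      have : (e*d*d')^2 = (n^2+1)*(n'^2+1) := by rw [h, h']; ring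
      nlinarith [sq_nonneg n, sq_nonneg n']
    have := lt_of_pow_lt_pow_left₀ 2 (by positivity) this
    rw [hX]; linarith
  have hX2 : 2 ≤ X := by
    by_contra hc
    have : X = 1 := by omega
    rw [this] at e1
    have : 0 < e * Y^2 := by positivity
    linarith
  have : 0 < e * d * Y := by positivity
  nlinarith

lemma pell_count (e : ℕ) (k : ℕ) (V : Finset (ℕ × ℕ)) (he : 0 < e)
    (hV : ∀ p ∈ V, 1 ≤ p.1 ∧ p.1 ≤ 2^k ∧ p.1^2+1 = e * p.2^2) : V.card ≤ k + 1 := by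
  have hmaps : ∀ p ∈ V, Nat.log 2 p.1 ∈ Finset.range (k+1) := by
    intro p hp
    rw [Finset.mem_range, Nat.lt_succ_iff]
    have := Nat.log_mono_right (b := 2) (hV p hp).2.1
    rwa [Nat.log_pow (by norm_num)] at this
  have hpos : ∀ p ∈ V, 0 < p.2 := by
    intro p hp
    rcases Nat.eq_zero_or_pos p.2 with h0 | h0
    · have := (hV p hp).2.2
      rw [h0] at this; simp at this
    · exact h0
  have hgap : ∀ p ∈ V, ∀ q ∈ V, p.1 < q.1 → Nat.log 2 p.1 < Nat.log 2 q.1 := by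
    intro p hp q hq hlt
    have h1 := hV p hp
    have h2 := hV q hq
    have h3 := pell_gap e p.1 p.2 q.1 q.2 (by exact_mod_cast he) (by exact_mod_cast h1.1) (by exact_mod_cast hpos p hp)
      (by exact_mod_cast hpos q hq) (by exact_mod_cast h1.2.2) (by exact_mod_cast h2.2.2) (by exact_mod_cast hlt)
    have h4 : p.1 * 2 ≤ q.1 := by
      have : 2 * p.1 ≤ q.1 := by exact_mod_cast h3
      linarith
    have h5 := Nat.log_mono_right (b := 2) h4
    rw [Nat.log_mul_base (by norm_num) (by have := h1.1; omega)] at h5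
    omega
  have := Finset.card_le_card_of_injOn (fun p : ℕ × ℕ => Nat.log 2 p.1) hmaps (by
    intro p hp q hq hpq
    simp only at hpq
    rcases lt_trichotomy p.1 q.1 with hlt | heq | hlt
    · have := hgap p hp q hq hlt; omega
    · have h1 := (hV p hp).2.2
      have h2 := (hV q hq).2.2
      rw [heq, h2] at h1
      have h3 := Nat.eq_of_mul_eq_mul_left he h1
      have h4 : q.2 = p.2 := Nat.pow_left_injective (n := 2) (by norm_num) h3
      exact Prod.ext heq h4.symm
    · have := hgap q hq p hp hlt; omega)
  simpa using this

theorem large_count (ε : ℝ) (hε : 0 < ε) : ∃ C : ℝ, 1 ≤ C ∧ ∀ x : ℝ, 1 ≤ x →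
    ∀ V : Finset (ℕ × ℕ), (∀ p ∈ V, 1 ≤ p.1 ∧ (p.1 : ℝ) ≤ x ∧ p.2^2 ∣ p.1^2+1 ∧ x ^ (57/80:ℝ) < p.2) →
    (V.card : ℝ) ≤ C * x ^ (23/40 + ε) := by
  obtain ⟨C2, hC2, hpow⟩ := exists_two_pow ε hε
  refine ⟨4 * C2, by linarith, ?_⟩
  intro x hx V hV
  classical
  obtain ⟨k, hk1, hk2⟩ := hpow x hx
  have hx0 : 0 < x := by linarith
  set f : ℕ × ℕ → ℕ := fun p => (p.1^2+1)/p.2^2 with hf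
  have hfe : ∀ p ∈ V, p.1^2+1 = f p * p.2^2 := fun p hp => (Nat.div_mul_cancel (hV p hp).2.2.1).symm
  have hf0 : ∀ p ∈ V, 0 < f p := by
    intro p hp
    rcases Nat.eq_zero_or_pos (f p) with h0 | h0
    · have := hfe p hp
      rw [h0] at this; simp at this
    · exact h0
  have hfib : ∀ e ∈ V.image f, (((V.filter (fun p => f p = e)).card : ℕ):ℝ) ≤ (k:ℝ) + 1 := by
    intro e he
    obtain ⟨q, hq, rfl⟩ := Finset.mem_image.1 he
    have := pell_count (f q) k (V.filter (fun p => f p = f q)) (hf0 q hq) (by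
      intro p hp
      obtain ⟨hp, hpe⟩ := Finset.mem_filter.1 hp
      refine ⟨(hV p hp).1, ?_, ?_⟩
      · have := (hV p hp).2.1.trans hk1
        exact_mod_cast this
      · rw [← hpe]; exact hfe p hp)
    exact_mod_cast this
  have hcI : ((V.image f).card : ℝ) ≤ 2 * x ^ (23/40:ℝ) := by
    have hsub : V.image f ⊆ Finset.Ioc 0 ⌊2 * x ^ (23/40:ℝ)⌋₊ := by
      intro e he
      obtain ⟨p, hp, rfl⟩ := Finset.mem_image.1 he
      rw [Finset.mem_Ioc]
      refine ⟨hf0 p hp, Nat.le_floor ?_⟩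
      have h1 : ((p.1:ℝ))^2+1 = f p * (p.2:ℝ)^2 := by exact_mod_cast hfe p hp
      obtain ⟨-, g2, -, g4⟩ := hV p hp
      have hY0 : 0 < x ^ (57/80:ℝ) := by positivity
      have g5 : (x ^ (57/80:ℝ))^2 ≤ (p.2:ℝ)^2 := pow_le_pow_left₀ hY0.le g4.le 2
      have g6 : (x ^ (57/80:ℝ))^2 * x ^ (23/40:ℝ) = x^2 := by
        rw [← Real.rpow_natCast, ← Real.rpow_mul hx0.le, ← Real.rpow_add hx0, ← Real.rpow_natCast]; norm_num
      have g7 : (p.1:ℝ)^2 ≤ x^2 := pow_le_pow_left₀ (by positivity) g2 2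
      have h2 : (f p:ℝ) * (x ^ (57/80:ℝ))^2 ≤ (2 * x ^ (23/40:ℝ)) * (x ^ (57/80:ℝ))^2 := by
        calc _ ≤ (f p:ℝ) * (p.2:ℝ)^2 := by gcongr
          _ = (p.1:ℝ)^2+1 := h1.symm
          _ ≤ 2 * x^2 := by nlinarith
          _ = _ := by rw [← g6]; ring
      exact le_of_mul_le_mul_right h2 (by positivity)
    have := Finset.card_le_card hsub
    rw [Nat.card_Ioc] at this
    have h2 : ((V.image f).card : ℝ) ≤ ⌊2 * x ^ (23/40:ℝ)⌋₊ := by exact_mod_cast this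
    exact h2.trans (Nat.floor_le (by positivity))
  rw [Finset.card_eq_sum_card_image f V]; push_cast
  refine (Finset.sum_le_card_nsmul _ _ _ hfib).trans ?_
  rw [nsmul_eq_mul, Real.rpow_add hx0]
  have h1 : 1 ≤ x ^ ε := Real.one_le_rpow hx hε.le
  calc _ ≤ (2 * x ^ (23/40:ℝ)) * (2 * C2 * x ^ ε) := by
        gcongr; nlinarith
    _ = _ := by ring

end SFV


namespace SFV
open Finset Filter ArithmeticFunction
open scoped ArithmeticFunction.Moebius

noncomputable def rho (d : ℕ) : ℕ := Nat.card {y : ZMod (d^2) // y^2 + 1 = 0}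

lemma rho_one : rho 1 = 1 := by
  unfold rho
  rw [Nat.card_eq_one_iff_unique]
  have : Subsingleton (ZMod (1^2)) := by rw [one_pow]; infer_instance
  exact ⟨inferInstance, ⟨⟨0, Subsingleton.elim _ _⟩⟩⟩

lemma rho_mul (m n : ℕ) (h : m.Coprime n) : rho (m * n) = rho m * rho n := by
  unfold rho
  have hc : (m^2).Coprime (n^2) := Nat.Coprime.pow 2 2 h
  rw [mul_pow, ← Nat.card_prod]
  let e := ZMod.chineseRemainder hc
  apply Nat.card_congr
  exact {
    toFun := fun y => (⟨(e y.1).1, by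
      have := congrArg (fun z => (e z).1) y.2
      simpa using this⟩, ⟨(e y.1).2, by
      have := congrArg (fun z => (e z).2) y.2
      simpa using this⟩)
    invFun := fun p => ⟨e.symm (p.1.1, p.2.1), by
      apply e.injective
      rw [map_add, map_pow, map_one, _root_.map_zero, RingEquiv.apply_symm_apply]
      ext
      · simpa using p.1.2
      · simpa using p.2.2⟩
    left_inv := fun y => by ext; simp
    right_inv := fun p => by ext <;> simp }

lemma zmod_root_iff (d : ℕ) (n : ℕ) : ((n : ZMod (d^2))^2 + 1 = 0) ↔ d^2 ∣ n^2+1 := by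
  rw [← ZMod.natCast_eq_zero_iff]; push_cast; rfl

lemma rho_prime_zero (p : ℕ) (hp : p.Prime) (h : p % 4 ≠ 1) : rho p = 0 := by
  unfold rho
  have hp0 : NeZero (p^2) := ⟨pow_ne_zero 2 hp.ne_zero⟩
  rw [Nat.card_eq_zero]
  left
  refine ⟨fun y => ?_⟩
  have hy := y.2
  rw [← ZMod.natCast_zmod_val y.1, zmod_root_iff] at hy
  set n := y.1.val
  rcases hp.eq_two_or_odd with h2 | h2
  · obtain ⟨s, t, hst⟩ := odd_of_sq_dvd n p (by exact_mod_cast hy)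
    rw [h2] at hst; push_cast at hst; omega
  · have h3 : p % 4 = 3 := by omega
    haveI := Fact.mk hp
    have h4 : IsSquare (-1 : ZMod p) := by
      refine ⟨(n : ZMod p), ?_⟩
      have : p ∣ n^2+1 := (dvd_pow_self p (by norm_num)).trans hy
      rw [← ZMod.natCast_eq_zero_iff] at this
      push_cast at this
      linear_combination -this
    exact ZMod.exists_sq_eq_neg_one_iff.1 h4 h3

lemma rho_prime_two (p : ℕ) (hp : p.Prime) (h : p % 4 = 1) : rho p = 2 := by
  unfold rho
  have hp0 : NeZero (p^2) := ⟨pow_ne_zero 2 hp.ne_zero⟩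
  haveI := Fact.mk hp
  have hsq : IsSquare (-1 : ZMod p) := ZMod.exists_sq_eq_neg_one_iff.2 (by omega)
  obtain ⟨y, hy⟩ := hsq
  have h2p : p ≠ 2 := by rintro rfl; omega
  have hodd : Odd p := hp.odd_of_ne_two h2p
  set n : ℤ := ((y.val : ℕ) : ℤ) with hn
  have hdvd : (p:ℤ) ∣ n^2 - (-1) := by
    have : ((n^2 - (-1) : ℤ) : ZMod p) = 0 := by
      rw [hn]; push_cast; rw [ZMod.natCast_zmod_val]; linear_combination -hy
    rwa [ZMod.intCast_zmod_eq_zero_iff_dvd] at this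
  have h3 := dvd_sub_pow_of_dvd_sub hdvd 1
  rw [pow_one, hodd.neg_one_pow] at h3
  set r : ZMod (p^2) := ((n^p : ℤ) : ZMod (p^2)) with hr
  have hr0 : r^2 + 1 = 0 := by
    have : (((n^2)^p - (-1) : ℤ) : ZMod (p^2)) = 0 := by
      rw [ZMod.intCast_zmod_eq_zero_iff_dvd]; push_cast; exact h3
    rw [hr, ← this]; push_cast; ring
  have key : ∀ s : ZMod (p^2), s^2+1=0 → s = r ∨ s = -r := by
    intro s hs
    have hprod : (s - r) * (s + r) = 0 := by linear_combination hs - hr0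
    obtain ⟨a, ha⟩ := ZMod.intCast_surjective s
    obtain ⟨b, hb⟩ := ZMod.intCast_surjective r
    rw [← ha, ← hb] at hprod ⊢
    rw [← hb] at hr0
    have e1 : ((p^2 : ℕ):ℤ) ∣ (a-b)*(a+b) := by
      rw [← ZMod.intCast_zmod_eq_zero_iff_dvd]; push_cast; exact hprod
    have e2 : ((p^2 : ℕ):ℤ) ∣ b^2+1 := by
      rw [← ZMod.intCast_zmod_eq_zero_iff_dvd]; push_cast; exact hr0
    push_cast at e1 e2
    have hpI : Prime (p:ℤ) := Nat.prime_iff_prime_int.1 hp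
    have hnot : ¬ ((p:ℤ) ∣ (a - b) ∧ (p:ℤ) ∣ (a+b)) := by
      rintro ⟨d1, d2⟩
      have d3 : (p:ℤ) ∣ 2 * b := by
        have := dvd_sub d2 d1; ring_nf at this; rwa [mul_comm] at this
      rcases hpI.dvd_or_dvd d3 with d4 | d4
      · have : p ∣ 2 := by exact_mod_cast d4
        exact h2p ((Nat.prime_dvd_prime_iff_eq hp Nat.prime_two).1 this)
      · have d5 : (p:ℤ) ∣ b^2+1 := (dvd_pow_self _ (by norm_num)).trans e2
        have d6 : (p:ℤ) ∣ 1 := by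
          have := dvd_sub d5 (d4.mul_left b); ring_nf at this; exact this
        exact hpI.not_isUnit (isUnit_of_dvd_one d6)
    by_cases hc : (p:ℤ) ∣ a - b
    · have hc2 : IsCoprime ((p:ℤ)^2) (a+b) := by
        apply IsCoprime.pow_left
        rw [hpI.coprime_iff_not_dvd]
        exact fun h => hnot ⟨hc, h⟩
      left
      have := hc2.dvd_of_dvd_mul_right e1
      rw [← sub_eq_zero]
      have h5 : ((a - b : ℤ) : ZMod (p^2)) = 0 := by
        rw [ZMod.intCast_zmod_eq_zero_iff_dvd]; push_cast; exact this
      push_cast at h5; exact h5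
    · have hc2 : IsCoprime ((p:ℤ)^2) (a-b) := by
        apply IsCoprime.pow_left
        rwa [hpI.coprime_iff_not_dvd]
      right
      have := hc2.dvd_of_dvd_mul_left e1
      rw [← sub_eq_zero]
      have h5 : ((a + b : ℤ) : ZMod (p^2)) = 0 := by
        rw [ZMod.intCast_zmod_eq_zero_iff_dvd]; push_cast; exact this
      push_cast at h5; linear_combination h5
  have hne : r ≠ -r := by
    intro he
    have h2r : 2 * r = 0 := by linear_combination he
    have h4 : (4 : ZMod (p^2)) = 0 := by linear_combination 4 * hr0 - 2 * r * h2r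
    have h5 : ((4 : ℕ) : ZMod (p^2)) = 0 := by exact_mod_cast h4
    rw [ZMod.natCast_eq_zero_iff] at h5
    have h6 : p ∣ 2^2 := (dvd_pow_self p (by norm_num)).trans h5
    exact h2p ((Nat.prime_dvd_prime_iff_eq hp Nat.prime_two).1 (hp.dvd_of_dvd_pow h6))
  rw [Nat.card_eq_two_iff]
  refine ⟨⟨r, hr0⟩, ⟨-r, by rw [neg_sq]; exact hr0⟩, ?_, ?_⟩
  · intro he; exact hne (congrArg Subtype.val he)
  · ext s
    simp only [Set.mem_insert_iff, Set.mem_singleton_iff, Set.mem_univ, iff_true]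
    rcases key s.1 s.2 with h | h
    · left; exact Subtype.ext h
    · right; exact Subtype.ext h

/-- the multiplicative coefficient -/
noncomputable def fco (d : ℕ) : ℝ := (μ d : ℝ) * rho d

lemma fco_mul (m n : ℕ) (h : m.Coprime n) : fco (m * n) = fco m * fco n := by
  unfold fco
  rw [rho_mul m n h, isMultiplicative_moebius.map_mul_of_coprime h]; push_cast; ring

lemma fco_one : fco 1 = 1 := by simp [fco, rho_one]

lemma fco_prime_pow (p k : ℕ) (hp : p.Prime) (hk : 2 ≤ k) : fco (p^k) = 0 := by
  unfold fco
  rw [moebius_eq_zero_of_not_squarefree]; · simp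
  intro h
  have := (Nat.squarefree_pow_iff hp.ne_one (by omega)).1 h
  omega

lemma fco_prime (p : ℕ) (hp : p.Prime) : fco p = if p % 4 = 1 then -2 else 0 := by
  unfold fco
  rw [moebius_apply_prime hp]
  split_ifs with h
  · rw [rho_prime_two p hp h]; norm_num
  · rw [rho_prime_zero p hp h]; norm_num

lemma fco_abs_le (d : ℕ) : |fco d| ≤ (d.divisors.card : ℝ) := by
  induction d using Nat.recOnPosPrimePosCoprime with
  | zero => simp [fco]
  | one => simp [fco_one]
  | prime_pow p k hp hk =>
    rcases Nat.lt_or_ge k 2 with h | h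
    · have : k = 1 := by omega
      subst this
      rw [pow_one, fco_prime p hp, hp.divisors, Finset.card_pair hp.one_lt.ne]
      split_ifs <;> norm_num
    · rw [fco_prime_pow p k hp h]; simp
  | coprime a b ha hb hab iha ihb =>
    rw [fco_mul a b hab, abs_mul, hab.card_divisors_mul]; push_cast
    gcongr

end SFV


namespace SFV
open Finset Filter

noncomputable def gco (d : ℕ) : ℝ := fco d / (d:ℝ)^2

lemma fco_bound (ε : ℝ) (hε : 0 < ε) : ∃ C : ℝ, 1 ≤ C ∧ ∀ d : ℕ, d ≠ 0 → |fco d| ≤ C * (d:ℝ)^ε := by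
  obtain ⟨C, hC, h⟩ := divisors_bound ε hε
  exact ⟨C, hC, fun d hd => (fco_abs_le d).trans (h d hd)⟩

lemma gco_bound (ε : ℝ) (hε : 0 < ε) : ∃ C : ℝ, 1 ≤ C ∧ ∀ d : ℕ, |gco d| ≤ C * (d:ℝ)^(-2 + ε) := by
  obtain ⟨C, hC, h⟩ := fco_bound ε hε
  refine ⟨C, hC, fun d => ?_⟩
  rcases Nat.eq_zero_or_pos d with rfl | hd
  · have h0 : gco 0 = 0 := by simp [gco]
    rw [h0, abs_zero]; positivity
  · have hd0 : (0:ℝ) < d := by exact_mod_cast hd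
    unfold gco
    rw [abs_div, abs_of_pos (by positivity : (0:ℝ) < (d:ℝ)^2), div_le_iff₀ (by positivity)]
    refine (h d hd.ne').trans_eq ?_
    rw [mul_assoc, ← Real.rpow_natCast, ← Real.rpow_add hd0]; congr 2; push_cast; ring

lemma gco_summable : Summable (fun d => ‖gco d‖) := by
  obtain ⟨C, hC, h⟩ := gco_bound (1/2) (by norm_num)
  have hs : Summable (fun d : ℕ => (d:ℝ) ^ (-2 + 1/2 : ℝ)) := Real.summable_nat_rpow.2 (by norm_num)
  have hs' : Summable (fun d : ℕ => C * (d:ℝ) ^ (-2 + 1/2 : ℝ)) := hs.mul_left C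
  exact Summable.of_nonneg_of_le (fun _ => norm_nonneg _) h hs'

lemma euler : ∑' d, gco d = ∏' p : {p : ℕ // p.Prime ∧ p % 4 = 1}, (1 - 2 / (p:ℝ)^2) := by
  have h1 : gco 1 = 1 := by simp [gco, fco_one]
  have hm : ∀ {m n : ℕ}, m.Coprime n → gco (m * n) = gco m * gco n := by
    intro m n h
    unfold gco
    rw [fco_mul m n h]; push_cast; rw [mul_pow, div_mul_div_comm]
  have hE := EulerProduct.eulerProduct_hasProd h1 hm gco_summable (by simp [gco])
  have hin : ∀ p : Nat.Primes, ∑' e, gco ((p:ℕ)^e) = if (p:ℕ) % 4 = 1 then 1 - 2 / ((p:ℕ):ℝ)^2 else 1 := by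
    intro p
    have hp := p.2
    rw [tsum_eq_sum (s := {0, 1}) (by
      intro e he
      have : 2 ≤ e := by
        simp only [Finset.mem_insert, Finset.mem_singleton, not_or] at he; omega
      unfold gco
      rw [fco_prime_pow _ _ hp this, zero_div])]
    rw [Finset.sum_pair (by norm_num), pow_zero, pow_one, h1]
    unfold gco
    rw [fco_prime _ hp]
    split_ifs <;> ring
  simp_rw [hin] at hE
  set g : {p : ℕ // p.Prime ∧ p % 4 = 1} → Nat.Primes := fun p => ⟨p.1, p.2.1⟩ with hg
  have hgi : Function.Injective g := by
    intro p q h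
    have := congrArg Subtype.val h
    exact Subtype.ext this
  rw [← hgi.hasProd_iff (by
    intro p hp
    rw [if_neg]
    intro h
    exact hp ⟨⟨p.1, p.2, h⟩, rfl⟩)] at hE
  rw [← hE.tprod_eq]
  apply tprod_congr
  intro p
  simp only [Function.comp, hg]
  rw [if_pos p.2.2]

lemma tail_bound (ε : ℝ) (hε : 0 < ε) : ∃ C : ℝ, 1 ≤ C ∧ ∀ m : ℕ, ∀ M : ℝ, 1 ≤ M → M ≤ m + 1 →
    2 * ε ≤ 1 → |∑ d ∈ Finset.range (m+1), gco d - ∑' d, gco d| ≤ C * M ^ (-1 + 2 * ε) := by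
  obtain ⟨C, hC, h⟩ := gco_bound ε hε
  have hs : Summable (fun d : ℕ => (d:ℝ) ^ (-1 - ε)) := Real.summable_nat_rpow.2 (by linarith)
  have hsum : Summable gco := gco_summable.of_norm
  have hT0 : 0 ≤ ∑' d : ℕ, (d:ℝ) ^ (-1 - ε) := tsum_nonneg (fun _ => by positivity)
  have hCT : 1 ≤ C * (1 + ∑' d : ℕ, (d:ℝ) ^ (-1 - ε)) := one_le_mul_of_one_le_of_one_le hC (by linarith)
  refine ⟨C * (1 + ∑' d : ℕ, (d:ℝ) ^ (-1 - ε)), hCT, ?_⟩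
  intro m M hM hMm hε2
  have e1 := hsum.sum_add_tsum_nat_add (m+1)
  have e2 : ∑ d ∈ Finset.range (m+1), gco d - ∑' d, gco d = - ∑' d, gco (d + (m+1)) := by rw [← e1]; ring
  rw [e2, abs_neg]
  have hs' : Summable (fun d : ℕ => ((d + (m+1) : ℕ):ℝ) ^ (-1 - ε)) :=
    hs.comp_injective (add_left_injective (m+1))
  have hle : ∀ d : ℕ, ‖gco (d + (m+1))‖ ≤ C * M ^ (-1 + 2*ε) * ((d + (m+1) : ℕ):ℝ) ^ (-1 - ε) := by
    intro d
    rw [Real.norm_eq_abs]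
    refine (h (d + (m+1))).trans ?_
    have hge : M ≤ ((d + (m+1) : ℕ):ℝ) := by push_cast; have : (0:ℝ) ≤ d := by positivity
                                             linarith
    set t : ℝ := ((d + (m+1) : ℕ):ℝ)
    have ht : 0 < t := by linarith
    have e3 : t ^ (-2 + ε) = t ^ (-1 + 2*ε) * t ^ (-1 - ε) := by
      rw [← Real.rpow_add ht]; congr 1; ring
    rw [e3, mul_assoc]
    have e4 : t ^ (-1 + 2*ε) ≤ M ^ (-1 + 2*ε) := Real.rpow_le_rpow_of_nonpos (by linarith) hge (by linarith)
    gcongr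
  have h1 := tsum_of_norm_bounded (hs'.mul_left (C * M ^ (-1 + 2*ε))).hasSum hle
  rw [Real.norm_eq_abs] at h1
  refine h1.trans ?_
  rw [tsum_mul_left]
  have h2 : ∑' d : ℕ, ((d + (m+1) : ℕ):ℝ) ^ (-1 - ε) ≤ ∑' d : ℕ, (d:ℝ) ^ (-1 - ε) := by
    have := hs.sum_add_tsum_nat_add (m+1)
    have h3 : 0 ≤ ∑ d ∈ Finset.range (m+1), (d:ℝ) ^ (-1 - ε) := Finset.sum_nonneg (fun _ _ => by positivity)
    linarith
  have hMp : 0 < M ^ (-1 + 2*ε) := by positivity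
  calc _ ≤ C * M ^ (-1 + 2*ε) * (1 + ∑' d : ℕ, (d:ℝ) ^ (-1 - ε)) := by gcongr; linarith
    _ = _ := by ring

/-- Moebius identity -/
lemma moebius_sq_sum (m : ℕ) (hm : 0 < m) (S : Finset ℕ) (hS : ∀ d, d^2 ∣ m → d ∈ S) :
    ∑ d ∈ S, (if d^2 ∣ m then (ArithmeticFunction.moebius d : ℝ) else 0) = if Squarefree m then 1 else 0 := by
  obtain ⟨a, b, ha, hb, hab, hsq⟩ := Nat.sq_mul_squarefree_of_pos hm
  have hiff : ∀ d, d^2 ∣ m ↔ d ∣ b := by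
    intro d
    constructor
    · intro h
      rw [← hab] at h
      have := (Nat.squarefree_iff_prime_squarefree).1 hsq
      by_contra hc
      have hg : 0 < d.gcd b := Nat.gcd_pos_of_pos_right _ hb
      obtain ⟨d', hd'⟩ := Nat.gcd_dvd_left d b
      obtain ⟨b', hb'⟩ := Nat.gcd_dvd_right d b
      have hcop : d'.Coprime b' := by
        have := Nat.coprime_div_gcd_div_gcd hg
        rwa [Nat.div_eq_of_eq_mul_right hg hd', Nat.div_eq_of_eq_mul_right hg hb'] at this
      have h3 : d'^2 ∣ b'^2 * a := by
        have : (d.gcd b)^2 * d'^2 ∣ (d.gcd b)^2 * (b'^2 * a) := by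
          rw [← mul_pow, ← hd', ← mul_assoc, ← mul_pow, ← hb']; exact h
        exact Nat.dvd_of_mul_dvd_mul_left (by positivity) this
      have h4 : d'^2 ∣ a := (Nat.Coprime.pow 2 2 hcop).dvd_of_dvd_mul_left h3
      have h5 : d' = 1 := by
        have := hsq d' (by rw [← pow_two]; exact h4)
        exact Nat.isUnit_iff.1 this
      apply hc
      rw [hd', h5, mul_one]; exact Nat.gcd_dvd_right d b
    · intro h; rw [← hab]; exact (pow_dvd_pow_of_dvd h 2).mul_right a
  rw [← Finset.sum_filter]
  have hfil : S.filter (fun d => d^2 ∣ m) = b.divisors := by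
    ext d
    rw [Finset.mem_filter, Nat.mem_divisors, hiff]
    constructor
    · exact fun h => ⟨h.2, hb.ne'⟩
    · exact fun h => ⟨hS d ((hiff d).2 h.1), h.1⟩
  rw [hfil]
  have hz := congrArg (fun f => f b) ArithmeticFunction.moebius_mul_coe_zeta
  simp only [ArithmeticFunction.coe_mul_zeta_apply, ArithmeticFunction.one_apply] at hz
  have hz' : ∑ d ∈ b.divisors, (ArithmeticFunction.moebius d : ℝ) = if b = 1 then 1 else 0 := by
    exact_mod_cast hz
  rw [hz']
  have : b = 1 ↔ Squarefree m := by
    constructor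
    · rintro rfl; rw [← hab]; simpa using hsq
    · intro h
      exact Nat.isUnit_iff.1 (h b (by rw [← hab]; exact ⟨a, by ring⟩))
  simp only [this]

end SFV


namespace SFV
open Finset Filter

noncomputable def Ad (X d : ℕ) : ℕ := ((Finset.Ioc 0 X).filter (fun n => d^2 ∣ n^2+1)).card

lemma res_count (X q v : ℕ) (hq : 0 < q) (x : ℝ) (h1 : (X:ℝ) ≤ x) (h2 : x < X + 1) :
    |(((Finset.Ioc 0 X).filter (fun n => n ≡ v [MOD q])).card : ℝ) - x / q| ≤ 2 := by
  have h := Nat.Ioc_filter_modEq_card 0 X hq v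
  have hq0 : (0:ℚ) < q := by exact_mod_cast hq
  have hq1 : (1:ℝ) ≤ q := by exact_mod_cast hq
  set A := ⌊((X:ℚ) - v) / q⌋ with hA
  set B := ⌊(((0:ℕ):ℚ) - v) / q⌋ with hB
  have hAB : B ≤ A := by
    apply Int.floor_le_floor
    gcongr
    simp
  rw [max_eq_left (by linarith)] at h
  have a1 := Int.floor_le (((X:ℚ) - v) / q)
  have a2 := Int.lt_floor_add_one (((X:ℚ) - v) / q)
  have b1 := Int.floor_le ((((0:ℕ):ℚ) - v) / q)
  have b2 := Int.lt_floor_add_one ((((0:ℕ):ℚ) - v) / q)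
  rw [← hA] at a1 a2
  rw [← hB] at b1 b2
  have e : ((X:ℚ) - v) / q - (((0:ℕ):ℚ) - v) / q = X / q := by push_cast; ring
  set c := ((Finset.Ioc 0 X).filter (fun n => n ≡ v [MOD q])).card
  have hc : (c:ℚ) = A - B := by exact_mod_cast h
  have l1 : (c:ℚ) ≤ X / q + 1 := by linarith
  have l2 : (X:ℚ) / q - 1 ≤ c := by linarith
  have l1' : (c:ℝ) ≤ X / q + 1 := by
    have := (Rat.cast_le (K := ℝ)).2 l1
    push_cast at this; exact this
  have l2' : (X:ℝ) / q - 1 ≤ c := by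
    have := (Rat.cast_le (K := ℝ)).2 l2
    push_cast at this; exact this
  have f1 : (X:ℝ) / q ≤ x / q := by gcongr
  have f2 : x / q ≤ X / q + 1 := by
    have : x / q ≤ (X + 1) / q := by gcongr
    have : (1:ℝ) / q ≤ 1 := by rw [div_le_one (by linarith)]; exact hq1
    rw [add_div] at *; linarith
  rw [abs_le]; constructor <;> linarith

lemma Ad_count (X d : ℕ) (hd : 0 < d) (x : ℝ) (h1 : (X:ℝ) ≤ x) (h2 : x < X + 1) :
    |(Ad X d : ℝ) - rho d * (x / (d:ℝ)^2)| ≤ 2 * rho d := by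
  classical
  have hq : 0 < d^2 := by positivity
  haveI : NeZero (d^2) := ⟨hq.ne'⟩
  set R : Finset (ZMod (d^2)) := Finset.univ.filter (fun y => y^2+1=0) with hR
  have hrho : rho d = R.card := by
    unfold rho; rw [Nat.card_eq_fintype_card, Fintype.card_subtype]
  set T := (Finset.Ioc 0 X).filter (fun n => d^2 ∣ n^2+1) with hT
  have hmaps : ∀ n ∈ T, ((n : ZMod (d^2))) ∈ R := by
    intro n hn
    rw [hR, Finset.mem_filter]
    exact ⟨Finset.mem_univ _, (zmod_root_iff d n).2 (Finset.mem_filter.1 hn).2⟩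
  have hcard := Finset.card_eq_sum_card_fiberwise hmaps
  have hfib : ∀ y ∈ R, T.filter (fun n : ℕ => (n : ZMod (d^2)) = y) = (Finset.Ioc 0 X).filter (fun n => n ≡ y.val [MOD d^2]) := by
    intro y hy
    ext n
    rw [hT, Finset.mem_filter, Finset.mem_filter, Finset.mem_filter, ← ZMod.natCast_eq_natCast_iff, ZMod.natCast_zmod_val]
    constructor
    · exact fun h => ⟨h.1.1, h.2⟩
    · intro h
      refine ⟨⟨h.1, ?_⟩, h.2⟩
      rw [← zmod_root_iff, h.2]
      exact (Finset.mem_filter.1 hy).2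
  rw [Finset.sum_congr rfl (fun y hy => congrArg Finset.card (hfib y hy))] at hcard
  have e1 : (Ad X d : ℝ) - rho d * (x / (d:ℝ)^2) =
      ∑ y ∈ R, ((((Finset.Ioc 0 X).filter (fun n => n ≡ y.val [MOD d^2])).card : ℝ) - x / ((d^2:ℕ):ℝ)) := by
    rw [Finset.sum_sub_distrib, Finset.sum_const, nsmul_eq_mul, hrho]
    unfold Ad
    rw [hcard]; push_cast; rfl
  rw [e1]
  refine (Finset.abs_sum_le_sum_abs _ _).trans ?_
  refine (Finset.sum_le_card_nsmul _ _ 2 (fun y _ => res_count X (d^2) y.val hq x h1 h2)).trans ?_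
  rw [nsmul_eq_mul, hrho]; linarith

theorem main_bound (x M : ℝ) (hM : 1 ≤ M) (hMx : M ≤ x) (B1 B2 : ℝ)
    (hf : ∀ d : ℕ, d ≠ 0 → (d:ℝ) ≤ M → |fco d| ≤ B1) 
    (hB2 : ∀ V : Finset (ℕ × ℕ), (∀ p ∈ V, 1 ≤ p.1 ∧ (p.1 : ℝ) ≤ x ∧ p.2^2 ∣ p.1^2+1 ∧ M < p.2) → (V.card : ℝ) ≤ B2) :
    |(((Finset.Icc 1 ⌊x⌋₊).filter (fun n => Squarefree (n ^ 2 + 1))).card : ℝ) - x * ∑ d ∈ Finset.range (⌊M⌋₊+1), gco d|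
      ≤ 2 * M * B1 + B2 := by
  classical
  have hx : 0 ≤ x := by linarith
  set X := ⌊x⌋₊ with hX
  set m := ⌊M⌋₊ with hm
  have hXx : (X:ℝ) ≤ x := Nat.floor_le hx
  have hxX : x < X + 1 := Nat.lt_floor_add_one x
  have hmM : (m:ℝ) ≤ M := Nat.floor_le (by linarith)
  have hmX : m ≤ X := Nat.floor_le_floor hMx
  have hI : Finset.Icc 1 X = Finset.Ioc 0 X := by ext; simp [Finset.mem_Icc, Finset.mem_Ioc]; omega
  set S := Finset.range (X+2) with hS
  -- step 1
  have s1 : (((Finset.Icc 1 X).filter (fun n => Squarefree (n ^ 2 + 1))).card : ℝ) =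
      ∑ d ∈ S, ∑ n ∈ Finset.Ioc 0 X, (if d^2 ∣ n^2+1 then (ArithmeticFunction.moebius d : ℝ) else 0) := by
    rw [Finset.sum_comm, hI, Finset.card_filter]; push_cast
    apply Finset.sum_congr rfl
    intro n hn
    rw [moebius_sq_sum (n^2+1) (by positivity) S]
    intro d hd
    rw [Finset.mem_Ioc] at hn
    have h1 := Nat.le_of_dvd (by positivity) hd
    rw [hS, Finset.mem_range]
    by_contra hc
    have : X + 2 ≤ d := by omega
    nlinarith
  have s2 : ∀ d, ∑ n ∈ Finset.Ioc 0 X, (if d^2 ∣ n^2+1 then (ArithmeticFunction.moebius d : ℝ) else 0) =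
      (ArithmeticFunction.moebius d : ℝ) * Ad X d := by
    intro d
    rw [← Finset.sum_filter, Finset.sum_const, nsmul_eq_mul, mul_comm]; rfl
  have hsplit : S = Finset.range (m+1) ∪ Finset.Ico (m+1) (X+2) := by
    rw [hS]; ext d; simp only [Finset.mem_union, Finset.mem_range, Finset.mem_Ico]; omega
  have hdisj : Disjoint (Finset.range (m+1)) (Finset.Ico (m+1) (X+2)) := by
    rw [Finset.disjoint_left]; intro d; simp only [Finset.mem_range, Finset.mem_Ico]; omega
  rw [s1, Finset.sum_congr rfl (fun d _ => s2 d), hsplit, Finset.sum_union hdisj]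
  have habsmu : ∀ d : ℕ, |(ArithmeticFunction.moebius d : ℝ)| ≤ 1 := by
    intro d; exact_mod_cast ArithmeticFunction.abs_moebius_le_one (n := d)
  -- large part
  have hlarge : |∑ d ∈ Finset.Ico (m+1) (X+2), (ArithmeticFunction.moebius d : ℝ) * Ad X d| ≤ B2 := by
    refine (Finset.abs_sum_le_sum_abs _ _).trans ?_
    set V := ((Finset.Ioc 0 X) ×ˢ (Finset.Ico (m+1) (X+2))).filter (fun p : ℕ × ℕ => p.2^2 ∣ p.1^2+1) with hV
    have hVc : (V.card : ℝ) = ∑ d ∈ Finset.Ico (m+1) (X+2), (Ad X d : ℝ) := by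
      rw [hV, Finset.card_filter, Finset.sum_product_right]
      push_cast
      apply Finset.sum_congr rfl
      intro d _
      unfold Ad
      rw [Finset.card_filter]; push_cast; rfl
    calc _ ≤ ∑ d ∈ Finset.Ico (m+1) (X+2), (Ad X d : ℝ) := by
          apply Finset.sum_le_sum
          intro d _
          rw [abs_mul, abs_of_nonneg (by positivity : (0:ℝ) ≤ (Ad X d:ℝ))]
          have : (0:ℝ) ≤ (Ad X d:ℝ) := by positivity
          nlinarith [habsmu d]
      _ = V.card := hVc.symm
      _ ≤ B2 := by
          apply hB2
          intro p hp
          obtain ⟨hp1, hp2⟩ := Finset.mem_filter.1 hp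
          rw [Finset.mem_product, Finset.mem_Ioc, Finset.mem_Ico] at hp1
          refine ⟨hp1.1.1, ?_, hp2, ?_⟩
          · have : (p.1:ℝ) ≤ X := by exact_mod_cast hp1.1.2
            linarith
          · have : ((m+1 : ℕ):ℝ) ≤ p.2 := by exact_mod_cast hp1.2.1
            have h3 := Nat.lt_floor_add_one M
            push_cast at this
            linarith
  have hsmall : |∑ d ∈ Finset.range (m+1), (ArithmeticFunction.moebius d : ℝ) * Ad X d - x * ∑ d ∈ Finset.range (m+1), gco d| ≤ 2 * M * B1 := by
    rw [Finset.mul_sum, ← Finset.sum_sub_distrib, Finset.sum_range_succ']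
    have h0 : (ArithmeticFunction.moebius 0 : ℝ) * Ad X 0 - x * gco 0 = 0 := by simp [gco]
    rw [h0, add_zero]
    refine (Finset.abs_sum_le_sum_abs _ _).trans ?_
    have hB10 : 0 ≤ B1 := (abs_nonneg _).trans (hf 1 one_ne_zero (by simpa using hM))
    refine (Finset.sum_le_card_nsmul _ _ (2 * B1) ?_).trans ?_
    · intro d hd
      rw [Finset.mem_range] at hd
      have hdM : ((d+1:ℕ):ℝ) ≤ M := by
        have : ((d+1:ℕ):ℝ) ≤ m := by exact_mod_cast hd
        linarith
      have e : (ArithmeticFunction.moebius (d+1) : ℝ) * Ad X (d+1) - x * gco (d+1) =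
          (ArithmeticFunction.moebius (d+1) : ℝ) * ((Ad X (d+1):ℝ) - rho (d+1) * (x / ((d+1:ℕ):ℝ)^2)) := by
        unfold gco fco; ring
      rw [e, abs_mul]
      have h3 := Ad_count X (d+1) (by omega) x hXx hxX
      have h4 := hf (d+1) (by omega) hdM
      unfold fco at h4
      rw [abs_mul, abs_of_nonneg (by positivity : (0:ℝ) ≤ (rho (d+1):ℝ))] at h4
      calc _ ≤ |(ArithmeticFunction.moebius (d+1) : ℝ)| * (2 * rho (d+1)) := by gcongr
        _ ≤ _ := by linarith
    · rw [Finset.card_range, nsmul_eq_mul]; nlinarith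
  set P := ∑ d ∈ Finset.range (m+1), (ArithmeticFunction.moebius d : ℝ) * Ad X d
  set Q := ∑ d ∈ Finset.Ico (m+1) (X+2), (ArithmeticFunction.moebius d : ℝ) * Ad X d
  set G := x * ∑ d ∈ Finset.range (m+1), gco d
  rw [abs_le] at *
  constructor <;> linarith [hlarge.1, hlarge.2, hsmall.1, hsmall.2]

end SFV


namespace SFV
open Finset Filter

theorem final_large : ∃ C : ℝ, 0 ≤ C ∧ ∀ᶠ x : ℝ in atTop,
    |(((Finset.Icc 1 ⌊x⌋₊).filter (fun n => Squarefree (n ^ 2 + 1))).card : ℝ) - x * ∑' d, gco d|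
      ≤ C * x ^ (576/1000:ℝ) := by
  obtain ⟨C1, hC1, hf⟩ := fco_bound (1/1000) (by norm_num)
  obtain ⟨C2, hC2, hmid⟩ := middle_count (1/1000) (by norm_num)
  obtain ⟨C3, hC3, hlar⟩ := large_count (1/1000) (by norm_num)
  obtain ⟨C4, hC4, htail⟩ := tail_bound (1/1000) (by norm_num)
  refine ⟨2 * C1 + (C2 + C3) + C4, by linarith, ?_⟩
  filter_upwards [hmid, eventually_ge_atTop 1] with x hmid hx
  have hx0 : 0 < x := by linarith
  set M := x ^ (23/40:ℝ) with hMd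
  have hM : 1 ≤ M := Real.one_le_rpow hx (by norm_num)
  have hMx : M ≤ x := by
    conv_rhs => rw [← Real.rpow_one x]
    exact Real.rpow_le_rpow_of_exponent_le hx (by norm_num)
  have hexp : (23/40 + 1/1000 : ℝ) = 576/1000 := by norm_num
  rw [hexp] at hmid
  have hlarx := hlar x hx
  rw [hexp] at hlarx
  set Z := x ^ (576/1000:ℝ) with hZ
  have hmain := main_bound x M hM hMx (C1 * x ^ (1/1000:ℝ)) ((C2 + C3) * Z) (by
    intro d hd hdM
    refine (hf d hd).trans ?_
    have : (d:ℝ) ≤ x := hdM.trans hMx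
    gcongr) (by
    intro V hV
    classical
    have h1 := hmid (V.filter (fun p => (p.2:ℝ) ≤ x ^ (57/80:ℝ))) (by
      intro p hp
      obtain ⟨hp, hk⟩ := Finset.mem_filter.1 hp
      have := hV p hp
      exact ⟨this.2.1, this.2.2.1, this.2.2.2, hk⟩)
    have h2 := hlarx (V.filter (fun p => ¬ (p.2:ℝ) ≤ x ^ (57/80:ℝ))) (by
      intro p hp
      obtain ⟨hp, hk⟩ := Finset.mem_filter.1 hp
      have := hV p hp
      exact ⟨this.1, this.2.1, this.2.2.1, not_le.1 hk⟩)
    have hs : (V.card : ℝ) = (V.filter (fun p => (p.2:ℝ) ≤ x ^ (57/80:ℝ))).card + (V.filter (fun p => ¬ (p.2:ℝ) ≤ x ^ (57/80:ℝ))).card := by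
      exact_mod_cast (Finset.card_filter_add_card_filter_not (s := V) (fun p => (p.2:ℝ) ≤ x ^ (57/80:ℝ))).symm
    rw [hs]; linarith)
  have ht := htail ⌊M⌋₊ M hM (Nat.lt_floor_add_one M).le (by norm_num)
  have e1 : 2 * M * (C1 * x ^ (1/1000:ℝ)) = 2 * C1 * Z := by
    have : Z = M * x ^ (1/1000:ℝ) := by rw [hZ, hMd, ← Real.rpow_add hx0, hexp]
    rw [this]; ring
  have e2 : x * M ^ (-1 + 2 * (1/1000) : ℝ) ≤ Z := by
    rw [hMd, ← Real.rpow_mul hx0.le, mul_comm, ← Real.rpow_add_one hx0.ne', hZ]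
    exact Real.rpow_le_rpow_of_exponent_le hx (by norm_num)
  set N := (((Finset.Icc 1 ⌊x⌋₊).filter (fun n => Squarefree (n ^ 2 + 1))).card : ℝ)
  set P := ∑ d ∈ Finset.range (⌊M⌋₊+1), gco d
  set G := ∑' d, gco d
  have e3 : |x * P - x * G| ≤ C4 * Z := by
    rw [← mul_sub, abs_mul, abs_of_pos hx0]
    calc x * |P - G| ≤ x * (C4 * M ^ (-1 + 2 * (1/1000) : ℝ)) := by gcongr
      _ = C4 * (x * M ^ (-1 + 2 * (1/1000) : ℝ)) := by ring
      _ ≤ _ := by gcongr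
  rw [e1] at hmain
  calc |N - x * G| ≤ |N - x * P| + |x * P - x * G| := abs_sub_le _ _ _
    _ ≤ _ := by linarith

theorem final_all : ∃ C : ℝ, ∀ x : ℝ, 2 ≤ x → ∀ t : ℝ, 576/1000 ≤ t →
    |(((Finset.Icc 1 ⌊x⌋₊).filter (fun n => Squarefree (n ^ 2 + 1))).card : ℝ) - x * ∑' d, gco d| ≤ C * x ^ t := by
  obtain ⟨C, hC, h⟩ := final_large
  obtain ⟨x0, hx0⟩ := eventually_atTop.1 h
  set G := ∑' d, gco d
  refine ⟨max C (|x0| * (1 + |G|)), ?_⟩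
  intro x hx t ht
  have hxt : 1 ≤ x ^ t := Real.one_le_rpow (by linarith) (by linarith)
  rcases le_or_gt x0 x with hc | hc
  · refine (hx0 x hc).trans ?_
    have h1 : x ^ (576/1000:ℝ) ≤ x ^ t := Real.rpow_le_rpow_of_exponent_le (by linarith) ht
    calc _ ≤ C * x ^ t := by gcongr
      _ ≤ _ := by gcongr; exact le_max_left _ _
  · have hle : (((Finset.Icc 1 ⌊x⌋₊).filter (fun n => Squarefree (n ^ 2 + 1))).card : ℝ) ≤ x := by
      have h1 := Finset.card_filter_le (Finset.Icc 1 ⌊x⌋₊) (fun n => Squarefree (n ^ 2 + 1))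
      rw [Nat.card_Icc, Nat.add_sub_cancel] at h1
      have h2 : (((Finset.Icc 1 ⌊x⌋₊).filter (fun n => Squarefree (n ^ 2 + 1))).card : ℝ) ≤ ⌊x⌋₊ := by exact_mod_cast h1
      exact h2.trans (Nat.floor_le (by linarith))
    have hx0' : x ≤ |x0| := hc.le.trans (le_abs_self x0)
    have h3 : |(((Finset.Icc 1 ⌊x⌋₊).filter (fun n => Squarefree (n ^ 2 + 1))).card : ℝ) - x * G| ≤ |x0| * (1 + |G|) := by
      refine (abs_sub _ _).trans ?_
      rw [abs_mul, abs_of_pos (by linarith : 0 < x), abs_of_nonneg (by positivity)]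
      have := abs_nonneg G
      nlinarith
    have h4 : 0 ≤ |x0| * (1 + |G|) := by positivity
    calc _ ≤ |x0| * (1 + |G|) := h3
      _ ≤ (|x0| * (1 + |G|)) * x ^ t := le_mul_of_one_le_right h4 hxt
      _ ≤ _ := by gcongr; exact le_max_right _ _

end SFV

theorem squarefree_values_of_n_sq_add_one_improved (ε : ℝ) (hε : 0 < ε) :
    ∃ C : ℝ, ∀ x : ℝ, 2 ≤ x →
      |(countSquarefreeVals x : ℝ) - squarefreeConstant * x| ≤
        C * x ^ (varpi + ε : ℝ) := by
  obtain ⟨C, hC⟩ := SFV.final_all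
  refine ⟨C, fun x hx => ?_⟩
  have hs : (20.8:ℝ) ≤ Real.sqrt 433 := by
    apply Real.le_sqrt_of_sq_le; norm_num
  have hv : (576/1000:ℝ) ≤ varpi + ε := by
    unfold varpi; linarith
  have h := hC x hx (varpi + ε) hv
  rw [SFV.euler, mul_comm] at h
  exact h
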